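/- Suppose that (λ−3)n > 2δ + 2γ. Let ω ∈ A₁ and f ∈ BMO(ω). If G*_λ(f)(x₀) < +∞ for at least one point x₀ ∈ ℝⁿ, then G*_λ(f)(x) < +∞ for almost every x ∈ ℝⁿ, and there exists a constant C > 0, independent of f, such that ‖G*_λ(f)‖_{BLO(ω)} ≤ C · ‖f‖_{BMO(ω)}. -/

import Mathlib

open MeasureTheory Metric Set ENNReal

noncomputable section

namespace LPW

variable {n : ℕ}

/-- n-dimensional Euclidean space. -/
abbrev Rn (n : ℕ) := EuclideanSpace ℝ (Fin n)

/-- Axis-parallel open cube with center `c` and half-side `h`. -/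
def cube (c : Rn n) (h : ℝ) : Set (Rn n) := {y : Rn n | ∀ i, |y i - c i| < h}

/-- The ω-measure `ω(E) = ∫_E ω`. -/
def wInt (ω : Rn n → ℝ) (E : Set (Rn n)) : ℝ := ∫ x in E, ω x

/-- The Lebesgue mean value `f_E = (1/m(E)) ∫_E f`. -/
def avg (f : Rn n → ℝ) (E : Set (Rn n)) : ℝ := ((volume E).toReal)⁻¹ * ∫ x in E, f x

/-- Weighted mean oscillation `(1/ω(E)) ∫_E |f - f_E|`. -/
def bmoAvg (ω f : Rn n → ℝ) (E : Set (Rn n)) : ℝ :=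
  (wInt ω E)⁻¹ * ∫ x in E, |f x - avg f E|

/-- Weighted lower oscillation `(1/ω(E)) ∫_E (f - essinf_E f)`. -/
def bloAvg (ω f : Rn n → ℝ) (E : Set (Rn n)) : ℝ :=
  (wInt ω E)⁻¹ * ∫ x in E, (f x - essInf f (volume.restrict E))

/-- `‖f‖_{BMO(ω)}`, supremum over all balls, valued in `[0,∞]`. -/
def bmoNorm (ω f : Rn n → ℝ) : ℝ≥0∞ :=
  ⨆ (c : Rn n) (ρ : ℝ) (_ : 0 < ρ), ENNReal.ofReal (bmoAvg ω f (Metric.ball c ρ))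

/-- `‖f‖_{BLO(ω)}`, supremum over all balls, valued in `[0,∞]`. -/
def bloNorm (ω f : Rn n → ℝ) : ℝ≥0∞ :=
  ⨆ (c : Rn n) (ρ : ℝ) (_ : 0 < ρ), ENNReal.ofReal (bloAvg ω f (Metric.ball c ρ))

/-- `‖f‖_{L^∞(ω)}`, supremum over all balls of `(essinf_B ω)⁻¹ · esssup_B |f|`. -/
def linfNorm (ω f : Rn n → ℝ) : ℝ≥0∞ :=
  ⨆ (c : Rn n) (ρ : ℝ) (_ : 0 < ρ),
    ENNReal.ofReal ((essInf ω (volume.restrict (Metric.ball c ρ)))⁻¹ *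
      essSup (fun x => |f x|) (volume.restrict (Metric.ball c ρ)))

/-- `‖f‖_{BMO(ω)}` taken over cubes. -/
def bmoNormC (ω f : Rn n → ℝ) : ℝ≥0∞ :=
  ⨆ (c : Rn n) (h : ℝ) (_ : 0 < h), ENNReal.ofReal (bmoAvg ω f (cube c h))

/-- `‖f‖_{BLO(ω)}` taken over cubes. -/
def bloNormC (ω f : Rn n → ℝ) : ℝ≥0∞ :=
  ⨆ (c : Rn n) (h : ℝ) (_ : 0 < h), ENNReal.ofReal (bloAvg ω f (cube c h))

/-- `‖f‖_{BMO^p(ω)}` taken over cubes (extended-valued). -/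
def bmoPNorm (p : ℝ) (ω f : Rn n → ℝ) : ℝ≥0∞ :=
  ⨆ (c : Rn n) (h : ℝ) (_ : 0 < h),
    ((ENNReal.ofReal (wInt ω (cube c h)))⁻¹ *
      ∫⁻ x in cube c h,
        ENNReal.ofReal (|f x - avg f (cube c h)| ^ p * (ω x) ^ (1 - p))) ^ (1/p)

/-- `‖f‖_{BLO^p(ω)}` taken over cubes (extended-valued). -/
def bloPNorm (p : ℝ) (ω f : Rn n → ℝ) : ℝ≥0∞ :=
  ⨆ (c : Rn n) (h : ℝ) (_ : 0 < h),
    ((ENNReal.ofReal (wInt ω (cube c h)))⁻¹ *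
      ∫⁻ x in cube c h,
        ENNReal.ofReal ((f x - essInf f (volume.restrict (cube c h))) ^ p * (ω x) ^ (1 - p))) ^ (1/p)

/-- A weight: nonnegative, locally integrable, positive a.e. -/
def IsWeight (ω : Rn n → ℝ) : Prop :=
  (∀ x, 0 ≤ ω x) ∧ LocallyIntegrable ω volume ∧
    ∀ᵐ x ∂(volume : Measure (Rn n)), 0 < ω x

/-- `C` is an `A₁` bound for `ω` (over balls). -/
def A1ballBound (ω : Rn n → ℝ) (C : ℝ) : Prop :=
  0 < C ∧ ∀ (c : Rn n) (ρ : ℝ), 0 < ρ →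
    avg ω (Metric.ball c ρ) ≤ C * essInf ω (volume.restrict (Metric.ball c ρ))

/-- `ω ∈ A₁` (over balls). -/
def IsA1ball (ω : Rn n → ℝ) : Prop := ∃ C, A1ballBound ω C

/-- `[ω]_{A₁}` (over balls), the least `A₁` bound. -/
def A1ballConst (ω : Rn n → ℝ) : ℝ := sInf {C | A1ballBound ω C}

/-- `C` is an `A₁` bound for `ω` (over cubes). -/
def A1cubeBound (ω : Rn n → ℝ) (C : ℝ) : Prop :=
  0 < C ∧ ∀ (c : Rn n) (h : ℝ), 0 < h →
    avg ω (cube c h) ≤ C * essInf ω (volume.restrict (cube c h))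

/-- `ω ∈ A₁` (over cubes). -/
def IsA1cube (ω : Rn n → ℝ) : Prop := ∃ C, A1cubeBound ω C

/-- `[ω]_{A₁}` (over cubes), the least `A₁` bound. -/
def A1cubeConst (ω : Rn n → ℝ) : ℝ := sInf {C | A1cubeBound ω C}

/-- `C` is an `A₂` bound for `ω` (over balls). -/
def A2ballBound (ω : Rn n → ℝ) (C : ℝ) : Prop :=
  0 < C ∧ ∀ (c : Rn n) (ρ : ℝ), 0 < ρ →
    avg ω (Metric.ball c ρ) * avg (fun x => (ω x)⁻¹) (Metric.ball c ρ) ≤ C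

/-- `ω ∈ A₂` (over balls). -/
def IsA2ball (ω : Rn n → ℝ) : Prop := ∃ C, A2ballBound ω C

/-- `[ω]_{A₂}` (over balls), the least `A₂` bound. -/
def A2ballConst (ω : Rn n → ℝ) : ℝ := sInf {C | A2ballBound ω C}

/-- Conditions (P1), (P2), (P3) on the kernel ψ. -/
def PsiKernel (n : ℕ) (C₁ C₂ δ γ : ℝ) (ψ : Rn n → ℝ) : Prop :=
  Integrable ψ volume ∧ (∫ x, ψ x) = 0 ∧
  (∀ x : Rn n, |ψ x| ≤ C₁ * (1 + ‖x‖) ^ (-((n : ℝ) + δ))) ∧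
  (∀ x h : Rn n, 2 * ‖h‖ ≤ ‖x‖ →
    |ψ (x + h) - ψ x| ≤ C₂ * ‖h‖ ^ γ * (1 + ‖x‖) ^ (-((n : ℝ) + δ + γ)))

/-- The convolution `(ψ_t * f)(x)` where `ψ_t(x) = t^{-n} ψ(x/t)`. -/
def cvl (ψ : Rn n → ℝ) (t : ℝ) (f : Rn n → ℝ) (x : Rn n) : ℝ :=
  ∫ y, (t ^ n)⁻¹ * ψ (t⁻¹ • (x - y)) * f y

/-- The generalized Littlewood–Paley g-function `G(f)(x)`, valued in `[0,∞]`. -/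
def Gfun (ψ f : Rn n → ℝ) (x : Rn n) : ℝ≥0∞ :=
  (∫⁻ t in Ioi (0:ℝ), ENNReal.ofReal ((cvl ψ t f x) ^ 2 / t)) ^ (1/2 : ℝ)

/-- The dilated Lusin area integral `S_a(f)(x)` (aperture `a`), valued in `[0,∞]`. -/
def Sdil (ψ : Rn n → ℝ) (a : ℝ) (f : Rn n → ℝ) (x : Rn n) : ℝ≥0∞ :=
  (∫⁻ t in Ioi (0:ℝ), ∫⁻ y in Metric.ball x (a * t),
      ENNReal.ofReal ((cvl ψ t f y) ^ 2 / t ^ (n + 1))) ^ (1/2 : ℝ)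

/-- The generalized Lusin area integral `S(f)(x)`, valued in `[0,∞]`. -/
def Sfun (ψ f : Rn n → ℝ) (x : Rn n) : ℝ≥0∞ := Sdil ψ 1 f x

/-- Stein's function `G*_λ(f)(x)`, valued in `[0,∞]`. -/
def Gstar (ψ : Rn n → ℝ) (lam : ℝ) (f : Rn n → ℝ) (x : Rn n) : ℝ≥0∞ :=
  (∫⁻ t in Ioi (0:ℝ), ∫⁻ y,
      ENNReal.ofReal ((t / (t + dist x y)) ^ (lam * (n : ℝ)) *
        (cvl ψ t f y) ^ 2 / t ^ (n + 1))) ^ (1/2 : ℝ)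



section PA
theorem lint_pow (n : ℕ) (q : ℝ) (hq : (n : ℝ) < q) :
    ∃ C : ℝ, 0 < C ∧ ∀ ρ : ℝ, 0 < ρ → ∀ c : Rn n,
      ∫⁻ y, ENNReal.ofReal ((ρ + dist y c) ^ (-q)) ≤ ENNReal.ofReal (C * ρ ^ ((n : ℝ) - q)) := by
  have hfin : (∫⁻ x : Rn n, ENNReal.ofReal ((1 + ‖x‖) ^ (-q))) < ∞ :=
    finite_integral_one_add_norm (by simpa using hq)
  refine ⟨(∫⁻ x : Rn n, ENNReal.ofReal ((1 + ‖x‖) ^ (-q))).toReal + 1, by positivity, ?_⟩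
  intro ρ hρ c
  set I := ∫⁻ x : Rn n, ENNReal.ofReal ((1 + ‖x‖) ^ (-q)) with hI
  have h1 : ∫⁻ y, ENNReal.ofReal ((ρ + dist y c) ^ (-q))
      = ∫⁻ y : Rn n, ENNReal.ofReal ((ρ + ‖y‖) ^ (-q)) := by
    have := lintegral_sub_right_eq_self (μ := (volume : Measure (Rn n)))
      (fun y => ENNReal.ofReal ((ρ + ‖y‖) ^ (-q))) c
    simpa [dist_eq_norm] using this
  have h2 : ∀ y : Rn n, ENNReal.ofReal ((ρ + ‖y‖) ^ (-q))
      = ENNReal.ofReal (ρ ^ (-q)) * ENNReal.ofReal ((1 + ‖ρ⁻¹ • y‖) ^ (-q)) := by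
    intro y
    rw [← ENNReal.ofReal_mul (by positivity), ← Real.mul_rpow (by positivity) (by positivity)]
    congr 2
    rw [norm_smul, norm_inv, Real.norm_of_nonneg hρ.le]
    field_simp
  have h3 : ∫⁻ y : Rn n, ENNReal.ofReal ((1 + ‖ρ⁻¹ • y‖) ^ (-q))
      = ENNReal.ofReal (ρ ^ n) * I := by
    have hm := Measure.map_addHaar_smul (volume : Measure (Rn n)) (inv_ne_zero hρ.ne')
    have h5 : ∫⁻ y : Rn n, ENNReal.ofReal ((1 + ‖ρ⁻¹ • y‖) ^ (-q))
        = ∫⁻ y, ENNReal.ofReal ((1 + ‖y‖) ^ (-q)) ∂(Measure.map (ρ⁻¹ • ·) (volume : Measure (Rn n))) := by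
      rw [lintegral_map (by fun_prop) (by fun_prop)]
    rw [h5, hm, lintegral_smul_measure]
    simp [hI, abs_of_pos hρ]
  rw [h1]
  simp_rw [h2]
  rw [lintegral_const_mul _ (by fun_prop), h3, ← mul_assoc, ← ENNReal.ofReal_mul (by positivity)]
  have h4 : ρ ^ (-q) * ρ ^ n = ρ ^ ((n : ℝ) - q) := by
    rw [← Real.rpow_natCast, ← Real.rpow_add hρ]; ring_nf
  rw [h4, mul_comm, ENNReal.ofReal_mul (by positivity)]
  gcongr
  rw [ENNReal.le_ofReal_iff_toReal_le hfin.ne (by positivity)]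
  linarith

theorem lint_1d (p q : ℝ) (hp : 0 < p) (hq : 0 < q) :
    ∃ C : ℝ, 0 < C ∧ ∀ D : ℝ, 0 < D →
      ∫⁻ t in Ioi (0:ℝ), ENNReal.ofReal (t ^ (p - 1) * (t + D) ^ (-(p + q)))
        ≤ ENNReal.ofReal (C * D ^ (-q)) := by
  refine ⟨1 / p + 1 / q, by positivity, ?_⟩
  intro D hD
  have hsplit : Ioi (0:ℝ) = Ioc 0 D ∪ Ioi D := (Ioc_union_Ioi_eq_Ioi hD.le).symm
  have e1 : ∫⁻ t in Ioc 0 D, ENNReal.ofReal (t ^ (p - 1) * (t + D) ^ (-(p + q)))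
      ≤ ENNReal.ofReal (1 / p * D ^ (-q)) := by
    calc ∫⁻ t in Ioc 0 D, ENNReal.ofReal (t ^ (p - 1) * (t + D) ^ (-(p + q)))
        ≤ ∫⁻ t in Ioc 0 D, ENNReal.ofReal (t ^ (p - 1) * D ^ (-(p + q))) := by
          refine setLIntegral_mono (by fun_prop) ?_
          intro t ht
          apply ENNReal.ofReal_le_ofReal
          have ht0 : 0 < t := ht.1
          apply mul_le_mul_of_nonneg_left _ (by positivity)
          exact Real.rpow_le_rpow_of_nonpos hD (by linarith) (by linarith)
      _ = ENNReal.ofReal (∫ t in Ioc 0 D, t ^ (p - 1) * D ^ (-(p + q))) := by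
          rw [ofReal_integral_eq_lintegral_ofReal]
          · apply Integrable.mul_const
            rw [← IntegrableOn, ← intervalIntegrable_iff_integrableOn_Ioc_of_le hD.le]
            exact intervalIntegral.intervalIntegrable_rpow' (by linarith)
          · filter_upwards [ae_restrict_mem measurableSet_Ioc] with t ht
            have ht0 : 0 < t := ht.1
            positivity
      _ = _ := by
          congr 1
          rw [integral_mul_const, ← intervalIntegral.integral_of_le hD.le,
            integral_rpow (Or.inl (by linarith))]
          simp only [sub_add_cancel]
          rw [Real.zero_rpow hp.ne', sub_zero, div_mul_eq_mul_div, ← Real.rpow_add hD]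
          ring_nf
  have e2 : ∫⁻ t in Ioi D, ENNReal.ofReal (t ^ (p - 1) * (t + D) ^ (-(p + q)))
      ≤ ENNReal.ofReal (1 / q * D ^ (-q)) := by
    calc ∫⁻ t in Ioi D, ENNReal.ofReal (t ^ (p - 1) * (t + D) ^ (-(p + q)))
        ≤ ∫⁻ t in Ioi D, ENNReal.ofReal (t ^ (-q - 1)) := by
          refine setLIntegral_mono (by fun_prop) ?_
          intro t ht
          have ht0 : 0 < t := hD.trans ht
          apply ENNReal.ofReal_le_ofReal
          calc t ^ (p - 1) * (t + D) ^ (-(p + q)) ≤ t ^ (p - 1) * t ^ (-(p + q)) := by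
                apply mul_le_mul_of_nonneg_left _ (by positivity)
                exact Real.rpow_le_rpow_of_nonpos ht0 (by linarith) (by linarith)
            _ = _ := by rw [← Real.rpow_add ht0]; ring_nf
      _ = ENNReal.ofReal (∫ t in Ioi D, t ^ (-q - 1)) := by
          rw [ofReal_integral_eq_lintegral_ofReal]
          · exact integrableOn_Ioi_rpow_of_lt (by linarith) hD
          · filter_upwards [ae_restrict_mem measurableSet_Ioi] with t ht
            have ht0 : 0 < t := hD.trans ht
            positivity
      _ = _ := by
          rw [integral_Ioi_rpow_of_lt (by linarith) hD]
          simp only [sub_add_cancel]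
          congr 1
          field_simp
  rw [hsplit]
  refine (lintegral_union_le _ _ _).trans ((add_le_add e1 e2).trans ?_)
  rw [← ENNReal.ofReal_add (by positivity) (by positivity), add_mul]

end PA

section PB
/-- Product measure on the upper half space. -/
def PM (n : ℕ) : Measure (ℝ × Rn n) := (volume.restrict (Ioi (0:ℝ))).prod volume

instance : SFinite (PM n) := by unfold PM; infer_instance

theorem PM_pos : ∀ᵐ p ∂(PM n), 0 < p.1 := by
  have h : PM n = ((volume : Measure ℝ).prod (volume : Measure (Rn n))).restrict (Ioi 0 ×ˢ univ) := by
    unfold PM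
    rw [← Measure.prod_restrict, Measure.restrict_univ]
  rw [h]
  filter_upwards [ae_restrict_mem (measurableSet_Ioi.prod MeasurableSet.univ)] with p hp
  exact hp.1

/-- Weight. -/
def wt (a : ℝ) (x : Rn n) (p : ℝ × Rn n) : ℝ≥0∞ :=
  ENNReal.ofReal ((p.1 / (p.1 + dist x p.2)) ^ a / p.1 ^ (n + 1))

theorem wt_meas (a : ℝ) : Measurable (fun q : Rn n × (ℝ × Rn n) => wt a q.1 q.2) := by
  unfold wt; fun_prop

theorem wt_meas' (a : ℝ) (x : Rn n) : Measurable (wt a x) := by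
  unfold wt; fun_prop

theorem wt_meas'' (a : ℝ) (p : ℝ × Rn n) : Measurable (fun x => wt a x p) := by
  unfold wt; fun_prop

/-- Abstract square function. -/
def Gs (a : ℝ) (Φ : ℝ × Rn n → ℝ≥0∞) (x : Rn n) : ℝ≥0∞ :=
  (∫⁻ p, wt a x p * Φ p ^ 2 ∂(PM n)) ^ (1/2 : ℝ)

theorem Gs_sq (a : ℝ) (Φ : ℝ × Rn n → ℝ≥0∞) (x : Rn n) :
    Gs a Φ x ^ 2 = ∫⁻ p, wt a x p * Φ p ^ 2 ∂(PM n) := by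
  unfold Gs
  rw [← ENNReal.rpow_natCast, ← ENNReal.rpow_mul]; norm_num

theorem Gs_le_of_sq {a : ℝ} {Φ : ℝ × Rn n → ℝ≥0∞} {x : Rn n} {M : ℝ≥0∞}
    (h : ∫⁻ p, wt a x p * Φ p ^ 2 ∂(PM n) ≤ M ^ 2) : Gs a Φ x ≤ M := by
  rw [← Gs_sq] at h
  exact (ENNReal.pow_le_pow_left_iff two_ne_zero).1 h

theorem Gs_mono {a : ℝ} {Φ Φ' : ℝ × Rn n → ℝ≥0∞} (h : ∀ p : ℝ × Rn n, 0 < p.1 → Φ p ≤ Φ' p) (x : Rn n) :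
    Gs a Φ x ≤ Gs a Φ' x := by
  unfold Gs
  gcongr ?_ ^ _
  apply lintegral_mono_ae
  filter_upwards [PM_pos] with p hp
  gcongr
  exact h p hp

theorem Gs_congr {a : ℝ} {Φ Φ' : ℝ × Rn n → ℝ≥0∞} (h : Φ =ᵐ[PM n] Φ') (x : Rn n) :
    Gs a Φ x = Gs a Φ' x := by
  unfold Gs
  congr 1
  apply lintegral_congr_ae
  filter_upwards [h] with p hp
  rw [hp]

theorem Gs_meas (a : ℝ) {Φ : ℝ × Rn n → ℝ≥0∞} (h : AEMeasurable Φ (PM n)) : Measurable (Gs a Φ) := by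
  have : Gs a Φ = Gs a (h.mk Φ) := by
    ext x; exact Gs_congr h.ae_eq_mk x
  rw [this]
  unfold Gs
  apply Measurable.pow_const
  have hm : Measurable (h.mk Φ) := h.measurable_mk
  exact Measurable.lintegral_prod_right' (f := fun q : Rn n × (ℝ × Rn n) => wt a q.1 q.2 * h.mk Φ q.2 ^ 2)
    ((wt_meas a).mul ((hm.comp measurable_snd).pow_const 2))

theorem Gs_withDensity (a : ℝ) (Φ : ℝ × Rn n → ℝ≥0∞) (x : Rn n) :
    Gs a Φ x = (∫⁻ p, Φ p ^ (2:ℝ) ∂((PM n).withDensity (wt a x))) ^ (1/2 : ℝ) := by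
  unfold Gs
  rw [lintegral_withDensity_eq_lintegral_mul_non_measurable _ (wt_meas' a x)]
  · simp
  · exact Filter.Eventually.of_forall fun p => by simp [wt]

theorem Gs_add (a : ℝ) {Φ Φ' : ℝ × Rn n → ℝ≥0∞} (h : AEMeasurable Φ (PM n)) (h' : AEMeasurable Φ' (PM n))
    (x : Rn n) : Gs a (Φ + Φ') x ≤ Gs a Φ x + Gs a Φ' x := by
  simp only [Gs_withDensity]
  exact ENNReal.lintegral_Lp_add_le (h.mono_ac (withDensity_absolutelyContinuous _ _))
    (h'.mono_ac (withDensity_absolutelyContinuous _ _)) (by norm_num)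

theorem Gs_zero (a : ℝ) (x : Rn n) : Gs a (fun _ => 0) x = 0 := by
  simp [Gs]

theorem Gs_iSup (a : ℝ) {Φ : ℕ → ℝ × Rn n → ℝ≥0∞} (h : ∀ i, AEMeasurable (Φ i) (PM n))
    (hm : Monotone Φ) (x : Rn n) : Gs a (fun p => ⨆ i, Φ i p) x = ⨆ i, Gs a (Φ i) x := by
  unfold Gs
  have h1 : ∀ p, wt a x p * (⨆ i, Φ i p) ^ 2 = ⨆ i, wt a x p * (Φ i p) ^ 2 := by
    intro p
    rw [← ENNReal.mul_iSup]
    congr 1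
    have := (ENNReal.orderIsoRpow (2:ℝ) (by norm_num)).map_iSup (fun i => Φ i p)
    simp only [ENNReal.orderIsoRpow_apply, ENNReal.rpow_ofNat] at this
    exact this
  simp_rw [h1]
  rw [lintegral_iSup']
  · have := (ENNReal.orderIsoRpow (1/2:ℝ) (by norm_num)).map_iSup
      (fun i => ∫⁻ p, wt a x p * (Φ i p) ^ 2 ∂(PM n))
    simp only [ENNReal.orderIsoRpow_apply] at this
    exact this
  · intro i
    exact (wt_meas' a x).aemeasurable.mul ((h i).pow_const 2)
  · refine Filter.Eventually.of_forall fun p => ?_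
    intro i j hij
    dsimp
    gcongr
    exact hm hij p

theorem Gs_sum (a : ℝ) {ι : Type*} (s : Finset ι) {Φ : ι → ℝ × Rn n → ℝ≥0∞} (h : ∀ i, AEMeasurable (Φ i) (PM n))
    (x : Rn n) : Gs a (fun p => ∑ i ∈ s, Φ i p) x ≤ ∑ i ∈ s, Gs a (Φ i) x := by
  classical
  induction s using Finset.induction_on with
  | empty => simp [Gs_zero]
  | insert i s hi ih =>
    simp_rw [Finset.sum_insert hi]
    exact (Gs_add a (h i) (Finset.aemeasurable_fun_sum s (fun i _ => h i)) x).trans (by gcongr)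

theorem Gs_tsum (a : ℝ) {Φ : ℕ → ℝ × Rn n → ℝ≥0∞} (h : ∀ i, AEMeasurable (Φ i) (PM n))
    (x : Rn n) : Gs a (fun p => ∑' i, Φ i p) x ≤ ∑' i, Gs a (Φ i) x := by
  simp_rw [ENNReal.tsum_eq_iSup_nat]
  rw [Gs_iSup]
  · exact iSup_mono fun i => Gs_sum a _ h x
  · intro i; exact Finset.aemeasurable_fun_sum _ (fun i _ => h i)
  · intro i j hij p
    exact Finset.sum_le_sum_of_subset (Finset.range_mono hij)

theorem Gs_split_sq (a : ℝ) (Φ : ℝ × Rn n → ℝ≥0∞) {E : Set (ℝ × Rn n)} (hE : MeasurableSet E) (x : Rn n) :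
    Gs a Φ x ^ 2 = Gs a (E.indicator Φ) x ^ 2 + Gs a (Eᶜ.indicator Φ) x ^ 2 := by
  simp only [Gs_sq]
  rw [← lintegral_add_compl _ hE, ← lintegral_indicator hE, ← lintegral_indicator hE.compl]
  congr 2 <;> ext p <;> simp only [indicator] <;> split_ifs <;> simp

/-- The convolution in absolute value. -/
def Phi (ψ f : Rn n → ℝ) (p : ℝ × Rn n) : ℝ≥0∞ := ENNReal.ofReal |cvl ψ p.1 f p.2|

theorem qmp_aux {t : ℝ} (ht : 0 < t) (x : Rn n) :
    Measure.QuasiMeasurePreserving (fun y : Rn n => t⁻¹ • (x - y)) volume volume := by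
  have h1 : Measure.QuasiMeasurePreserving (fun y : Rn n => x - y) volume volume :=
    (Measure.measurePreserving_sub_left volume x).quasiMeasurePreserving
  have h2 : Measure.QuasiMeasurePreserving (fun y : Rn n => t⁻¹ • y) volume volume := by
    refine ⟨by fun_prop, ?_⟩
    rw [Measure.map_addHaar_smul _ (inv_ne_zero ht.ne')]
    exact Measure.smul_absolutelyContinuous
  exact h2.comp h1

theorem cvl_meas {ψ f : Rn n → ℝ} (hψ : AEStronglyMeasurable ψ volume)
    (hf : AEStronglyMeasurable f volume) :
    ∃ F : ℝ × Rn n → ℝ, Measurable F ∧ ∀ t > 0, ∀ y, F (t, y) = cvl ψ t f y := by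
  refine ⟨fun p => ∫ y, (p.1 ^ n)⁻¹ * hψ.mk ψ (p.1⁻¹ • (p.2 - y)) * hf.mk f y, ?_, ?_⟩
  · have h1 := hψ.stronglyMeasurable_mk.measurable
    have h2 := hf.stronglyMeasurable_mk.measurable
    have : StronglyMeasurable (fun q : (ℝ × Rn n) × Rn n =>
        (q.1.1 ^ n)⁻¹ * hψ.mk ψ (q.1.1⁻¹ • (q.1.2 - q.2)) * hf.mk f q.2) := by
      apply Measurable.stronglyMeasurable
      fun_prop
    exact (this.integral_prod_right (ν := (volume : Measure (Rn n)))).measurable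
  · intro t ht y
    unfold cvl
    apply integral_congr_ae
    filter_upwards [hf.ae_eq_mk, (qmp_aux ht y).ae hψ.ae_eq_mk] with z h1 h2
    simp only
    rw [← h1, ← h2]

theorem Phi_aemeas {ψ f : Rn n → ℝ} (hψ : AEStronglyMeasurable ψ volume)
    (hf : AEStronglyMeasurable f volume) : AEMeasurable (Phi ψ f) (PM n) := by
  obtain ⟨F, hF, h⟩ := cvl_meas hψ hf
  refine ⟨fun p => ENNReal.ofReal |F p|, by fun_prop, ?_⟩
  filter_upwards [PM_pos] with p hp
  rw [Phi, ← h _ hp]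

theorem Gstar_eq {ψ f : Rn n → ℝ} (hψ : AEStronglyMeasurable ψ volume)
    (hf : AEStronglyMeasurable f volume) (lam : ℝ) (x : Rn n) :
    Gstar ψ lam f x = Gs (lam * n) (Phi ψ f) x := by
  unfold Gstar Gs
  congr 1
  have hm : AEMeasurable (fun p => wt (lam * n) x p * Phi ψ f p ^ 2) (PM n) :=
    (wt_meas' _ x).aemeasurable.mul ((Phi_aemeas hψ hf).pow_const 2)
  unfold PM at hm ⊢
  rw [lintegral_prod _ hm]
  apply setLIntegral_congr_fun measurableSet_Ioi
  intro t ht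
  simp only
  congr 1
  ext y
  have ht' : 0 < t := ht
  rw [wt, Phi, ← ENNReal.ofReal_pow (by positivity), ← ENNReal.ofReal_mul (by positivity), sq_abs]
  congr 1
  simp only
  ring

end PB

section PC1
open FourierTransform SchwartzMap in
theorem plancherel_L1L2 {E : Type*} [NormedAddCommGroup E] [InnerProductSpace ℝ E]
    [FiniteDimensional ℝ E] [MeasurableSpace E] [BorelSpace E] {h : E → ℂ} (h1 : Integrable h volume) (h2 : MemLp h 2 volume) :
    ∫⁻ ξ, ‖(𝓕 h : E → ℂ) ξ‖ₑ ^ 2 = ∫⁻ x, ‖h x‖ₑ ^ 2 := by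
  set H : Lp (α := E) ℂ 2 (volume : Measure E) := h2.toLp h with hH
  have key : ∀ᵐ ξ ∂(volume : Measure (E)), (𝓕 H : Lp (α := E) ℂ 2 (volume : Measure E)) ξ = (𝓕 h : E → ℂ) ξ := by
    apply ae_eq_of_integral_contDiff_smul_eq
    · exact (Lp.memLp _).locallyIntegrable (by norm_num)
    · have : Continuous (𝓕 h : E → ℂ) :=
        VectorFourier.fourierIntegral_continuous Real.continuous_fourierChar
          (by exact continuous_inner) h1
      exact this.locallyIntegrable
    · intro g hg hgc
      have hgc' : HasCompactSupport (Complex.ofRealCLM ∘ g) := hgc.comp_left (by simp)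
      let G : 𝓢(E, ℂ) := hgc'.toSchwartzMap (Complex.ofRealCLM.contDiff.comp hg)
      have e := congrArg (fun T => T G) (Lp.fourier_toTemperedDistribution_eq H)
      simp only [TemperedDistribution.fourier_apply, Lp.toTemperedDistribution_apply] at e
      have e1 : ∫ x, g x • (𝓕 H : Lp (α := E) ℂ 2 (volume : Measure E)) x = ∫ x, G x • (𝓕 H : Lp (α := E) ℂ 2 (volume : Measure E)) x := by
        rfl
      rw [e1, ← e]
      have e2 : ∫ x, (𝓕 G) x • H x = ∫ x, (𝓕 G) x • h x := by
        apply integral_congr_ae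
        filter_upwards [h2.coeFn_toLp] with x hx
        rw [hH, hx]
      rw [e2]
      have e3 := VectorFourier.integral_fourierIntegral_smul_eq_flip (μ := (volume : Measure (E)))
        (ν := (volume : Measure (E))) (L := innerₗ (E))
        (f := (G : E → ℂ)) (g := h) Real.continuous_fourierChar
        (by exact continuous_inner) G.integrable h1
      rw [flip_innerₗ] at e3
      exact e3
  have e4 := Lp.norm_fourier_eq H
  have e5 : eLpNorm (𝓕 h : E → ℂ) 2 volume = eLpNorm h 2 volume := by
    rw [← eLpNorm_congr_ae key]
    have : ‖(𝓕 H : Lp (α := E) ℂ 2 (volume : Measure E))‖ₑ = ‖H‖ₑ := by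
      rw [← ofReal_norm, ← ofReal_norm, e4]
    rw [Lp.enorm_def, Lp.enorm_def] at this
    rw [this]
    exact eLpNorm_congr_ae h2.coeFn_toLp
  rw [eLpNorm_eq_lintegral_rpow_enorm_toReal (by norm_num) (by norm_num),
    eLpNorm_eq_lintegral_rpow_enorm_toReal (by norm_num) (by norm_num)] at e5
  have := (ENNReal.rpow_left_injective (x := 1 / (2:ℝ≥0∞).toReal) (by norm_num)) e5
  simpa using this

end PC1

section PC2
open FourierTransform in
theorem fourier_small_sc (X : ℝ) (hX : 1 ≤ X) (N : ℝ) (ε : ℝ) (h : ε ≤ N) : (X⁻¹)^N ≤ X ^ (-ε) := by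
  have h0 : 0 ≤ X := by linarith
  rw [Real.inv_rpow h0, ← Real.rpow_neg h0]
  exact Real.rpow_le_rpow_of_exponent_le hX (by linarith)

open FourierTransform in
theorem fourier_small {C₁ C₂ δ γ : ℝ} (hC₁ : 0 < C₁) {ψ : Rn n → ℝ} (hψ : PsiKernel n C₁ C₂ δ γ ψ)
    {ε : ℝ} (hε : 0 < ε) (hε1 : ε ≤ 1) (hεδ : ε < δ) :
    ∃ C : ℝ, 0 < C ∧ ∀ ξ : Rn n, ‖(𝓕 (fun x => (ψ x : ℂ)) : Rn n → ℂ) ξ‖ ≤ C * ‖ξ‖ ^ ε := by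
  obtain ⟨hIntg, hzero, hP2, -⟩ := hψ
  have hI : Integrable (fun v : Rn n => (1 + ‖v‖) ^ (-((n:ℝ) + (δ - ε)))) volume :=
    integrable_one_add_norm (by simp; linarith)
  set I := ∫ v : Rn n, (1 + ‖v‖) ^ (-((n:ℝ) + (δ - ε))) with hIdef
  have hI0 : 0 ≤ I := integral_nonneg fun v => by positivity
  refine ⟨2 * (2 * Real.pi) ^ ε * C₁ * I + 1, by positivity, ?_⟩
  intro ξ
  have hz : ∫ v : Rn n, (ψ v : ℂ) = 0 := by
    rw [integral_complex_ofReal, hzero]; simp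
  have hi1 : Integrable (fun v : Rn n => Real.fourierChar (-(inner ℝ v ξ)) • (ψ v : ℂ)) volume :=
    (Real.fourierIntegral_convergent_iff ξ).2 hIntg.ofReal
  have e1 : (𝓕 (fun x => (ψ x : ℂ)) : Rn n → ℂ) ξ
      = ∫ v : Rn n, (Real.fourierChar (-(inner ℝ v ξ)) • (ψ v : ℂ) - (ψ v : ℂ)) := by
    have hio : Integrable (fun v : Rn n => (ψ v : ℂ)) volume := hIntg.ofReal
    rw [integral_sub hi1 hio, hz, sub_zero, Real.fourier_eq]
  rw [e1]
  have hb : ∀ v : Rn n, ‖Real.fourierChar (-(inner ℝ v ξ)) • (ψ v : ℂ) - (ψ v : ℂ)‖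
      ≤ (2 * (2 * Real.pi) ^ ε * C₁ * ‖ξ‖ ^ ε) * (1 + ‖v‖) ^ (-((n:ℝ) + (δ - ε))) := by
    intro v
    have a1 : Real.fourierChar (-(inner ℝ v ξ)) • (ψ v : ℂ) - (ψ v : ℂ)
        = ((Real.fourierChar (-(inner ℝ v ξ)) : ℂ) - 1) * (ψ v : ℂ) := by
      rw [Circle.smul_def, smul_eq_mul]; ring
    rw [a1, norm_mul, Complex.norm_real, Real.norm_eq_abs]
    have a2 : ‖(Real.fourierChar (-(inner ℝ v ξ)) : ℂ) - 1‖ ≤ 2 * (2 * Real.pi * (‖v‖ * ‖ξ‖)) ^ ε := by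
      set s := 2 * Real.pi * (‖v‖ * ‖ξ‖) with hs
      have hs0 : 0 ≤ s := by positivity
      have b1 : ‖(Real.fourierChar (-(inner ℝ v ξ)) : ℂ) - 1‖ ≤ s := by
        have := Real.norm_exp_I_mul_ofReal_sub_one_le (x := 2 * Real.pi * (-(inner ℝ v ξ)))
        rw [Real.fourierChar_apply]
        rw [mul_comm Complex.I] at this
        refine this.trans ?_
        rw [norm_mul, norm_neg, Real.norm_of_nonneg (by positivity : 0 ≤ 2 * Real.pi), hs]
        gcongr
        exact norm_inner_le_norm v ξ
      have b2 : ‖(Real.fourierChar (-(inner ℝ v ξ)) : ℂ) - 1‖ ≤ 2 := by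
        refine (norm_sub_le _ _).trans ?_
        rw [Circle.norm_coe, norm_one]; norm_num
      by_cases hs1 : s ≤ 1
      · have : s ≤ s ^ ε := Real.self_le_rpow_of_le_one hs0 hs1 hε1
        have : 0 ≤ s ^ ε := by positivity
        linarith
      · have : 1 ≤ s ^ ε := Real.one_le_rpow (by linarith) hε.le
        linarith
    have a3 := hP2 v
    have a4 : ‖v‖ ^ ε ≤ (1 + ‖v‖) ^ ε := Real.rpow_le_rpow (by positivity) (by linarith) hε.le
    calc _ ≤ 2 * (2 * Real.pi * (‖v‖ * ‖ξ‖)) ^ ε * (C₁ * (1 + ‖v‖) ^ (-((n : ℝ) + δ))) := by gcongr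
      _ = 2 * (2 * Real.pi) ^ ε * C₁ * ‖ξ‖ ^ ε * (‖v‖ ^ ε * (1 + ‖v‖) ^ (-((n : ℝ) + δ))) := by
          rw [Real.mul_rpow (x := 2 * Real.pi) (by positivity) (by positivity), Real.mul_rpow (norm_nonneg v) (norm_nonneg ξ)]
          ring
      _ ≤ 2 * (2 * Real.pi) ^ ε * C₁ * ‖ξ‖ ^ ε * ((1 + ‖v‖) ^ ε * (1 + ‖v‖) ^ (-((n : ℝ) + δ))) := by
          gcongr
      _ = _ := by
          rw [← Real.rpow_add (by positivity)]; ring_nf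
  refine (norm_integral_le_of_norm_le (hI.const_mul _) (Filter.Eventually.of_forall hb)).trans ?_
  rw [integral_const_mul]
  have : 0 ≤ ‖ξ‖ ^ ε := by positivity
  nlinarith

theorem fourier_large_sc {C₁ C₂ I V A B X F : ℝ} (hI : 0 ≤ I) (hV : 0 ≤ V) (h2 : 0 < C₂) (h1 : 0 < C₁)
    (a1 : A ≤ X) (a2 : B ≤ X) (hF : 0 ≤ F) (e : 2 * F ≤ C₂ * A * I + B * V * (2 * C₁)) (hX : 0 ≤ X) :
    F ≤ (C₂ * I + 2 * C₁ * V + 1) * X := by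
  have b1 : C₂ * A * I ≤ C₂ * X * I := by gcongr
  have b2 : B * V * (2 * C₁) ≤ X * V * (2 * C₁) := by gcongr
  have b4 : 0 ≤ C₂ * X * I := by positivity
  have b5 : 0 ≤ X * V * (2 * C₁) := by positivity
  nlinarith

set_option maxHeartbeats 1600000 in
open FourierTransform in
theorem fourier_large (hn : 1 ≤ n) {C₁ C₂ δ γ : ℝ} (hC₁ : 0 < C₁) (hC₂ : 0 < C₂) (hδ : 0 < δ) (hγ : 0 < γ)
    {ψ : Rn n → ℝ} (hψ : PsiKernel n C₁ C₂ δ γ ψ)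
    {ε : ℝ} (hε : 0 < ε) (hε1 : ε ≤ 1) (hεγ : ε ≤ γ) :
    ∃ C : ℝ, 0 < C ∧ ∀ ξ : Rn n, 1 ≤ ‖ξ‖ → ‖(𝓕 (fun x => (ψ x : ℂ)) : Rn n → ℂ) ξ‖ ≤ C * ‖ξ‖ ^ (-ε) := by
  obtain ⟨hIntg, hzero, hP2, hP3⟩ := hψ
  have hI : Integrable (fun v : Rn n => (1 + ‖v‖) ^ (-((n:ℝ) + δ + γ))) volume :=
    integrable_one_add_norm (by simp; linarith)
  set I := ∫ v : Rn n, (1 + ‖v‖) ^ (-((n:ℝ) + δ + γ)) with hIdef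
  have hI0 : 0 ≤ I := integral_nonneg fun v => by positivity
  set V := (volume (ball (0 : Rn n) 1)).toReal with hV
  refine ⟨C₂ * I + 2 * C₁ * V + 1, by positivity, ?_⟩
  intro ξ hξ
  have hξ0 : 0 < ‖ξ‖ := by linarith
  obtain ⟨h, hhn, hinner⟩ : ∃ h : Rn n, ‖h‖ = 1 / (2 * ‖ξ‖) ∧ inner ℝ h ξ = 1 / 2 := by
    refine ⟨(1 / (2 * ‖ξ‖ ^ 2)) • ξ, ?_, ?_⟩
    · rw [norm_smul, Real.norm_of_nonneg (by positivity)]; field_simp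
    · rw [real_inner_smul_left, real_inner_self_eq_norm_sq]; field_simp
  set f : Rn n → ℂ := fun x => (ψ x : ℂ) with hf
  have hfi : Integrable f volume := hIntg.ofReal
  have hfi' : Integrable (f ∘ fun v => v + h) volume := hfi.comp_add_right h
  have e1 : (𝓕 (f ∘ fun v => v + h) : Rn n → ℂ) ξ = - (𝓕 f : Rn n → ℂ) ξ := by
    have := congrFun (VectorFourier.fourierIntegral_comp_add_right Real.fourierChar
      (volume : Measure (Rn n)) (innerₗ (Rn n)) f h) ξ
    refine this.trans ?_
    have h2 : (Real.fourierChar (innerₗ (Rn n) h ξ) : ℂ) = -1 := by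
      rw [innerₗ_apply_apply, hinner, Real.fourierChar_apply]
      rw [← Complex.exp_pi_mul_I]; congr 1; push_cast; ring
    rw [Circle.smul_def, h2]
    simp; rfl
  have e2 : ∫ v, (Real.fourierChar (-(inner ℝ v ξ)) • (f v - f (v + h))) = 2 * (𝓕 f : Rn n → ℂ) ξ := by
    have i1 : Integrable (fun v : Rn n => Real.fourierChar (-(inner ℝ v ξ)) • f v) volume :=
      (Real.fourierIntegral_convergent_iff ξ).2 hfi
    have i2 : Integrable (fun v : Rn n => Real.fourierChar (-(inner ℝ v ξ)) • f (v + h)) volume :=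
      (Real.fourierIntegral_convergent_iff ξ).2 hfi'
    simp_rw [smul_sub]
    rw [integral_sub i1 i2]
    have e3 : ∫ v, Real.fourierChar (-(inner ℝ v ξ)) • f v = (𝓕 f : Rn n → ℂ) ξ := (Real.fourier_eq f ξ).symm
    have e4 : ∫ v, Real.fourierChar (-(inner ℝ v ξ)) • f (v + h) = - (𝓕 f : Rn n → ℂ) ξ := by
      rw [← e1, Real.fourier_eq]; rfl
    rw [e3, e4]; ring
  have hball : Integrable ((ball (0 : Rn n) (2 * ‖h‖)).indicator (fun _ => (2 * C₁ : ℝ))) volume :=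
    (integrable_indicator_iff measurableSet_ball).2 (integrableOn_const (by exact measure_ball_lt_top.ne))
  have hb : ∀ v : Rn n, ‖Real.fourierChar (-(inner ℝ v ξ)) • (f v - f (v + h))‖
      ≤ (C₂ * ‖h‖ ^ γ) * (1 + ‖v‖) ^ (-((n:ℝ) + δ + γ))
        + (ball (0 : Rn n) (2 * ‖h‖)).indicator (fun _ => (2 * C₁ : ℝ)) v := by
    intro v
    rw [Circle.smul_def, norm_smul, Circle.norm_coe, one_mul, hf]
    simp only
    rw [← Complex.ofReal_sub, Complex.norm_real, Real.norm_eq_abs]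
    by_cases hv : 2 * ‖h‖ ≤ ‖v‖
    · have := hP3 v h hv
      rw [abs_sub_comm] at this
      refine this.trans ?_
      have : 0 ≤ (ball (0 : Rn n) (2 * ‖h‖)).indicator (fun _ => (2 * C₁ : ℝ)) v :=
        indicator_nonneg (fun _ _ => by positivity) v
      linarith
    · rw [indicator_of_mem (by simpa using hv)]
      have hbd : ∀ w, |ψ w| ≤ C₁ := by
        intro w
        refine (hP2 w).trans ?_
        have : (1 + ‖w‖) ^ (-((n : ℝ) + δ)) ≤ 1 :=
          Real.rpow_le_one_of_one_le_of_nonpos (by linarith [norm_nonneg w]) (by linarith [(Nat.cast_nonneg n : (0:ℝ) ≤ n)])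
        nlinarith
      have : |ψ v - ψ (v + h)| ≤ 2 * C₁ := by
        refine (abs_sub _ _).trans ?_
        linarith [hbd v, hbd (v + h)]
      have : 0 ≤ (C₂ * ‖h‖ ^ γ) * (1 + ‖v‖) ^ (-((n:ℝ) + δ + γ)) := by positivity
      linarith
  have h2h : 0 < 2 * ‖h‖ := by rw [hhn]; positivity
  have e5 := norm_integral_le_of_norm_le ((hI.const_mul (C₂ * ‖h‖ ^ γ)).add hball) (Filter.Eventually.of_forall hb)
  rw [e2] at e5
  simp only [Pi.add_apply] at e5
  rw [integral_add (hI.const_mul _) hball, integral_const_mul, ← hIdef,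
    integral_indicator_const _ measurableSet_ball, smul_eq_mul, Measure.real,
    Measure.addHaar_ball_of_pos _ _ h2h, ENNReal.toReal_mul, ENNReal.toReal_ofReal (by positivity), ← hV] at e5
  simp only [finrank_euclideanSpace, Fintype.card_fin, norm_mul, Complex.norm_ofNat] at e5
  have a1 : ‖h‖ ^ γ ≤ ‖ξ‖ ^ (-ε) := by
    refine le_trans ?_ (fourier_small_sc ‖ξ‖ hξ γ ε hεγ)
    apply Real.rpow_le_rpow (norm_nonneg h) _ hγ.le
    rw [hhn, one_div, mul_inv]
    have : 0 ≤ ‖ξ‖⁻¹ := inv_nonneg.2 hξ0.le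
    linarith
  have a2 : (2 * ‖h‖) ^ n ≤ ‖ξ‖ ^ (-ε) := by
    have : 2 * ‖h‖ = ‖ξ‖⁻¹ := by rw [hhn, one_div, mul_inv, ← mul_assoc, mul_inv_cancel₀ (two_ne_zero' ℝ), one_mul]
    rw [this, ← Real.rpow_natCast]
    have h1n : (1 : ℝ) ≤ n := by exact_mod_cast hn
    exact fourier_small_sc ‖ξ‖ hξ n ε (by linarith)
  have hV0 : 0 ≤ V := ENNReal.toReal_nonneg
  exact fourier_large_sc hI0 hV0 hC₂ hC₁ a1 a2 (norm_nonneg _) e5 (Real.rpow_nonneg hξ0.le _)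

end PC2

section PC3
open FourierTransform Convolution in
theorem conv_L2 {E : Type*} [NormedAddCommGroup E] [InnerProductSpace ℝ E]
    [FiniteDimensional ℝ E] [MeasurableSpace E] [BorelSpace E] {φ g : E → ℂ} (h1 : Integrable φ volume)
    (h2 : Integrable g volume) {H : ℝ} (hH : ∀ x, ‖g x‖ ≤ H) :
    ∫⁻ y, ‖∫ z, φ (y - z) * g z‖ₑ ^ 2 = ∫⁻ ξ, ‖(𝓕 φ : E → ℂ) ξ‖ₑ ^ 2 * ‖(𝓕 g : E → ℂ) ξ‖ₑ ^ 2 := by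
  have e0 : (fun y => ∫ z, φ (y - z) * g z) = (g ⋆[ContinuousLinearMap.mul ℂ ℂ] φ) := by
    funext y
    simp only [convolution, ContinuousLinearMap.mul_apply', mul_comm]
  have hi : Integrable (g ⋆[ContinuousLinearMap.mul ℂ ℂ] φ) volume :=
    h2.integrable_convolution (ContinuousLinearMap.mul ℂ ℂ) h1
  have hbd : ∀ y, ‖(g ⋆[ContinuousLinearMap.mul ℂ ℂ] φ) y‖ ≤ H * ∫ z, ‖φ z‖ := by
    intro y
    rw [← e0]
    simp only
    have hi' : Integrable (fun z => H * ‖φ (y - z)‖) volume := (h1.comp_sub_left y).norm.const_mul H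
    refine (norm_integral_le_of_norm_le hi' (Filter.Eventually.of_forall fun z => ?_)).trans ?_
    · rw [norm_mul, mul_comm]; gcongr; exact hH z
    · rw [integral_const_mul, integral_sub_left_eq_self (fun z => ‖φ z‖)]
  have hm : MemLp (g ⋆[ContinuousLinearMap.mul ℂ ℂ] φ) 2 volume := by
    rw [memLp_two_iff_integrable_sq_norm hi.1]
    simp_rw [sq]
    exact hi.norm.bdd_mul hi.1.norm (Filter.Eventually.of_forall fun y => by rw [norm_norm]; exact hbd y)
  have e1 := plancherel_L1L2 hi hm
  have e2 : ∫⁻ y, ‖∫ z, φ (y - z) * g z‖ₑ ^ 2 = ∫⁻ y, ‖(g ⋆[ContinuousLinearMap.mul ℂ ℂ] φ) y‖ₑ ^ 2 := by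
    rw [← e0]
  rw [e2, ← e1]
  apply lintegral_congr
  intro ξ
  rw [Real.fourier_mul_convolution_eq h2 h1, enorm_mul, mul_pow, mul_comm]

open FourierTransform in
theorem plancherel_bdd {E : Type*} [NormedAddCommGroup E] [InnerProductSpace ℝ E]
    [FiniteDimensional ℝ E] [MeasurableSpace E] [BorelSpace E] {g : E → ℂ} 
    (h2 : Integrable g volume) {H : ℝ} (hH : ∀ x, ‖g x‖ ≤ H) :
    ∫⁻ ξ, ‖(𝓕 g : E → ℂ) ξ‖ₑ ^ 2 = ∫⁻ x, ‖g x‖ₑ ^ 2 := by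
  refine plancherel_L1L2 h2 ?_
  rw [memLp_two_iff_integrable_sq_norm h2.1]
  simp_rw [sq]
  exact h2.norm.bdd_mul h2.1.norm (Filter.Eventually.of_forall fun y => by rw [norm_norm]; exact hH y)

open FourierTransform in
theorem fourier_dil {E : Type*} [NormedAddCommGroup E] [InnerProductSpace ℝ E]
    [FiniteDimensional ℝ E] [MeasurableSpace E] [BorelSpace E] (φ : E → ℂ) {t : ℝ} (ht : 0 < t) (ξ : E) :
    (𝓕 (fun x => (((t ^ (Module.finrank ℝ E))⁻¹ : ℝ) : ℂ) * φ (t⁻¹ • x)) : E → ℂ) ξ = (𝓕 φ : E → ℂ) (t • ξ) := by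
  rw [Real.fourier_eq, Real.fourier_eq]
  have := Measure.integral_comp_inv_smul_of_nonneg (volume : Measure E)
    (fun v => Real.fourierChar (-(inner ℝ v (t • ξ))) • φ v) ht.le
  have h2 : ∀ v : E, Real.fourierChar (-(inner ℝ v ξ)) • ((((t ^ (Module.finrank ℝ E))⁻¹ : ℝ) : ℂ) * φ (t⁻¹ • v))
     = (((t ^ (Module.finrank ℝ E))⁻¹ : ℝ) : ℂ) * Real.fourierChar (-(inner ℝ (t⁻¹ • v) (t • ξ))) • φ (t⁻¹ • v) := by
    intro v
    rw [real_inner_smul_left, real_inner_smul_right, inv_mul_cancel_left₀ ht.ne', Circle.smul_def, Circle.smul_def]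
    simp only [smul_eq_mul]; ring
  simp_rw [h2]
  rw [integral_const_mul, this, Complex.real_smul, ← mul_assoc, ← Complex.ofReal_mul,
    inv_mul_cancel₀ (by positivity), Complex.ofReal_one, one_mul]

open FourierTransform in
theorem fourier_sq_int (hn : 1 ≤ n) {C₁ C₂ δ γ : ℝ} (hC₁ : 0 < C₁) (hC₂ : 0 < C₂) (hδ : 0 < δ) (hγ : 0 < γ)
    {ψ : Rn n → ℝ} (hψ : PsiKernel n C₁ C₂ δ γ ψ) :
    ∃ C : ℝ, 0 < C ∧ ∀ ξ : Rn n, ∫⁻ t in Ioi (0:ℝ),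
      ‖(𝓕 (fun x => (ψ x : ℂ)) : Rn n → ℂ) (t • ξ)‖ₑ ^ 2 * ENNReal.ofReal t⁻¹ ≤ ENNReal.ofReal C := by
  set ε := min γ (min (δ / 2) 1) with hεd
  have hε : 0 < ε := lt_min hγ (lt_min (by linarith) one_pos)
  have hε1 : ε ≤ 1 := (min_le_right _ _).trans (min_le_right _ _)
  have hεδ : ε < δ := ((min_le_right _ _).trans (min_le_left _ _)).trans_lt (by linarith)
  have hεγ : ε ≤ γ := min_le_left _ _
  clear_value ε
  obtain ⟨A, hA, hA'⟩ := fourier_small hC₁ hψ hε hε1 hεδ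
  obtain ⟨B, hB, hB'⟩ := fourier_large hn hC₁ hC₂ hδ hγ hψ hε hε1 hεγ
  obtain ⟨L, hL, hL'⟩ := lint_1d (2 * ε) (2 * ε) (by linarith) (by linarith)
  set F : Rn n → ℂ := (𝓕 (fun x => (ψ x : ℂ)) : Rn n → ℂ) with hF
  -- pointwise bound
  have key : ∀ s : ℝ, 0 ≤ s → ∀ ξ : Rn n, ‖ξ‖ = s → ‖F ξ‖ ≤ ((A + B) * 2 ^ (2 * ε)) * (s ^ ε * (1 + s) ^ (-(2 * ε))) := by
    intro s hs ξ hξ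
    by_cases h1 : s ≤ 1
    · have a := hA' ξ
      rw [hξ] at a
      refine a.trans ?_
      have : 1 ≤ 2 ^ (2 * ε) * (1 + s) ^ (-(2 * ε)) := by
        rw [Real.rpow_neg (by positivity), ← div_eq_mul_inv, one_le_div (by positivity)]
        exact Real.rpow_le_rpow (by positivity) (by linarith) (by positivity)
      calc A * s ^ ε ≤ (A + B) * s ^ ε * 1 := by rw [mul_one]; gcongr; linarith
        _ ≤ (A + B) * s ^ ε * (2 ^ (2 * ε) * (1 + s) ^ (-(2 * ε))) := by gcongr
        _ = _ := by ring
    · push Not at h1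
      have a := hB' ξ (by linarith)
      rw [hξ] at a
      refine a.trans ?_
      have : s ^ (-ε) ≤ 2 ^ (2 * ε) * (s ^ ε * (1 + s) ^ (-(2 * ε))) := by
        rw [Real.rpow_neg (by positivity), Real.rpow_neg (by positivity)]
        have e1 : (1 + s) ^ (2 * ε) ≤ (2 * s) ^ (2 * ε) := Real.rpow_le_rpow (by positivity) (by linarith) (by positivity)
        have e2 : (2 * s) ^ (2 * ε) = 2 ^ (2 * ε) * (s ^ ε * s ^ ε) := by
          rw [Real.mul_rpow (by norm_num) hs, ← Real.rpow_add (by linarith)]; ring_nf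
        have e3 : 0 < s ^ ε := by positivity
        rw [← div_eq_mul_inv, ← mul_div_assoc, le_div_iff₀ (by positivity), inv_mul_le_iff₀ e3]
        nlinarith
      calc B * s ^ (-ε) ≤ (A + B) * s ^ (-ε) := by gcongr; linarith
        _ ≤ (A + B) * (2 ^ (2 * ε) * (s ^ ε * (1 + s) ^ (-(2 * ε)))) := by gcongr
        _ = _ := by ring
  set K := (A + B) * 2 ^ (2 * ε) with hK
  have hK0 : 0 < K := by positivity
  clear_value K
  refine ⟨K ^ 2 * L, by positivity, ?_⟩
  intro ξ
  by_cases hξ : ‖ξ‖ = 0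
  · have : ∀ t : ℝ, F (t • ξ) = 0 := by
      intro t
      have := key 0 le_rfl (t • ξ) (by rw [norm_smul, hξ, mul_zero])
      rw [Real.zero_rpow hε.ne', zero_mul, mul_zero] at this
      exact norm_le_zero_iff.1 this
    simp [this]
  · have hX : 0 < ‖ξ‖ := lt_of_le_of_ne (norm_nonneg _) (Ne.symm hξ)
    set X := ‖ξ‖ with hXd
    have step : ∀ t ∈ Ioi (0:ℝ), ‖F (t • ξ)‖ₑ ^ 2 * ENNReal.ofReal t⁻¹ ≤ 
        ENNReal.ofReal (K ^ 2 * X ^ (-(2 * ε))) * ENNReal.ofReal (t ^ (2 * ε - 1) * (t + X⁻¹) ^ (-(2 * ε + 2 * ε))) := by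
      intro t ht
      have ht : 0 < t := ht
      have b := key (t * X) (by positivity) (t • ξ) (by rw [norm_smul, Real.norm_of_nonneg ht.le])
      rw [← ofReal_norm, ← ENNReal.ofReal_pow (norm_nonneg _), ← ENNReal.ofReal_mul (by positivity),
        ← ENNReal.ofReal_mul (by positivity)]
      apply ENNReal.ofReal_le_ofReal
      calc ‖F (t • ξ)‖ ^ 2 * t⁻¹ ≤ (K * ((t * X) ^ ε * (1 + t * X) ^ (-(2 * ε)))) ^ 2 * t⁻¹ := by gcongr
        _ = _ := by
          have e1 : 1 + t * X = X * (t + X⁻¹) := by field_simp; ring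
          rw [e1, Real.mul_rpow ht.le hX.le, Real.mul_rpow hX.le (by positivity)]
          have e2 : t ^ (2 * ε - 1) = t ^ ε * t ^ ε * t⁻¹ := by
            rw [← Real.rpow_neg_one t, ← Real.rpow_add ht, ← Real.rpow_add ht]; ring_nf
          have e3 : (t + X⁻¹) ^ (-(2 * ε + 2 * ε)) = (t + X⁻¹) ^ (-(2 * ε)) * (t + X⁻¹) ^ (-(2 * ε)) := by
            rw [← Real.rpow_add (by positivity)]; ring_nf
          have e4 : X ^ ε * X ^ ε * X ^ (-(2 * ε)) = 1 := by
            rw [← Real.rpow_add hX, ← Real.rpow_add hX]; ring_nf; simp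
          rw [e2, e3]
          linear_combination (K ^ 2 * t ^ ε * t ^ ε * t⁻¹ * (t + X⁻¹) ^ (-(2 * ε)) * (t + X⁻¹) ^ (-(2 * ε)) * X ^ (-(2 * ε))) * e4
    refine (setLIntegral_mono' measurableSet_Ioi step).trans ?_
    rw [lintegral_const_mul' _ _ ENNReal.ofReal_ne_top]
    refine (mul_le_mul_right (hL' X⁻¹ (by positivity)) _).trans ?_
    rw [← ENNReal.ofReal_mul (by positivity)]
    apply ENNReal.ofReal_le_ofReal
    apply le_of_eq
    have e4 : X ^ (-(2 * ε)) * X⁻¹ ^ (-(2 * ε)) = 1 := by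
      rw [← Real.mul_rpow hX.le (by positivity), mul_inv_cancel₀ hX.ne', Real.one_rpow]
    linear_combination K ^ 2 * L * e4

open FourierTransform in
theorem L2_halfspace (hn : 1 ≤ n) {C₁ C₂ δ γ : ℝ} (hC₁ : 0 < C₁) (hC₂ : 0 < C₂) (hδ : 0 < δ) (hγ : 0 < γ)
    {ψ : Rn n → ℝ} (hψ : PsiKernel n C₁ C₂ δ γ ψ) :
    ∃ C : ℝ, 0 < C ∧ ∀ g : Rn n → ℝ, Integrable g volume → ∀ H : ℝ, (∀ x, |g x| ≤ H) →
      ∫⁻ p, Phi ψ g p ^ 2 * ENNReal.ofReal (p.1)⁻¹ ∂(PM n) ≤ ENNReal.ofReal C * ∫⁻ x, ENNReal.ofReal |g x| ^ 2 := by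
  obtain ⟨C, hC, hC'⟩ := fourier_sq_int hn hC₁ hC₂ hδ hγ hψ
  refine ⟨C, hC, ?_⟩
  intro g hg H hH
  set F : Rn n → ℂ := (𝓕 (fun x => (ψ x : ℂ)) : Rn n → ℂ) with hF
  have hψi : Integrable ψ volume := hψ.1
  have hψc : Integrable (fun x => (ψ x : ℂ)) volume := hψi.ofReal
  have hgc : Integrable (fun x => (g x : ℂ)) volume := hg.ofReal
  have hgH : ∀ x, ‖(g x : ℂ)‖ ≤ H := by intro x; rw [Complex.norm_real]; exact hH x
  have hFc : Continuous F := VectorFourier.fourierIntegral_continuous Real.continuous_fourierChar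
          (by exact continuous_inner) hψc
  have hGc : Continuous (𝓕 (fun x => (g x : ℂ)) : Rn n → ℂ) := VectorFourier.fourierIntegral_continuous Real.continuous_fourierChar
          (by exact continuous_inner) hgc
  set G : Rn n → ℂ := (𝓕 (fun x => (g x : ℂ)) : Rn n → ℂ) with hG
  have hm : AEMeasurable (fun p => Phi ψ g p ^ 2 * ENNReal.ofReal (p.1)⁻¹) (PM n) := by
    have := Phi_aemeas hψ.1.1 hg.1
    have h3 : Measurable (fun p : ℝ × Rn n => ENNReal.ofReal (p.1)⁻¹) := by fun_prop
    exact (this.pow_const 2).mul h3.aemeasurable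
  unfold PM at hm ⊢
  rw [lintegral_prod _ hm]
  have step : ∀ t ∈ Ioi (0:ℝ), ∫⁻ y, Phi ψ g (t, y) ^ 2 * ENNReal.ofReal t⁻¹
      = ∫⁻ ξ, (‖F (t • ξ)‖ₑ ^ 2 * ENNReal.ofReal t⁻¹) * ‖G ξ‖ₑ ^ 2 := by
    intro t ht
    have ht : 0 < t := ht
    rw [lintegral_mul_const' _ _ ENNReal.ofReal_ne_top]
    have hφ : Integrable (fun x : Rn n => (((t ^ n)⁻¹ : ℝ) : ℂ) * (ψ (t⁻¹ • x) : ℂ)) volume :=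
      (hψc.comp_smul (inv_ne_zero ht.ne')).const_mul _
    have c1 := conv_L2 hφ hgc hgH
    have c2 : ∀ y, ‖∫ z, ((((t ^ n)⁻¹ : ℝ) : ℂ) * (ψ (t⁻¹ • (y - z)) : ℂ)) * (g z : ℂ)‖ₑ = Phi ψ g (t, y) := by
      intro y
      unfold Phi cvl
      simp only
      have : ∀ z, ((((t ^ n)⁻¹ : ℝ) : ℂ) * (ψ (t⁻¹ • (y - z)) : ℂ)) * (g z : ℂ) = 
         (((t ^ n)⁻¹ * ψ (t⁻¹ • (y - z)) * g z : ℝ) : ℂ) := by intro z; push_cast; ring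
      simp_rw [this]
      rw [integral_complex_ofReal, ← ofReal_norm, Complex.norm_real, Real.norm_eq_abs]
    simp_rw [c2] at c1
    rw [c1, ← lintegral_mul_const' _ _ ENNReal.ofReal_ne_top]
    apply lintegral_congr
    intro ξ
    have c3 := fourier_dil (fun x : Rn n => (ψ x : ℂ)) ht ξ
    simp only [finrank_euclideanSpace, Fintype.card_fin] at c3
    rw [c3]
    ring
  rw [setLIntegral_congr_fun measurableSet_Ioi step]
  have hm2 : Measurable (fun p : ℝ × Rn n => (‖F (p.1 • p.2)‖ₑ ^ 2 * ENNReal.ofReal p.1⁻¹) * ‖G p.2‖ₑ ^ 2) := by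
    have k1 : Continuous (fun p : ℝ × Rn n => F (p.1 • p.2)) := hFc.comp (by fun_prop)
    have k2 : Continuous (fun p : ℝ × Rn n => G p.2) := hGc.comp (by fun_prop)
    exact ((k1.measurable.enorm.pow_const 2).mul (by fun_prop)).mul (k2.measurable.enorm.pow_const 2)
  rw [lintegral_lintegral_swap hm2.aemeasurable]
  calc _ ≤ ∫⁻ ξ, ENNReal.ofReal C * ‖G ξ‖ₑ ^ 2 := by
        apply lintegral_mono
        intro ξ
        dsimp only
        rw [lintegral_mul_const' _ _ (by finiteness)]
        gcongr
        exact hC' ξ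
    _ = ENNReal.ofReal C * ∫⁻ x, ENNReal.ofReal |g x| ^ 2 := by
        rw [lintegral_const_mul' _ _ ENNReal.ofReal_ne_top, hG, plancherel_bdd hgc hgH]
        congr 1
        apply lintegral_congr
        intro x
        rw [← ofReal_norm, Complex.norm_real, Real.norm_eq_abs]

end PC3

section PC4
theorem PM_lint {F : ℝ × Rn n → ℝ≥0∞} (hF : AEMeasurable F (PM n)) :
    ∫⁻ p, F p ∂(PM n) = ∫⁻ t in Ioi (0:ℝ), ∫⁻ y, F (t, y) := by
  unfold PM at *
  rw [lintegral_prod _ hF]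

theorem Gs_L2 (hn : 1 ≤ n) {C₁ C₂ δ γ : ℝ} (hC₁ : 0 < C₁) (hC₂ : 0 < C₂) (hδ : 0 < δ) (hγ : 0 < γ)
    {ψ : Rn n → ℝ} (hψ : PsiKernel n C₁ C₂ δ γ ψ) {a : ℝ} (ha : (n:ℝ) < a) :
    ∃ C : ℝ, 0 < C ∧ ∀ g : Rn n → ℝ, Integrable g volume → ∀ H : ℝ, (∀ x, |g x| ≤ H) →
      ∫⁻ x, Gs a (Phi ψ g) x ^ 2 ≤ ENNReal.ofReal C * ∫⁻ x, ENNReal.ofReal |g x| ^ 2 := by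
  obtain ⟨C, hC, hC'⟩ := L2_halfspace hn hC₁ hC₂ hδ hγ hψ
  obtain ⟨L, hL, hL'⟩ := lint_pow n a ha
  refine ⟨L * C, by positivity, ?_⟩
  intro g hg H hH
  simp_rw [Gs_sq]
  have hm : AEMeasurable (Function.uncurry fun (x : Rn n) (p : ℝ × Rn n) => wt a x p * Phi ψ g p ^ 2) (volume.prod (PM n)) := by
    have h1 := Phi_aemeas hψ.1.1 hg.1
    have h2 : AEMeasurable (fun q : Rn n × (ℝ × Rn n) => Phi ψ g q.2) (volume.prod (PM n)) :=
      h1.comp_quasiMeasurePreserving Measure.quasiMeasurePreserving_snd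
    exact (wt_meas a).aemeasurable.mul (h2.pow_const 2)
  rw [lintegral_lintegral_swap hm]
  have step : ∀ᵐ p ∂(PM n), ∫⁻ x, wt a x p * Phi ψ g p ^ 2 ≤ ENNReal.ofReal L * (Phi ψ g p ^ 2 * ENNReal.ofReal (p.1)⁻¹) := by
    filter_upwards [PM_pos] with p hp
    rw [lintegral_mul_const' _ _ (by unfold Phi; finiteness)]
    have h3 : ∫⁻ x, wt a x p ≤ ENNReal.ofReal L * ENNReal.ofReal (p.1)⁻¹ := by
      obtain ⟨t, y⟩ := p
      simp only at hp
      have h4 : ∀ x : Rn n, wt a x (t, y) = ENNReal.ofReal (t ^ a / t ^ (n+1)) * ENNReal.ofReal ((t + dist x y) ^ (-a)) := by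
        intro x
        unfold wt
        simp only
        rw [← ENNReal.ofReal_mul (by positivity), Real.div_rpow hp.le (by positivity), Real.rpow_neg (by positivity)]
        congr 1; ring
      simp_rw [h4]
      rw [lintegral_const_mul' _ _ ENNReal.ofReal_ne_top]
      refine (mul_le_mul_right (hL' t hp y) _).trans ?_
      rw [← ENNReal.ofReal_mul (by positivity), ← ENNReal.ofReal_mul (by positivity)]
      apply ENNReal.ofReal_le_ofReal
      apply le_of_eq
      have e1 : t ^ (n+1) = t ^ (n:ℝ) * t := by rw [Real.rpow_natCast, pow_succ]
      have e2 : t ^ ((n:ℝ) - a) = t ^ (n:ℝ) / t ^ a := Real.rpow_sub hp _ _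
      rw [e1, e2]
      have : 0 < t ^ (n:ℝ) := by positivity
      have : 0 < t ^ a := by positivity
      field_simp
    calc _ ≤ (ENNReal.ofReal L * ENNReal.ofReal (p.1)⁻¹) * Phi ψ g p ^ 2 := by gcongr
      _ = _ := by ring
  refine (lintegral_mono_ae step).trans ?_
  rw [lintegral_const_mul' _ _ ENNReal.ofReal_ne_top, ENNReal.ofReal_mul hL.le, mul_assoc]
  gcongr
  exact hC' g hg H hH

theorem psit_bd {C₁ C₂ δ γ : ℝ} {ψ : Rn n → ℝ} (hψ : PsiKernel n C₁ C₂ δ γ ψ) {t : ℝ} (ht : 0 < t) (w : Rn n) :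
    |(t ^ n)⁻¹ * ψ (t⁻¹ • w)| ≤ C₁ * (t ^ δ * (t + ‖w‖) ^ (-((n:ℝ) + δ))) := by
  have h := hψ.2.2.1 (t⁻¹ • w)
  rw [norm_smul, Real.norm_of_nonneg (inv_nonneg.2 ht.le)] at h
  have e1 : 1 + t⁻¹ * ‖w‖ = t⁻¹ * (t + ‖w‖) := by field_simp
  have hw := norm_nonneg w
  rw [e1, Real.mul_rpow (inv_nonneg.2 ht.le) (by positivity), Real.inv_rpow ht.le, Real.rpow_neg ht.le, inv_inv,
    Real.rpow_add ht, Real.rpow_natCast] at h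
  rw [abs_mul, abs_of_nonneg (inv_nonneg.2 (pow_nonneg ht.le n))]
  calc _ ≤ (t ^ n)⁻¹ * (C₁ * (t ^ n * t ^ δ * (t + ‖w‖) ^ (-((n:ℝ) + δ)))) := by gcongr
    _ = _ := by field_simp

theorem psit_diff {C₁ C₂ δ γ : ℝ} {ψ : Rn n → ℝ} (hψ : PsiKernel n C₁ C₂ δ γ ψ) {t : ℝ} (ht : 0 < t) (w h : Rn n)
    (hwh : 2 * ‖h‖ ≤ ‖w‖) :
    |(t ^ n)⁻¹ * ψ (t⁻¹ • (w + h)) - (t ^ n)⁻¹ * ψ (t⁻¹ • w)| ≤ C₂ * (‖h‖ ^ γ * t ^ δ * (t + ‖w‖) ^ (-((n:ℝ) + δ + γ))) := by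
  have h1 := hψ.2.2.2 (t⁻¹ • w) (t⁻¹ • h) (by
    rw [norm_smul, norm_smul, Real.norm_of_nonneg (inv_nonneg.2 ht.le)]
    have : 0 < t⁻¹ := inv_pos.2 ht
    nlinarith)
  rw [← smul_add, norm_smul, norm_smul, Real.norm_of_nonneg (inv_nonneg.2 ht.le)] at h1
  have e1 : 1 + t⁻¹ * ‖w‖ = t⁻¹ * (t + ‖w‖) := by field_simp
  have hw := norm_nonneg w
  have hh := norm_nonneg h
  have hti := inv_nonneg.2 ht.le
  rw [e1, Real.mul_rpow hti hh, Real.mul_rpow hti (by positivity), Real.inv_rpow ht.le, Real.inv_rpow ht.le, Real.rpow_neg ht.le, inv_inv,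
    Real.rpow_add ht, Real.rpow_add ht, Real.rpow_natCast] at h1
  rw [← mul_sub, abs_mul, abs_of_nonneg (inv_nonneg.2 (pow_nonneg ht.le n))]
  have hg : 0 < t ^ γ := by positivity
  calc _ ≤ (t ^ n)⁻¹ * (C₂ * ((t ^ γ)⁻¹ * ‖h‖ ^ γ) * (t ^ n * t ^ δ * t ^ γ * (t + ‖w‖) ^ (-((n:ℝ) + δ + γ)))) := by gcongr
    _ = _ := by field_simp

theorem lint_half (n : ℕ) (s A B : ℝ) (hB : (n:ℝ) < B) (hp : 0 < s + n - B) (hq : 0 < A - (s + n - B)) :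
    ∃ C : ℝ, 0 < C ∧ ∀ D : ℝ, 0 < D → ∀ c : Rn n,
     ∫⁻ p, ENNReal.ofReal (p.1 ^ (s - 1) * (p.1 + D) ^ (-A) * (p.1 + dist p.2 c) ^ (-B)) ∂(PM n)
       ≤ ENNReal.ofReal (C * D ^ (s + n - B - A)) := by
  obtain ⟨L, hL, hL'⟩ := lint_pow n B hB
  obtain ⟨K, hK, hK'⟩ := lint_1d (s + n - B) (A - (s + n - B)) hp hq
  refine ⟨L * K, by positivity, ?_⟩
  intro D hD c
  rw [PM_lint (by apply Measurable.aemeasurable; fun_prop)]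
  have step : ∀ t ∈ Ioi (0:ℝ), ∫⁻ y : Rn n, ENNReal.ofReal (t ^ (s - 1) * (t + D) ^ (-A) * (t + dist y c) ^ (-B))
      ≤ ENNReal.ofReal L * ENNReal.ofReal (t ^ ((s + n - B) - 1) * (t + D) ^ (-((s + n - B) + (A - (s + n - B))))) := by
    intro t ht
    have ht : 0 < t := ht
    have h1 : ∀ y : Rn n, ENNReal.ofReal (t ^ (s - 1) * (t + D) ^ (-A) * (t + dist y c) ^ (-B)) =
        ENNReal.ofReal (t ^ (s - 1) * (t + D) ^ (-A)) * ENNReal.ofReal ((t + dist y c) ^ (-B)) := by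
      intro y; rw [← ENNReal.ofReal_mul (by positivity)]
    simp_rw [h1]
    rw [lintegral_const_mul' _ _ ENNReal.ofReal_ne_top]
    refine (mul_le_mul_right (hL' t ht c) _).trans ?_
    rw [← ENNReal.ofReal_mul (by positivity), ← ENNReal.ofReal_mul (by positivity)]
    apply ENNReal.ofReal_le_ofReal
    apply le_of_eq
    have e1 : s + n - B - 1 = (s - 1) + (n - B) := by ring
    have e2 : -((s + n - B) + (A - (s + n - B))) = -A := by ring
    rw [e1, e2, Real.rpow_add ht]; ring
  refine (setLIntegral_mono' measurableSet_Ioi step).trans ?_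
  rw [lintegral_const_mul' _ _ ENNReal.ofReal_ne_top]
  refine (mul_le_mul_right (hK' D hD) _).trans ?_
  rw [← ENNReal.ofReal_mul (by positivity)]
  apply ENNReal.ofReal_le_ofReal
  apply le_of_eq
  have e2 : -(A - (s + n - B)) = s + n - B - A := by ring
  rw [e2]; ring

theorem lint_half2 (n : ℕ) (s B : ℝ) (hB : (n:ℝ) < B) (hp : 0 < s) (hq : 0 < B - n - s) :
    ∃ C : ℝ, 0 < C ∧ ∀ D : ℝ, 0 < D → ∀ c : Rn n,
     ∫⁻ p, ENNReal.ofReal (p.1 ^ (s - 1) * (p.1 + D + dist p.2 c) ^ (-B)) ∂(PM n)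
       ≤ ENNReal.ofReal (C * D ^ (s + n - B)) := by
  obtain ⟨L, hL, hL'⟩ := lint_pow n B hB
  obtain ⟨K, hK, hK'⟩ := lint_1d s (B - n - s) hp hq
  refine ⟨L * K, by positivity, ?_⟩
  intro D hD c
  rw [PM_lint (by apply Measurable.aemeasurable; fun_prop)]
  have step : ∀ t ∈ Ioi (0:ℝ), ∫⁻ y : Rn n, ENNReal.ofReal (t ^ (s - 1) * (t + D + dist y c) ^ (-B))
      ≤ ENNReal.ofReal L * ENNReal.ofReal (t ^ (s - 1) * (t + D) ^ (-(s + (B - n - s)))) := by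
    intro t ht
    have ht : 0 < t := ht
    have h1 : ∀ y : Rn n, ENNReal.ofReal (t ^ (s - 1) * (t + D + dist y c) ^ (-B)) =
        ENNReal.ofReal (t ^ (s - 1)) * ENNReal.ofReal ((t + D + dist y c) ^ (-B)) := by
      intro y; rw [← ENNReal.ofReal_mul (by positivity)]
    simp_rw [h1]
    rw [lintegral_const_mul' _ _ ENNReal.ofReal_ne_top]
    refine (mul_le_mul_right (hL' (t + D) (by positivity) c) _).trans ?_
    rw [← ENNReal.ofReal_mul (by positivity), ← ENNReal.ofReal_mul (by positivity)]
    apply ENNReal.ofReal_le_ofReal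
    apply le_of_eq
    have e2 : -(s + (B - n - s)) = n - B := by ring
    rw [e2]; ring
  refine (setLIntegral_mono' measurableSet_Ioi step).trans ?_
  rw [lintegral_const_mul' _ _ ENNReal.ofReal_ne_top]
  refine (mul_le_mul_right (hK' D hD) _).trans ?_
  rw [← ENNReal.ofReal_mul (by positivity)]
  apply ENNReal.ofReal_le_ofReal
  apply le_of_eq
  have e2 : -(B - n - s) = s + n - B := by ring
  rw [e2]; ring

end PC4

section PD1
/-- Volume of the unit ball. -/
def VB (n : ℕ) : ℝ := (volume (ball (0 : Rn n) 1)).toReal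

theorem VB_pos : 0 < VB n :=
  ENNReal.toReal_pos (measure_ball_pos _ _ one_pos).ne' measure_ball_lt_top.ne

theorem vol_ball (c : Rn n) {r : ℝ} (hr : 0 < r) : volume (ball c r) = ENNReal.ofReal (VB n * r ^ n) := by
  rw [Measure.addHaar_ball_of_pos _ _ hr, mul_comm (VB n), ENNReal.ofReal_mul (by positivity)]
  congr 1
  · simp
  · exact (ENNReal.ofReal_toReal measure_ball_lt_top.ne).symm

theorem psit_le {C₁ C₂ δ γ : ℝ} (hC₁ : 0 < C₁) (hδ : 0 < δ) {ψ : Rn n → ℝ} (hψ : PsiKernel n C₁ C₂ δ γ ψ) {t : ℝ} (ht : 0 < t) (w : Rn n) :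
    |(t ^ n)⁻¹ * ψ (t⁻¹ • w)| ≤ C₁ * (t ^ n)⁻¹ := by
  refine (psit_bd hψ ht w).trans ?_
  have hw := norm_nonneg w
  have h1 : (t + ‖w‖) ^ (-((n:ℝ) + δ)) ≤ t ^ (-((n:ℝ) + δ)) :=
    Real.rpow_le_rpow_of_nonpos ht (by linarith) (by linarith [(Nat.cast_nonneg n : (0:ℝ) ≤ n)])
  have h2 : t ^ δ * t ^ (-((n:ℝ) + δ)) = (t ^ n)⁻¹ := by
    rw [← Real.rpow_add ht, ← Real.rpow_natCast, ← Real.rpow_neg ht.le]; ring_nf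
  rw [← h2]
  gcongr

theorem psit_int {C₁ C₂ δ γ : ℝ} {ψ : Rn n → ℝ} (hψ : PsiKernel n C₁ C₂ δ γ ψ) {t : ℝ} (ht : 0 < t) (y : Rn n) :
    Integrable (fun z => (t ^ n)⁻¹ * ψ (t⁻¹ • (y - z))) volume :=
  ((hψ.1.comp_smul (inv_ne_zero ht.ne')).comp_sub_left y).const_mul _

theorem psit_mul_int {C₁ C₂ δ γ : ℝ} (hC₁ : 0 < C₁) (hδ : 0 < δ) {ψ : Rn n → ℝ} (hψ : PsiKernel n C₁ C₂ δ γ ψ) {t : ℝ} (ht : 0 < t) (y : Rn n)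
    {h : Rn n → ℝ} (hh : Integrable h volume) :
    Integrable (fun z => (t ^ n)⁻¹ * ψ (t⁻¹ • (y - z)) * h z) volume :=
  hh.bdd_mul (psit_int hψ ht y).1 (Filter.Eventually.of_forall fun z => psit_le hC₁ hδ hψ ht (y - z))

theorem cvl_crude {C₁ C₂ δ γ : ℝ} (hC₁ : 0 < C₁) (hδ : 0 < δ) {ψ : Rn n → ℝ} (hψ : PsiKernel n C₁ C₂ δ γ ψ) {t : ℝ} (ht : 0 < t)
    (h : Rn n → ℝ) (y : Rn n) :
    Phi ψ h (t, y) ≤ ENNReal.ofReal (C₁ * (t ^ n)⁻¹) * ∫⁻ z, ENNReal.ofReal |h z| := by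
  unfold Phi cvl
  rw [← Real.norm_eq_abs, ofReal_norm]
  refine (enorm_integral_le_lintegral_enorm _).trans ?_
  rw [← lintegral_const_mul' _ _ ENNReal.ofReal_ne_top]
  apply lintegral_mono
  intro z
  dsimp only
  rw [← ofReal_norm, ← ENNReal.ofReal_mul (by positivity), norm_mul]
  apply ENNReal.ofReal_le_ofReal
  simp only [Real.norm_eq_abs]
  gcongr
  exact psit_le hC₁ hδ hψ ht (y - z)

theorem atom_l1 {g : Rn n → ℝ} {H r : ℝ} (hr : 0 < r) (hH : 0 < H) {c : Rn n} (hb : ∀ x, |g x| ≤ H) (hs : ∀ x, x ∉ ball c r → g x = 0) :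
    ∫⁻ z, ENNReal.ofReal |g z| ≤ ENNReal.ofReal (H * (VB n * r ^ n)) := by
  rw [ENNReal.ofReal_mul hH.le, ← vol_ball c hr, ← lintegral_indicator_const measurableSet_ball]
  apply lintegral_mono
  intro z
  by_cases hz : z ∈ ball c r
  · simp only [indicator_of_mem hz]; exact ENNReal.ofReal_le_ofReal (hb z)
  · simp [hs z hz]

theorem atom_l2 {g : Rn n → ℝ} {H r : ℝ} (hr : 0 < r) (hH : 0 < H) {c : Rn n} (hb : ∀ x, |g x| ≤ H) (hs : ∀ x, x ∉ ball c r → g x = 0) :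
    ∫⁻ z, ENNReal.ofReal |g z| ^ 2 ≤ ENNReal.ofReal (H ^ 2 * (VB n * r ^ n)) := by
  rw [ENNReal.ofReal_mul (by positivity), ← vol_ball c hr, ← lintegral_indicator_const measurableSet_ball]
  apply lintegral_mono
  intro z
  by_cases hz : z ∈ ball c r
  · simp only [indicator_of_mem hz]
    rw [← ENNReal.ofReal_pow (abs_nonneg _)]
    apply ENNReal.ofReal_le_ofReal
    have := hb z
    gcongr
  · simp [hs z hz]

theorem atom_near_Phi {C₁ C₂ δ γ : ℝ} (hC₁ : 0 < C₁) (hδ : 0 < δ) {ψ : Rn n → ℝ} (hψ : PsiKernel n C₁ C₂ δ γ ψ) {t : ℝ} (ht : 0 < t)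
    {g : Rn n → ℝ} {H r : ℝ} (hr : 0 < r) (hH : 0 < H) {c : Rn n} (hb : ∀ x, |g x| ≤ H) (hs : ∀ x, x ∉ ball c r → g x = 0) (y : Rn n) :
    |cvl ψ t g y| ≤ C₁ * (t ^ n)⁻¹ * (H * (VB n * r ^ n)) := by
  have h := (cvl_crude hC₁ hδ hψ ht g y).trans (mul_le_mul_right (atom_l1 hr hH hb hs) _)
  have hV := VB_pos (n := n)
  rw [← ENNReal.ofReal_mul (by positivity)] at h
  exact (ENNReal.ofReal_le_ofReal_iff (by positivity)).1 h

theorem atom_far_Phi {C₁ C₂ δ γ : ℝ} (hC₁ : 0 < C₁) (hC₂ : 0 < C₂) (hδ : 0 < δ) (hγ : 0 < γ) {ψ : Rn n → ℝ} (hψ : PsiKernel n C₁ C₂ δ γ ψ) {t : ℝ} (ht : 0 < t)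
    {g : Rn n → ℝ} (hg : Integrable g volume) {H r : ℝ} (hr : 0 < r) (hH : 0 < H) {c : Rn n} (hb : ∀ x, |g x| ≤ H) (hs : ∀ x, x ∉ ball c r → g x = 0)
    (h0 : ∫ x, g x = 0) (y : Rn n) (hy : 2 * r ≤ dist y c) :
    |cvl ψ t g y| ≤ C₂ * (r ^ γ * t ^ δ * (t + dist y c) ^ (-((n:ℝ) + δ + γ))) * (H * (VB n * r ^ n)) := by
  have hV := VB_pos (n := n)
  set M := C₂ * (r ^ γ * t ^ δ * (t + dist y c) ^ (-((n:ℝ) + δ + γ))) with hM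
  have hM0 : 0 ≤ M := by positivity
  have e1 : cvl ψ t g y = ∫ z, ((t ^ n)⁻¹ * ψ (t⁻¹ • (y - z)) - (t ^ n)⁻¹ * ψ (t⁻¹ • (y - c))) * g z := by
    simp_rw [sub_mul]
    rw [integral_sub (psit_mul_int hC₁ hδ hψ ht y hg) (hg.const_mul _), integral_const_mul, h0, mul_zero, sub_zero]
    rfl
  rw [e1]
  have e2 : ∀ z, ‖((t ^ n)⁻¹ * ψ (t⁻¹ • (y - z)) - (t ^ n)⁻¹ * ψ (t⁻¹ • (y - c))) * g z‖ₑ ≤ ENNReal.ofReal M * ENNReal.ofReal |g z| := by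
    intro z
    rw [enorm_mul, ← ofReal_norm, ← ofReal_norm (g z), Real.norm_eq_abs, Real.norm_eq_abs]
    by_cases hz : z ∈ ball c r
    · gcongr
      have hz' : ‖c - z‖ < r := by rw [← dist_eq_norm, dist_comm]; exact hz
      have := psit_diff hψ ht (y - c) (c - z) (by rw [← dist_eq_norm y c]; linarith)
      rw [sub_add_sub_cancel, ← dist_eq_norm y c] at this
      refine this.trans ?_
      rw [hM]
      gcongr
    · simp [hs z hz]
  have e3 : ‖∫ z, ((t ^ n)⁻¹ * ψ (t⁻¹ • (y - z)) - (t ^ n)⁻¹ * ψ (t⁻¹ • (y - c))) * g z‖ₑ ≤ ENNReal.ofReal (M * (H * (VB n * r ^ n))) := by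
    refine (enorm_integral_le_lintegral_enorm _).trans ((lintegral_mono e2).trans ?_)
    rw [lintegral_const_mul' _ _ ENNReal.ofReal_ne_top, ENNReal.ofReal_mul hM0]
    gcongr
    exact atom_l1 hr hH hb hs
  rw [← ofReal_norm] at e3
  exact (ENNReal.ofReal_le_ofReal_iff (by positivity)).1 e3

theorem sc_split {Y Z S a m : ℝ} (hY : 0 < Y) (hZ : 0 < Z) (hS : 0 < S) (ha : 0 < a) (hm : 0 < m) (h : S ≤ Y + Z) :
    Z ^ (-a) * Y ^ (-m) ≤ 2 ^ m * (S ^ (-m) * Z ^ (-a)) + 2 ^ a * (S ^ (-a) * Y ^ (-m)) := by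
  have key : ∀ (U b : ℝ), 0 < U → 0 < b → S / 2 ≤ U → U ^ (-b) ≤ 2 ^ b * S ^ (-b) := by
    intro U b hU hb hSU
    calc U ^ (-b) ≤ (S / 2) ^ (-b) := Real.rpow_le_rpow_of_nonpos (by positivity) hSU (by linarith)
      _ = 2 ^ b * S ^ (-b) := by
        rw [div_eq_mul_inv, Real.mul_rpow hS.le (by norm_num), Real.inv_rpow (by norm_num), Real.rpow_neg (by norm_num : (0:ℝ) ≤ 2), inv_inv, mul_comm]
  have p1 : 0 < 2 ^ m * (S ^ (-m) * Z ^ (-a)) := by positivity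
  have p2 : 0 < 2 ^ a * (S ^ (-a) * Y ^ (-m)) := by positivity
  by_cases hc : S / 2 ≤ Y
  · have := key Y m hY hm hc
    calc _ ≤ Z ^ (-a) * (2 ^ m * S ^ (-m)) := by gcongr
      _ = 2 ^ m * (S ^ (-m) * Z ^ (-a)) := by ring
      _ ≤ _ := by linarith
  · have := key Z a hZ ha (by linarith)
    calc _ ≤ (2 ^ a * S ^ (-a)) * Y ^ (-m) := by gcongr
      _ = 2 ^ a * (S ^ (-a) * Y ^ (-m)) := by ring
      _ ≤ _ := by linarith

theorem wt_eq (a : ℝ) (x : Rn n) {t : ℝ} (ht : 0 < t) (y : Rn n) :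
    wt a x (t, y) = ENNReal.ofReal (t ^ (a - n - 1) * (t + dist x y) ^ (-a)) := by
  unfold wt
  simp only
  congr 1
  rw [Real.div_rpow ht.le (by positivity), Real.rpow_neg (by positivity), sub_sub, Real.rpow_sub ht]
  have : t ^ ((n:ℝ) + 1) = t ^ (n + 1) := by exact_mod_cast Real.rpow_natCast t (n + 1)
  rw [this]; ring

end PD1

section PD2
theorem lint_near (n : ℕ) (a : ℝ) (ha : 3 * (n:ℝ) < a) (hn : 1 ≤ n) :
    ∃ C : ℝ, 0 < C ∧ ∀ D : ℝ, 0 < D → ∀ r : ℝ, 0 < r → ∀ c : Rn n,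
     ∫⁻ p, (ball c (2 * r)).indicator (fun _ => ENNReal.ofReal (p.1 ^ (a - 3 * n - 1) * (p.1 + D) ^ (-a))) p.2 ∂(PM n)
       ≤ ENNReal.ofReal (C * r ^ n * D ^ (-(3 * (n:ℝ)))) := by
  have hn' : (1:ℝ) ≤ n := by exact_mod_cast hn
  obtain ⟨K, hK, hK'⟩ := lint_1d (a - 3 * n) (3 * n) (by linarith) (by linarith)
  have hV := VB_pos (n := n)
  refine ⟨VB n * 2 ^ n * K, by positivity, ?_⟩
  intro D hD r hr c
  have hm : Measurable (fun p : ℝ × Rn n => (ball c (2 * r)).indicator (fun _ => ENNReal.ofReal (p.1 ^ (a - 3 * n - 1) * (p.1 + D) ^ (-a))) p.2) := by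
    have : (fun p : ℝ × Rn n => (ball c (2 * r)).indicator (fun _ => ENNReal.ofReal (p.1 ^ (a - 3 * n - 1) * (p.1 + D) ^ (-a))) p.2)
      = (Prod.snd ⁻¹' (ball c (2 * r))).indicator (fun p => ENNReal.ofReal (p.1 ^ (a - 3 * n - 1) * (p.1 + D) ^ (-a))) := by
      funext p; simp [indicator]
    rw [this]
    exact Measurable.indicator (by fun_prop) (measurable_snd measurableSet_ball)
  rw [PM_lint hm.aemeasurable]
  simp only
  simp_rw [lintegral_indicator_const (measurableSet_ball (x := c) (ε := 2 * r))]
  rw [lintegral_mul_const' _ _ measure_ball_lt_top.ne, vol_ball c (by positivity)]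
  have := hK' D hD
  rw [show (-(a - 3 * (n:ℝ) + 3 * n)) = -a by ring] at this
  refine (mul_le_mul_left this _).trans ?_
  rw [← ENNReal.ofReal_mul (by positivity)]
  apply ENNReal.ofReal_le_ofReal
  apply le_of_eq
  rw [mul_pow]; ring

set_option maxHeartbeats 1000000 in
theorem atom_far (hn : 1 ≤ n) {C₁ C₂ δ γ : ℝ} (hC₁ : 0 < C₁) (hC₂ : 0 < C₂) (hδ : 0 < δ) (hγ : 0 < γ) {ψ : Rn n → ℝ} (hψ : PsiKernel n C₁ C₂ δ γ ψ) 
    {a : ℝ} (ha : 3 * (n:ℝ) + 2 * δ + 2 * γ < a) :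
    ∃ C : ℝ, 0 < C ∧ ∀ (g : Rn n → ℝ) (_ : Integrable g volume) (H r : ℝ) (_ : 0 < r) (_ : 0 < H) (c : Rn n) (_ : ∀ x, |g x| ≤ H) 
      (_ : ∀ x, x ∉ ball c r → g x = 0) (_ : ∫ x, g x = 0) (x : Rn n), 4 * r ≤ dist x c →
      Gs a (Phi ψ g) x ≤ ENNReal.ofReal (C * H * (r ^ ((n:ℝ) + γ) * (dist x c) ^ (-((n:ℝ) + γ)) + r ^ (3 / 2 * (n:ℝ)) * (dist x c) ^ (-(3 / 2 * (n:ℝ))))) := by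
  have hn' : (1:ℝ) ≤ n := by exact_mod_cast hn
  have hV := VB_pos (n := n)
  set m := (n:ℝ) + δ + γ with hm
  obtain ⟨L1, hL1, hL1'⟩ := lint_half n (2 * δ + a - n) (2 * m) a (by linarith) (by linarith) (by rw [hm]; linarith)
  obtain ⟨L2, hL2, hL2'⟩ := lint_half n (2 * δ + a - n) a (2 * m) (by rw [hm]; linarith) (by rw [hm]; linarith) (by rw [hm]; linarith)
  obtain ⟨L3, hL3, hL3'⟩ := lint_near n a (by linarith) hn
  set K1 := (C₂ * VB n) ^ 2 * (2 ^ (2 * m) * L1 + 2 ^ a * L2) with hK1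
  set K3 := (C₁ * VB n) ^ 2 * (2 ^ a * L3) with hK3
  have hK10 : 0 < K1 := by positivity
  have hK30 : 0 < K3 := by positivity
  refine ⟨K1 + K3 + 1, by positivity, ?_⟩
  intro g hg H r hr hH c hb hs h0 x hx
  set D := dist x c with hD
  have hD0 : 0 < D := by linarith
  apply Gs_le_of_sq
  set X1 := (C₂ * VB n * H * r ^ ((n:ℝ) + γ)) ^ 2 with hX1
  set X3 := (C₁ * VB n * H * r ^ n) ^ 2 with hX3
  have step : ∀ p : ℝ × Rn n, 0 < p.1 → wt a x p * Phi ψ g p ^ 2 ≤ 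
      (ENNReal.ofReal (X1 * 2 ^ (2 * m)) * ENNReal.ofReal (p.1 ^ (2 * δ + a - n - 1) * (p.1 + D) ^ (-(2 * m)) * (p.1 + dist p.2 x) ^ (-a))
      + ENNReal.ofReal (X1 * 2 ^ a) * ENNReal.ofReal (p.1 ^ (2 * δ + a - n - 1) * (p.1 + D) ^ (-a) * (p.1 + dist p.2 c) ^ (-(2 * m))))
      + ENNReal.ofReal (X3 * 2 ^ a) * (ball c (2 * r)).indicator (fun _ => ENNReal.ofReal (p.1 ^ (a - 3 * n - 1) * (p.1 + D) ^ (-a))) p.2 := by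
    rintro ⟨t, y⟩ ht
    simp only at ht ⊢
    rw [wt_eq a x ht y]
    unfold Phi
    simp only
    rw [← ENNReal.ofReal_pow (abs_nonneg _), ← ENNReal.ofReal_mul (by positivity)]
    have htri : D ≤ dist y c + dist x y := by rw [hD]; linarith [dist_triangle x y c]
    have hyc := dist_nonneg (x := y) (y := c)
    have hxy := dist_nonneg (x := x) (y := y)
    by_cases hy : y ∈ ball c (2 * r)
    · refine le_trans ?_ le_add_self
      rw [indicator_of_mem hy, ← ENNReal.ofReal_mul (by positivity)]
      apply ENNReal.ofReal_le_ofReal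
      have hb1 := atom_near_Phi hC₁ hδ hψ ht hr hH hb hs y
      have hy' : dist y c < 2 * r := hy
      have hz : (t + D) / 2 ≤ t + dist x y := by linarith
      have hz' : (t + dist x y) ^ (-a) ≤ 2 ^ a * (t + D) ^ (-a) := by
        calc _ ≤ ((t + D) / 2) ^ (-a) := Real.rpow_le_rpow_of_nonpos (by positivity) hz (by linarith)
          _ = _ := by
            rw [div_eq_mul_inv, Real.mul_rpow (by positivity) (by norm_num), Real.inv_rpow (by norm_num), Real.rpow_neg (by norm_num : (0:ℝ) ≤ 2), inv_inv, mul_comm]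
      have e1 : t ^ (a - 3 * n - 1) = t ^ (a - n - 1) * ((t ^ n)⁻¹) ^ 2 := by
        rw [← Real.rpow_natCast t n, ← Real.rpow_neg ht.le, ← Real.rpow_natCast _ 2, ← Real.rpow_mul ht.le, ← Real.rpow_add ht]
        congr 1; push_cast; ring
      calc _ ≤ t ^ (a - n - 1) * (2 ^ a * (t + D) ^ (-a)) * (C₁ * (t ^ n)⁻¹ * (H * (VB n * r ^ n))) ^ 2 := by gcongr
        _ = _ := by rw [e1, hX3]; ring
    · refine le_trans ?_ le_self_add
      have hy' : 2 * r ≤ dist y c := by simpa using hy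
      rw [← ENNReal.ofReal_mul (by positivity), ← ENNReal.ofReal_mul (by positivity), ← ENNReal.ofReal_add (by positivity) (by positivity)]
      apply ENNReal.ofReal_le_ofReal
      have hb1 := atom_far_Phi hC₁ hC₂ hδ hγ hψ ht hg hr hH hb hs h0 y hy'
      have hsc := sc_split (Y := t + dist y c) (Z := t + dist x y) (S := t + D) (a := a) (m := 2 * m) (by positivity) (by positivity)
        (by positivity) (by linarith) (by positivity) (by linarith)
      have e1 : t ^ (2 * δ + a - n - 1) = t ^ (a - n - 1) * (t ^ δ) ^ 2 := by
        rw [← Real.rpow_natCast (t ^ δ), ← Real.rpow_mul ht.le, ← Real.rpow_add ht]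
        congr 1; push_cast; ring
      have e2 : (t + dist y c) ^ (-(2 * m)) = ((t + dist y c) ^ (-m)) ^ 2 := by
        rw [← Real.rpow_natCast, ← Real.rpow_mul (by positivity)]
        congr 1; push_cast; ring
      have e3 : r ^ ((n:ℝ) + γ) = r ^ n * r ^ γ := by rw [Real.rpow_add hr, Real.rpow_natCast]
      have hX1' : 0 ≤ t ^ (2 * δ + a - n - 1) * X1 := by positivity
      calc _ ≤ t ^ (a - n - 1) * (t + dist x y) ^ (-a) * (C₂ * (r ^ γ * t ^ δ * (t + dist y c) ^ (-m)) * (H * (VB n * r ^ n))) ^ 2 := by gcongr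
        _ = (t ^ (2 * δ + a - n - 1) * X1) * ((t + dist x y) ^ (-a) * (t + dist y c) ^ (-(2 * m))) := by
            rw [e1, e2, hX1, e3]; ring
        _ ≤ (t ^ (2 * δ + a - n - 1) * X1) * _ := mul_le_mul_of_nonneg_left hsc hX1'
        _ = _ := by rw [dist_comm y x]; ring
  have hm1 : Measurable (fun p : ℝ × Rn n => ENNReal.ofReal (X1 * 2 ^ (2 * m)) * ENNReal.ofReal (p.1 ^ (2 * δ + a - n - 1) * (p.1 + D) ^ (-(2 * m)) * (p.1 + dist p.2 x) ^ (-a))) := by fun_prop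
  have hm2 : Measurable (fun p : ℝ × Rn n => ENNReal.ofReal (X1 * 2 ^ a) * ENNReal.ofReal (p.1 ^ (2 * δ + a - n - 1) * (p.1 + D) ^ (-a) * (p.1 + dist p.2 c) ^ (-(2 * m)))) := by fun_prop
  refine (lintegral_mono_ae (PM_pos.mono step)).trans ?_
  rw [lintegral_add_left (by exact hm1.add hm2), lintegral_add_left hm1, lintegral_const_mul' _ _ ENNReal.ofReal_ne_top, lintegral_const_mul' _ _ ENNReal.ofReal_ne_top, lintegral_const_mul' _ _ ENNReal.ofReal_ne_top]
  have i1 := hL1' D hD0 x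
  have i2 := hL2' D hD0 c
  have i3 := hL3' D hD0 r hr c
  refine (add_le_add (add_le_add (mul_le_mul_right i1 _) (mul_le_mul_right i2 _)) (mul_le_mul_right i3 _)).trans ?_
  rw [← ENNReal.ofReal_mul (by positivity), ← ENNReal.ofReal_mul (by positivity), ← ENNReal.ofReal_mul (by positivity),
    ← ENNReal.ofReal_add (by positivity) (by positivity), ← ENNReal.ofReal_add (by positivity) (by positivity),
    ← ENNReal.ofReal_pow (by positivity)]
  apply ENNReal.ofReal_le_ofReal
  set U := r ^ ((n:ℝ) + γ) * D ^ (-((n:ℝ) + γ)) with hU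
  set W := r ^ (3 / 2 * (n:ℝ)) * D ^ (-(3 / 2 * (n:ℝ))) with hW
  have hU0 : 0 < U := by positivity
  have hW0 : 0 < W := by positivity
  have d1 : D ^ (2 * δ + a - n + n - a - 2 * m) = (D ^ (-((n:ℝ) + γ))) ^ 2 := by
    rw [← Real.rpow_natCast, ← Real.rpow_mul hD0.le]; congr 1; push_cast; rw [hm]; ring
  have d2 : D ^ (2 * δ + a - n + n - 2 * m - a) = (D ^ (-((n:ℝ) + γ))) ^ 2 := by
    rw [← d1]; congr 1; ring
  have d3 : D ^ (-(3 * (n:ℝ))) = (D ^ (-(3 / 2 * (n:ℝ)))) ^ 2 := by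
    rw [← Real.rpow_natCast, ← Real.rpow_mul hD0.le]; congr 1; push_cast; ring
  have d4 : (r ^ n) ^ 2 * r ^ n = (r ^ (3 / 2 * (n:ℝ))) ^ 2 := by
    rw [← Real.rpow_natCast (r ^ (3 / 2 * (n:ℝ))), ← Real.rpow_mul hr.le, ← Real.rpow_natCast r n, ← Real.rpow_natCast _ 2, ← Real.rpow_mul hr.le, ← Real.rpow_add hr]
    congr 1; push_cast; ring
  have tot : X1 * 2 ^ (2 * m) * (L1 * D ^ (2 * δ + a - n + n - a - 2 * m)) + X1 * 2 ^ a * (L2 * D ^ (2 * δ + a - n + n - 2 * m - a))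
      + X3 * 2 ^ a * (L3 * r ^ n * D ^ (-(3 * (n:ℝ)))) = H ^ 2 * (K1 * U ^ 2 + K3 * W ^ 2) := by
    rw [d1, d2, d3, hK1, hK3, hU, hW, hX1, hX3]
    linear_combination ((C₁ * VB n * H) ^ 2 * 2 ^ a * L3 * (D ^ (-(3 / 2 * (n:ℝ)))) ^ 2) * d4
  rw [tot]
  have f1 : K1 * U ^ 2 + K3 * W ^ 2 ≤ ((K1 + K3 + 1) * (U + W)) ^ 2 := by
    have g1 : K1 ≤ (K1 + K3 + 1) ^ 2 := by nlinarith
    have g2 : K3 ≤ (K1 + K3 + 1) ^ 2 := by nlinarith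
    calc K1 * U ^ 2 + K3 * W ^ 2 ≤ (K1 + K3 + 1) ^ 2 * U ^ 2 + (K1 + K3 + 1) ^ 2 * W ^ 2 := by gcongr
      _ ≤ (K1 + K3 + 1) ^ 2 * (U + W) ^ 2 := by
        have : 0 ≤ (K1 + K3 + 1) ^ 2 * (2 * (U * W)) := by positivity
        nlinarith
      _ = _ := by ring
  calc H ^ 2 * (K1 * U ^ 2 + K3 * W ^ 2) ≤ H ^ 2 * ((K1 + K3 + 1) * (U + W)) ^ 2 := by gcongr
    _ = _ := by ring

theorem enn_le_add_sq (u h : ℝ≥0∞) (h0 : h ≠ 0) (ht : h ≠ ⊤) : u ≤ h + u ^ 2 * h⁻¹ := by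
  by_cases hc : u ≤ h
  · exact hc.trans le_self_add
  · refine le_trans ?_ le_add_self
    push Not at hc
    calc u = u * (h * h⁻¹) := by rw [ENNReal.mul_inv_cancel h0 ht, mul_one]
      _ ≤ u * (u * h⁻¹) := by gcongr
      _ = _ := by ring

theorem atom_bd (hn : 1 ≤ n) {C₁ C₂ δ γ : ℝ} (hC₁ : 0 < C₁) (hC₂ : 0 < C₂) (hδ : 0 < δ) (hγ : 0 < γ) {ψ : Rn n → ℝ} (hψ : PsiKernel n C₁ C₂ δ γ ψ) 
    {a : ℝ} (ha : 3 * (n:ℝ) + 2 * δ + 2 * γ < a) :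
    ∃ C : ℝ, 0 < C ∧ ∀ (g : Rn n → ℝ) (_ : Integrable g volume) (H r : ℝ) (_ : 0 < r) (_ : 0 < H) (c : Rn n) (_ : ∀ x, |g x| ≤ H) 
      (_ : ∀ x, x ∉ ball c r → g x = 0) (_ : ∫ x, g x = 0),
      ∫⁻ x, Gs a (Phi ψ g) x ≤ ENNReal.ofReal (C * (H * r ^ n)) := by
  have hn' : (1:ℝ) ≤ n := by exact_mod_cast hn
  have hV := VB_pos (n := n)
  obtain ⟨A, hA, hA'⟩ := Gs_L2 hn hC₁ hC₂ hδ hγ hψ (a := a) (by linarith)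
  obtain ⟨B, hB, hB'⟩ := atom_far hn hC₁ hC₂ hδ hγ hψ ha
  obtain ⟨L1, hL1, hL1'⟩ := lint_pow n (n + γ) (by linarith)
  obtain ⟨L2, hL2, hL2'⟩ := lint_pow n (3 / 2 * n) (by linarith)
  refine ⟨VB n * 4 ^ n + A * VB n + B * (2 ^ ((n:ℝ) + γ) * L1 + 2 ^ (3 / 2 * (n:ℝ)) * L2), by positivity, ?_⟩
  intro g hg H r hr hH c hb hs h0
  have near : ∫⁻ x in ball c (4 * r), Gs a (Phi ψ g) x ≤ ENNReal.ofReal ((VB n * 4 ^ n + A * VB n) * (H * r ^ n)) := by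
    calc _ ≤ ∫⁻ x in ball c (4 * r), (ENNReal.ofReal H + Gs a (Phi ψ g) x ^ 2 * (ENNReal.ofReal H)⁻¹) := by
          apply lintegral_mono; intro x
          exact enn_le_add_sq _ _ (by simpa using hH) ENNReal.ofReal_ne_top
      _ = ENNReal.ofReal H * volume (ball c (4 * r)) + (∫⁻ x in ball c (4 * r), Gs a (Phi ψ g) x ^ 2) * (ENNReal.ofReal H)⁻¹ := by
          rw [lintegral_add_left measurable_const, setLIntegral_const, lintegral_mul_const' _ _ (by simpa using hH)]
      _ ≤ ENNReal.ofReal H * ENNReal.ofReal (VB n * (4 * r) ^ n) + (ENNReal.ofReal A * ENNReal.ofReal (H ^ 2 * (VB n * r ^ n))) * (ENNReal.ofReal H)⁻¹ := by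
          rw [vol_ball c (by positivity)]
          gcongr
          exact (setLIntegral_le_lintegral _ _).trans ((hA' g hg H hb).trans (mul_le_mul_right (atom_l2 hr hH hb hs) _))
      _ = _ := by
          rw [← ENNReal.ofReal_inv_of_pos hH, ← ENNReal.ofReal_mul (by positivity), ← ENNReal.ofReal_mul (by positivity),
             ← ENNReal.ofReal_mul (by positivity), ← ENNReal.ofReal_add (by positivity) (by positivity)]
          congr 1
          rw [mul_pow]; field_simp
  have far : ∫⁻ x in (ball c (4 * r))ᶜ, Gs a (Phi ψ g) x ≤ ENNReal.ofReal (B * (2 ^ ((n:ℝ) + γ) * L1 + 2 ^ (3 / 2 * (n:ℝ)) * L2) * (H * r ^ n)) := by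
    have key : ∀ (q D : ℝ), 0 < q → 4 * r ≤ D → D ^ (-q) ≤ 2 ^ q * (r + D) ^ (-q) := by
      intro q D hq hD
      calc _ ≤ ((r + D) / 2) ^ (-q) := Real.rpow_le_rpow_of_nonpos (by linarith) (by linarith) (by linarith)
        _ = _ := by
            rw [div_eq_mul_inv, Real.mul_rpow (by linarith) (by norm_num), Real.inv_rpow (by norm_num), Real.rpow_neg (by norm_num : (0:ℝ) ≤ 2), inv_inv, mul_comm]
    calc _ ≤ ∫⁻ x in (ball c (4 * r))ᶜ, (ENNReal.ofReal (B * H * (2 ^ ((n:ℝ) + γ) * r ^ ((n:ℝ) + γ))) * ENNReal.ofReal ((r + dist x c) ^ (-((n:ℝ) + γ)))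
              + ENNReal.ofReal (B * H * (2 ^ (3 / 2 * (n:ℝ)) * r ^ (3 / 2 * (n:ℝ)))) * ENNReal.ofReal ((r + dist x c) ^ (-(3 / 2 * (n:ℝ))))) := by
          apply setLIntegral_mono' measurableSet_ball.compl
          intro x hx
          have hx' : 4 * r ≤ dist x c := by simpa using hx
          refine (hB' g hg H r hr hH c hb hs h0 x hx').trans ?_
          have hD : 0 < dist x c := by linarith
          rw [← ENNReal.ofReal_mul (by positivity), ← ENNReal.ofReal_mul (by positivity), ← ENNReal.ofReal_add (by positivity) (by positivity)]
          apply ENNReal.ofReal_le_ofReal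
          have k1 := key ((n:ℝ) + γ) _ (by positivity) hx'
          have k2 := key (3 / 2 * (n:ℝ)) _ (by positivity) hx'
          calc _ ≤ B * H * (r ^ ((n:ℝ) + γ) * (2 ^ ((n:ℝ) + γ) * (r + dist x c) ^ (-((n:ℝ) + γ))) + r ^ (3 / 2 * (n:ℝ)) * (2 ^ (3 / 2 * (n:ℝ)) * (r + dist x c) ^ (-(3 / 2 * (n:ℝ))))) := by gcongr
            _ = _ := by ring
      _ ≤ ∫⁻ x, (ENNReal.ofReal (B * H * (2 ^ ((n:ℝ) + γ) * r ^ ((n:ℝ) + γ))) * ENNReal.ofReal ((r + dist x c) ^ (-((n:ℝ) + γ)))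
              + ENNReal.ofReal (B * H * (2 ^ (3 / 2 * (n:ℝ)) * r ^ (3 / 2 * (n:ℝ)))) * ENNReal.ofReal ((r + dist x c) ^ (-(3 / 2 * (n:ℝ))))) := setLIntegral_le_lintegral _ _
      _ ≤ ENNReal.ofReal (B * H * (2 ^ ((n:ℝ) + γ) * r ^ ((n:ℝ) + γ))) * ENNReal.ofReal (L1 * r ^ ((n:ℝ) - (n + γ)))
            + ENNReal.ofReal (B * H * (2 ^ (3 / 2 * (n:ℝ)) * r ^ (3 / 2 * (n:ℝ)))) * ENNReal.ofReal (L2 * r ^ ((n:ℝ) - (3 / 2 * n))) := by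
          rw [lintegral_add_left (by fun_prop), lintegral_const_mul' _ _ ENNReal.ofReal_ne_top, lintegral_const_mul' _ _ ENNReal.ofReal_ne_top]
          gcongr
          · exact hL1' r hr c
          · exact hL2' r hr c
      _ = _ := by
          rw [← ENNReal.ofReal_mul (by positivity), ← ENNReal.ofReal_mul (by positivity), ← ENNReal.ofReal_add (by positivity) (by positivity)]
          congr 1
          have e1 : r ^ ((n:ℝ) + γ) * r ^ ((n:ℝ) - (n + γ)) = r ^ n := by
            rw [← Real.rpow_add hr, ← Real.rpow_natCast]; congr 1; ring
          have e2 : r ^ (3 / 2 * (n:ℝ)) * r ^ ((n:ℝ) - (3 / 2 * n)) = r ^ n := by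
            rw [← Real.rpow_add hr, ← Real.rpow_natCast]; congr 1; ring
          linear_combination B * H * 2 ^ ((n:ℝ) + γ) * L1 * e1 + B * H * 2 ^ (3 / 2 * (n:ℝ)) * L2 * e2
  rw [← lintegral_add_compl _ (measurableSet_ball (x := c) (ε := 4 * r))]
  refine (add_le_add near far).trans ?_
  rw [← ENNReal.ofReal_add (by positivity) (by positivity)]
  apply ENNReal.ofReal_le_ofReal
  apply le_of_eq; ring

end PD2

section PE1
/-- Half-open cube with corner `p` and side `s`. -/
def dc (p : Rn n) (s : ℝ) : Set (Rn n) := {x | ∀ i, p i ≤ x i ∧ x i < p i + s}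

theorem dc_meas (p : Rn n) (s : ℝ) : MeasurableSet (dc p s) := by
  unfold dc
  rw [show {x : Rn n | ∀ i, p i ≤ x i ∧ x i < p i + s} = ⋂ i, {x : Rn n | p i ≤ x i ∧ x i < p i + s} by ext; simp]
  refine MeasurableSet.iInter fun i => ?_
  have hm : Measurable (fun x : Rn n => x i) := by fun_prop
  exact (measurableSet_le measurable_const hm).inter (measurableSet_lt hm measurable_const)

theorem dc_vol (p : Rn n) {s : ℝ} (hs : 0 < s) : volume (dc p s) = ENNReal.ofReal (s ^ n) := by
  have h : dc p s = (WithLp.ofLp : Rn n → (Fin n → ℝ)) ⁻¹' (Set.pi univ fun i => Ico (p i) (p i + s)) := by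
    ext x; simp [dc]
  rw [h, (PiLp.volume_preserving_ofLp (Fin n)).measure_preimage
    (MeasurableSet.univ_pi fun i => measurableSet_Ico).nullMeasurableSet, Real.volume_pi_Ico]
  simp [ENNReal.ofReal_pow hs.le]

theorem dc_dist {p : Rn n} {s : ℝ} (hs : 0 < s) {x y : Rn n} (hx : x ∈ dc p s) (hy : y ∈ dc p s) :
    dist x y < (n + 1) * s := by
  rw [EuclideanSpace.dist_eq, Real.sqrt_lt' (by positivity)]
  have : ∑ i, dist (x i) (y i) ^ 2 ≤ ∑ i : Fin n, s ^ 2 := by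
    apply Finset.sum_le_sum
    intro i _
    have h1 := hx i
    have h2 := hy i
    rw [Real.dist_eq]
    have : |x i - y i| ≤ s := by rw [abs_le]; constructor <;> linarith
    gcongr
  refine this.trans_lt ?_
  simp only [Finset.sum_const, Finset.card_univ, Fintype.card_fin, nsmul_eq_mul]
  have : (0:ℝ) ≤ n := by positivity
  have : 0 < s ^ 2 := by positivity
  nlinarith

theorem dc_self (p : Rn n) {s : ℝ} (hs : 0 < s) : p ∈ dc p s := fun i => ⟨le_rfl, by linarith⟩

theorem dc_sub_ball (p : Rn n) {s : ℝ} (hs : 0 < s) : dc p s ⊆ ball p ((n + 1) * s) :=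
  fun _ hx => dc_dist hs hx (dc_self p hs)

/-- Dyadic index. -/
def fl (p : Rn n) (s : ℝ) (k : ℕ) (x : Rn n) : Fin n → ℤ := fun i => ⌊(x i - p i) / s * 2 ^ k⌋

/-- Corner of a dyadic cube. -/
def crn (p : Rn n) (s : ℝ) (k : ℕ) (j : Fin n → ℤ) : Rn n := WithLp.toLp 2 (fun i => p i + s / 2 ^ k * j i)

theorem fl_eq_iff (p : Rn n) {s : ℝ} (hs : 0 < s) (k : ℕ) (x : Rn n) (j : Fin n → ℤ) :
    fl p s k x = j ↔ x ∈ dc (crn p s k j) (s / 2 ^ k) := by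
  simp only [fl, funext_iff, dc, crn, mem_setOf_eq]
  refine forall_congr' fun i => ?_
  rw [Int.floor_eq_iff]
  have h2 : (0:ℝ) < 2 ^ k := by positivity
  have e : (x i - p i) / s * 2 ^ k = (x i - p i) / (s / 2 ^ k) := by field_simp
  have h3 : 0 < s / 2 ^ k := by positivity
  rw [e, le_div_iff₀ h3, div_lt_iff₀ h3]
  constructor <;> rintro ⟨h, h'⟩ <;> constructor <;> linarith

theorem fl_nest (p : Rn n) (s : ℝ) (l m : ℕ) (x y : Rn n) (h : fl p s (l + m) x = fl p s (l + m) y) :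
    fl p s l x = fl p s l y := by
  have key : ∀ z : Rn n, ∀ i, fl p s l z i = fl p s (l + m) z i / ((2 ^ m : ℕ) : ℤ) := by
    intro z i
    simp only [fl]
    rw [← Int.floor_div_natCast]
    congr 1
    push_cast
    rw [pow_add]
    field_simp
  funext i
  rw [key, key, h]

theorem fl_nest' (p : Rn n) (s : ℝ) {l k : ℕ} (hl : l ≤ k) {x y : Rn n} (h : fl p s k x = fl p s k y) :
    fl p s l x = fl p s l y := by
  obtain ⟨m, rfl⟩ := Nat.exists_eq_add_of_le hl
  exact fl_nest p s l m x y h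

theorem fl_zero (p : Rn n) {s : ℝ} (hs : 0 < s) (x : Rn n) : fl p s 0 x = 0 ↔ x ∈ dc p s := by
  rw [fl_eq_iff p hs]
  simp [crn]

/-- bad cubes. -/
def bad (h : Rn n → ℝ) (p : Rn n) (s α : ℝ) (k : ℕ) (j : Fin n → ℤ) : Prop :=
  ENNReal.ofReal (α * (s / 2 ^ k) ^ n) < ∫⁻ x in dc (crn p s k j) (s / 2 ^ k), ENNReal.ofReal |h x|

/-- stopping. -/
def stopAt (h : Rn n → ℝ) (p : Rn n) (s α : ℝ) (k : ℕ) (x : Rn n) : Prop :=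
  bad h p s α k (fl p s k x) ∧ ∀ l < k, ¬ bad h p s α l (fl p s l x)

theorem stopAt_congr {h : Rn n → ℝ} {p : Rn n} {s α : ℝ} {k : ℕ} {x y : Rn n} (hxy : fl p s k x = fl p s k y)
    (hx : stopAt h p s α k x) : stopAt h p s α k y := by
  refine ⟨hxy ▸ hx.1, fun l hl => ?_⟩
  rw [← fl_nest' p s hl.le hxy]
  exact hx.2 l hl

theorem cz_leb {h : Rn n → ℝ} (hh : Integrable h) (p : Rn n) {s α : ℝ} (hs : 0 < s) (hα : 0 < α) :
    ∀ᵐ x, (∀ k, ¬ bad h p s α k (fl p s k x)) → |h x| ≤ α := by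
  filter_upwards [IsUnifLocDoublingMeasure.ae_tendsto_average_norm_sub volume hh.locallyIntegrable 1] with x hx hb
  have hσ0 : Filter.Tendsto (fun k : ℕ => ((n:ℝ) + 1) * (s / 2 ^ k)) Filter.atTop (nhdsWithin 0 (Ioi 0)) := by
    rw [tendsto_nhdsWithin_iff]
    constructor
    · have := (tendsto_pow_atTop_nhds_zero_of_lt_one (r := (1/2:ℝ)) (by norm_num) (by norm_num)).const_mul (((n:ℝ)+1) * s)
      simp only [mul_zero] at this
      refine this.congr fun k => ?_
      rw [one_div, inv_pow]; ring
    · filter_upwards with k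
      simp only [mem_Ioi]; positivity
  have T := hx (fun _ => x) _ hσ0 (by
    filter_upwards with k
    apply mem_closedBall_self; positivity)
  have T2 := (T.const_mul (VB n * (n + 1) ^ n)).const_add α
  simp only [mul_zero, add_zero] at T2
  refine ge_of_tendsto T2 ?_
  filter_upwards with k
  set σ := s / 2 ^ k with hσ
  have hσp : 0 < σ := by positivity
  have hD := hb k
  set D := dc (crn p s k (fl p s k x)) σ with hDdef
  have hxD : x ∈ D := (fl_eq_iff p hs k x _).1 rfl
  simp only [bad, not_lt] at hD
  have hsub : D ⊆ closedBall x ((n+1) * σ) := fun y hy => (dc_dist hσp hy hxD).le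
  have hvD : volume D = ENNReal.ofReal (σ ^ n) := dc_vol _ hσp
  have hI : IntegrableOn (fun y => ‖h y - h x‖) (closedBall x ((n+1) * σ)) := by
    apply Integrable.norm
    exact hh.integrableOn.sub (integrableOn_const (isCompact_closedBall x _).measure_lt_top.ne)
  have hvb : volume.real (closedBall x ((n+1) * σ)) = VB n * ((n+1) * σ) ^ n := by
    rw [Measure.real, Measure.addHaar_closedBall volume x (by positivity), ENNReal.toReal_mul, ENNReal.toReal_ofReal (by positivity), VB]
    simp [mul_comm]
  have hvDr : volume.real D = σ ^ n := by rw [Measure.real, hvD, ENNReal.toReal_ofReal (by positivity)]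
  have hfin : volume D ≠ ⊤ := by rw [hvD]; exact ENNReal.ofReal_ne_top
  have e1 : ∫ y in D, |h x| = σ ^ n * |h x| := by rw [setIntegral_const, hvDr, smul_eq_mul]
  have e2 : ∫ y in D, |h x| ≤ ∫ y in D, (|h y| + ‖h y - h x‖) := by
    apply setIntegral_mono_on (integrableOn_const hfin) ((hh.abs.integrableOn).add (hI.mono_set hsub)) (dc_meas _ _)
    intro y _
    have := abs_sub_abs_le_abs_sub (h x) (h y)
    rw [abs_sub_comm] at this
    change |h x| ≤ |h y| + |h y - h x|
    linarith
  rw [integral_add (hh.abs.integrableOn) (hI.mono_set hsub)] at e2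
  have e3 : ∫ y in D, |h y| ≤ α * σ ^ n := by
    rw [integral_eq_lintegral_of_nonneg_ae (by filter_upwards with y using abs_nonneg _) hh.abs.aestronglyMeasurable.restrict]
    exact ENNReal.toReal_le_of_le_ofReal (by positivity) hD
  have e4 : ∫ y in D, ‖h y - h x‖ ≤ ∫ y in closedBall x ((n+1) * σ), ‖h y - h x‖ :=
    setIntegral_mono_set hI (by filter_upwards with y using norm_nonneg _) hsub.eventuallyLE
  have e5 : ∫ y in closedBall x ((n+1) * σ), ‖h y - h x‖ = VB n * ((n+1) * σ) ^ n * ⨍ y in closedBall x ((n+1) * σ), ‖h y - h x‖ := by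
    rw [setAverage_eq, hvb, smul_eq_mul, mul_inv_cancel_left₀]
    have := VB_pos (n := n); positivity
  have hfinal : σ ^ n * |h x| ≤ σ ^ n * (α + VB n * (n+1) ^ n * ⨍ y in closedBall x ((n+1) * σ), ‖h y - h x‖) := by
    rw [← e1]
    refine e2.trans ((add_le_add e3 (e4.trans e5.le)).trans (le_of_eq ?_))
    rw [mul_pow]; ring
  exact le_of_mul_le_mul_left hfinal (by positivity)

theorem cz {h : Rn n → ℝ} (hh : Integrable h) (p : Rn n) {s α : ℝ} (hs : 0 < s) (hα : 0 < α)
    (hsupp : ∀ x, x ∉ dc p s → h x = 0) (h0 : ∫⁻ x, ENNReal.ofReal |h x| ≤ ENNReal.ofReal (α * s ^ n)) :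
    ∃ E : ℕ → Set (Rn n), Pairwise (fun i j => Disjoint (E i) (E j)) ∧
      (∀ i, E i = ∅ ∨ ∃ p' s', 0 < s' ∧ E i = dc p' s' ∧ dc p' s' ⊆ dc p s ∧
        ENNReal.ofReal (α * s' ^ n) < ∫⁻ x in dc p' s', ENNReal.ofReal |h x| ∧
        ∫⁻ x in dc p' s', ENNReal.ofReal |h x| ≤ ENNReal.ofReal (2 ^ n * α * s' ^ n)) ∧
      ∀ᵐ x, (∀ i, x ∉ E i) → |h x| ≤ α := by
  obtain ⟨e⟩ : Nonempty (ℕ ≃ ℕ × (Fin n → ℤ)) := ⟨(nonempty_equiv_of_countable (α := ℕ) (β := ℕ × (Fin n → ℤ))).some⟩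
  let E : ℕ → Set (Rn n) := fun i => {x | fl p s (e i).1 x = (e i).2 ∧ stopAt h p s α (e i).1 x}
  refine ⟨E, ?_, ?_, ?_⟩
  · intro i j hij
    rw [Set.disjoint_left]
    rintro x ⟨h1, h2⟩ ⟨h3, h4⟩
    apply hij
    apply e.injective
    have : (e i).1 = (e j).1 := by
      rcases lt_trichotomy (e i).1 (e j).1 with hl | hl | hl
      · exact absurd h2.1 (h4.2 _ hl)
      · exact hl
      · exact absurd h4.1 (h2.2 _ hl)
    refine Prod.ext this ?_
    rw [← h1, ← h3, this]
  · intro i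
    rcases (E i).eq_empty_or_nonempty with hE | ⟨x, hx1, hx2⟩
    · exact Or.inl hE
    right
    have hED : E i = dc (crn p s (e i).1 (e i).2) (s / 2 ^ (e i).1) := by
      ext y
      rw [← fl_eq_iff p hs]
      refine ⟨fun hy => hy.1, fun hy => ⟨hy, stopAt_congr (hx1.trans hy.symm) hx2⟩⟩
    have hxE : x ∈ dc (crn p s (e i).1 (e i).2) (s / 2 ^ (e i).1) := hED ▸ ⟨hx1, hx2⟩
    refine ⟨crn p s (e i).1 (e i).2, s / 2 ^ (e i).1, by positivity, hED, ?_, ?_, ?_⟩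
    · have hb := hx2.1
      rw [hx1] at hb
      have : ∃ y ∈ dc (crn p s (e i).1 (e i).2) (s / 2 ^ (e i).1), y ∈ dc p s := by
        by_contra hcon
        push Not at hcon
        rw [bad, setLIntegral_congr_fun (g := fun _ => 0) (dc_meas _ _) (fun y hy => by simp [hsupp y (hcon y hy)])] at hb
        simp at hb
      obtain ⟨y, hy1, hy2⟩ := this
      intro z hz
      rw [← fl_eq_iff p hs] at hy1 hz
      rw [← fl_zero p hs] at hy2 ⊢
      rw [← hy2]
      exact fl_nest' p s (Nat.zero_le _) (hz.trans hy1.symm)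
    · have hb := hx2.1
      rw [hx1] at hb
      exact hb
    · rcases Nat.eq_zero_or_pos (e i).1 with hk | hk
      · refine (setLIntegral_le_lintegral _ _).trans (h0.trans ?_)
        apply ENNReal.ofReal_le_ofReal
        rw [hk]
        simp only [pow_zero, div_one]
        have : (1:ℝ) ≤ 2 ^ n := one_le_pow₀ (by norm_num)
        have : 0 < α * s ^ n := by positivity
        nlinarith
      · obtain ⟨m, hm⟩ := Nat.exists_eq_add_of_le' hk
        have hnb := hx2.2 m (by omega)
        rw [bad, not_lt] at hnb
        refine (lintegral_mono_set ?_).trans (hnb.trans (le_of_eq ?_))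
        · intro z hz
          rw [← fl_eq_iff p hs] at hz ⊢
          exact fl_nest' p s (by omega) (hz.trans hx1.symm)
        · congr 1
          rw [hm, pow_succ, show s / 2 ^ m = 2 * (s / (2 ^ m * 2)) by field_simp, mul_pow]
          ring
  · filter_upwards [cz_leb hh p hs hα] with x hx hE
    apply hx
    by_contra hcon
    push Not at hcon
    classical
    have hf := Nat.find_spec hcon
    apply hE (e.symm (Nat.find hcon, fl p s (Nat.find hcon) x))
    refine ⟨by simp, ?_⟩
    simp only [Equiv.apply_symm_apply]
    exact ⟨hf, fun l hl => Nat.find_min hcon hl⟩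

end PE1

section PE2
/-- Localized oscillation. -/
def hQ (f : Rn n → ℝ) (p : Rn n) (s : ℝ) : Rn n → ℝ := (dc p s).indicator (fun x => f x - avg f (dc p s))

theorem dc_bdd_int {f : Rn n → ℝ} (hf : LocallyIntegrable f volume) (p : Rn n) {s : ℝ} (hs : 0 < s) :
    IntegrableOn f (dc p s) :=
  (hf.integrableOn_isCompact (isCompact_closedBall p ((n+1) * s))).mono_set ((dc_sub_ball p hs).trans ball_subset_closedBall)

theorem dc_fin (p : Rn n) {s : ℝ} (hs : 0 < s) : volume (dc p s) ≠ ⊤ := by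
  rw [dc_vol p hs]; exact ENNReal.ofReal_ne_top

theorem dc_real (p : Rn n) {s : ℝ} (hs : 0 < s) : volume.real (dc p s) = s ^ n := by
  rw [Measure.real, dc_vol p hs, ENNReal.toReal_ofReal (by positivity)]

theorem hQ_int {f : Rn n → ℝ} (hf : LocallyIntegrable f volume) (p : Rn n) {s : ℝ} (hs : 0 < s) :
    Integrable (hQ f p s) := by
  unfold hQ
  rw [integrable_indicator_iff (dc_meas p s)]
  exact (dc_bdd_int hf p hs).sub (integrableOn_const (dc_fin p hs))

theorem hQ_zero {f : Rn n → ℝ} (hf : LocallyIntegrable f volume) (p : Rn n) {s : ℝ} (hs : 0 < s) :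
    ∫ x, hQ f p s x = 0 := by
  unfold hQ
  rw [integral_indicator (dc_meas p s), integral_sub (dc_bdd_int hf p hs) (integrableOn_const (dc_fin p hs)),
    setIntegral_const, avg, ← Measure.real, dc_real p hs, smul_eq_mul]
  field_simp
  ring

theorem hQ_lint (f : Rn n → ℝ) (p : Rn n) (s : ℝ) :
    ∫⁻ x, ENNReal.ofReal |hQ f p s x| = ∫⁻ x in dc p s, ENNReal.ofReal |f x - avg f (dc p s)| := by
  rw [← lintegral_indicator (dc_meas p s)]
  apply lintegral_congr; intro x
  unfold hQ
  by_cases hx : x ∈ dc p s <;> simp [hx]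

theorem B_int {b : ℕ → Rn n → ℝ} (hb : ∀ i, Integrable (b i)) (hs : ∀ x, Summable (fun i => b i x))
    (hfin : ∑' i, ∫⁻ x, ‖b i x‖ₑ ≠ ⊤) : Integrable (fun x => ∑' i, b i x) := by
  constructor
  · refine aestronglyMeasurable_of_tendsto_ae Filter.atTop (f := fun (N : ℕ) x => ∑ i ∈ Finset.range N, b i x) (fun N => ?_) ?_
    · exact Finset.aestronglyMeasurable_fun_sum _ fun i _ => (hb i).1
    · filter_upwards with x
      exact (hs x).hasSum.tendsto_sum_nat
  · unfold HasFiniteIntegral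
    refine lt_of_le_of_lt (lintegral_mono fun x => enorm_tsum_le_tsum_enorm) ?_
    rw [lintegral_tsum fun i => (hb i).1.enorm]
    exact hfin.lt_top

theorem Phi_decomp {C₁ C₂ δ γ : ℝ} (hC₁ : 0 < C₁) (hδ : 0 < δ) {ψ : Rn n → ℝ} (hψ : PsiKernel n C₁ C₂ δ γ ψ)
    {h : Rn n → ℝ} (hh : Integrable h) {b : ℕ → Rn n → ℝ} (hb : ∀ i, Integrable (b i)) (hs : ∀ x, Summable (fun i => b i x))
    (hfin : ∑' i, ∫⁻ x, ‖b i x‖ₑ ≠ ⊤) {t : ℝ} (ht : 0 < t) (y : Rn n) :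
    Phi ψ h (t, y) ≤ Phi ψ (fun x => h x - ∑' i, b i x) (t, y) + ∑' i, Phi ψ (b i) (t, y) := by
  have hB := B_int hb hs hfin
  have e1 : cvl ψ t h y = cvl ψ t (fun x => h x - ∑' i, b i x) y + ∑' i, cvl ψ t (b i) y := by
    unfold cvl
    rw [← integral_tsum (fun i => (psit_mul_int hC₁ hδ hψ ht y (hb i)).1), ← integral_add
      (psit_mul_int hC₁ hδ hψ ht y (h := fun x => h x - ∑' i, b i x) (hh.sub hB))]
    · apply integral_congr_ae
      filter_upwards with z
      rw [tsum_mul_left]; ring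
    · simp_rw [tsum_mul_left]
      exact psit_mul_int hC₁ hδ hψ ht y hB
    · have : ∀ i, ∫⁻ z, ‖(t ^ n)⁻¹ * ψ (t⁻¹ • (y - z)) * b i z‖ₑ ≤ ENNReal.ofReal (C₁ * (t ^ n)⁻¹) * ∫⁻ z, ‖b i z‖ₑ := by
        intro i
        rw [← lintegral_const_mul' _ _ ENNReal.ofReal_ne_top]
        apply lintegral_mono
        intro z
        dsimp only
        rw [enorm_mul]
        gcongr
        rw [← ofReal_norm]
        exact ENNReal.ofReal_le_ofReal (psit_le hC₁ hδ hψ ht (y - z))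
      refine ne_top_of_le_ne_top ?_ (ENNReal.tsum_le_tsum this)
      rw [ENNReal.tsum_mul_left]
      exact ENNReal.mul_ne_top ENNReal.ofReal_ne_top hfin
  unfold Phi
  simp only [e1, ← Real.norm_eq_abs, ofReal_norm]
  exact (enorm_add_le _ _).trans (by gcongr; exact enorm_tsum_le_tsum_enorm)

theorem sum_disj {E : ℕ → Set (Rn n)} (hd : Pairwise (fun i j => Disjoint (E i) (E j))) {b : ℕ → Rn n → ℝ}
    (hsupp : ∀ i x, x ∉ E i → b i x = 0) {i : ℕ} {x : Rn n} (hx : x ∈ E i) : HasSum (fun j => b j x) (b i x) :=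
  hasSum_single i fun j hj => hsupp j x fun hxj => (Set.disjoint_left.1 (hd hj) hxj) hx

theorem sum_disj' {E : ℕ → Set (Rn n)} (hd : Pairwise (fun i j => Disjoint (E i) (E j))) {b : ℕ → Rn n → ℝ}
    (hsupp : ∀ i x, x ∉ E i → b i x = 0) (x : Rn n) : Summable (fun j => b j x) := by
  by_cases h : ∃ i, x ∈ E i
  · obtain ⟨i, hi⟩ := h
    exact (sum_disj hd hsupp hi).summable
  · push Not at h
    simp_rw [fun i => hsupp i x (h i)]
    exact summable_zero

/-- Structural hypotheses on (f, μ). -/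
structure Adm (f : Rn n → ℝ) (μ : Measure (Rn n)) (K₂ K₃ : ℝ) : Prop where
  loc : LocallyIntegrable f volume
  k2 : 0 < K₂
  k3 : 1 ≤ K₃
  h1 : ∀ p s, 0 < s → ∫⁻ x in dc p s, ENNReal.ofReal |f x - avg f (dc p s)| ≤ ENNReal.ofReal K₂ * μ (dc p s)
  h2 : ∀ p s, 0 < s → ∀ E, E ⊆ dc p s → MeasurableSet E → μ (dc p s) * volume E ≤ ENNReal.ofReal K₃ * volume (dc p s) * μ E
  h3 : ∀ p s, 0 < s → 0 < μ (dc p s)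
  h4 : ∀ p s, 0 < s → μ (dc p s) < ⊤

end PE2

section PE3
theorem avg_diff {f : Rn n → ℝ} (hf : LocallyIntegrable f volume) {p p' : Rn n} {s s' H : ℝ} (hs : 0 < s) (hs' : 0 < s') 
    (hsub : dc p' s' ⊆ dc p s) (hH : 0 < H)
    (h : ∫⁻ x in dc p' s', ENNReal.ofReal |hQ f p s x| ≤ ENNReal.ofReal (H * s' ^ n)) :
    |avg f (dc p' s') - avg f (dc p s)| ≤ H := by
  have e : ∫ x in dc p' s', hQ f p s x = s' ^ n * (avg f (dc p' s') - avg f (dc p s)) := by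
    rw [setIntegral_congr_fun (g := fun x => f x - avg f (dc p s)) (dc_meas _ _) (fun x hx => by simp [hQ, hsub hx]),
      integral_sub (dc_bdd_int hf p' hs') (integrableOn_const (dc_fin p' hs')), setIntegral_const, dc_real p' hs', smul_eq_mul, mul_sub]
    congr 1
    rw [avg, ← Measure.real, dc_real p' hs', mul_inv_cancel_left₀ (by positivity)]
  have e2 : |∫ x in dc p' s', hQ f p s x| ≤ H * s' ^ n := by
    refine (abs_integral_le_integral_abs).trans ?_
    rw [integral_eq_lintegral_of_nonneg_ae (by filter_upwards with y using abs_nonneg _) (hQ_int hf p hs).abs.aestronglyMeasurable.restrict]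
    exact ENNReal.toReal_le_of_le_ofReal (by positivity) h
  rw [e, abs_mul, abs_of_pos (by positivity), mul_comm] at e2
  exact le_of_mul_le_mul_right e2 (by positivity)

theorem step (hn : 1 ≤ n) {C₁ C₂ δ γ : ℝ} (hC₁ : 0 < C₁) (hC₂ : 0 < C₂) (hδ : 0 < δ) (hγ : 0 < γ) {ψ : Rn n → ℝ} (hψ : PsiKernel n C₁ C₂ δ γ ψ) 
    {a : ℝ} (ha : 3 * (n:ℝ) + 2 * δ + 2 * γ < a) :
    ∃ D : ℝ, 0 < D ∧ ∀ (f : Rn n → ℝ) (μ : Measure (Rn n)) (K₂ K₃ : ℝ) (_ : Adm f μ K₂ K₃) (p : Rn n) (s : ℝ) (_ : 0 < s),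
      ∃ (b : ℕ → Rn n → ℝ) (E : ℕ → Set (Rn n)) (g : Rn n → ℝ), Pairwise (fun i j => Disjoint (E i) (E j)) ∧ (∀ i, MeasurableSet (E i)) ∧
        (∀ i, (E i = ∅ ∧ b i = 0) ∨ ∃ p' s', 0 < s' ∧ E i = dc p' s' ∧ b i = hQ f p' s') ∧
        μ (⋃ i, E i) ≤ ENNReal.ofReal (1 - 1 / (2 * K₃)) * μ (dc p s) ∧ Integrable g ∧
        ∫⁻ x, Gs a (Phi ψ g) x ≤ ENNReal.ofReal (D * K₂) * μ (dc p s) ∧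
        ∀ t > 0, ∀ y, Phi ψ (hQ f p s) (t, y) ≤ Phi ψ g (t, y) + ∑' i, Phi ψ (b i) (t, y) := by
  obtain ⟨C, hC, hat⟩ := atom_bd hn hC₁ hC₂ hδ hγ hψ ha
  refine ⟨C * (2 ^ n * 2 * (n + 1) ^ n), by positivity, ?_⟩
  intro f μ K₂ K₃ A p s hs
  have hk2 := A.k2
  have hk3 := A.k3
  have hf := A.loc
  obtain ⟨m, hm, hmμ⟩ : ∃ m : ℝ, 0 < m ∧ μ (dc p s) = ENNReal.ofReal m :=
    ⟨(μ (dc p s)).toReal, ENNReal.toReal_pos (A.h3 p s hs).ne' (A.h4 p s hs).ne, (ENNReal.ofReal_toReal (A.h4 p s hs).ne).symm⟩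
  obtain ⟨α, hαdef⟩ : ∃ α, α = 2 * K₂ * m / s ^ n := ⟨_, rfl⟩
  have hα : 0 < α := by rw [hαdef]; positivity
  have hαs : α * s ^ n = 2 * K₂ * m := by rw [hαdef]; field_simp
  have hIntg := hQ_int hf p hs
  have hl1 : ∫⁻ x, ENNReal.ofReal |hQ f p s x| ≤ ENNReal.ofReal (K₂ * m) := by
    rw [hQ_lint, ENNReal.ofReal_mul hk2.le, ← hmμ]
    exact A.h1 p s hs
  obtain ⟨E, hd, hE, hae⟩ := cz hIntg p hs hα (fun x hx => by simp [hQ, hx]) (hl1.trans (ENNReal.ofReal_le_ofReal (by rw [hαs]; nlinarith [mul_pos hk2 hm])))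
  have hEm : ∀ i, MeasurableSet (E i) := by
    intro i
    rcases hE i with h | ⟨p', s', _, h, _⟩
    · rw [h]; exact MeasurableSet.empty
    · rw [h]; exact dc_meas _ _
  have hEs : ∀ i, E i ⊆ dc p s := by
    intro i
    rcases hE i with h | ⟨p', s', _, h, h', _⟩
    · rw [h]; exact empty_subset _
    · rw [h]; exact h'
  have hU : (⋃ i, E i) ⊆ dc p s := iUnion_subset hEs
  have hUm : MeasurableSet (⋃ i, E i) := MeasurableSet.iUnion hEm
  -- volume of the union
  have hvol : ENNReal.ofReal α * volume (⋃ i, E i) ≤ ENNReal.ofReal (K₂ * m) := by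
    rw [measure_iUnion hd hEm, ← ENNReal.tsum_mul_left]
    calc _ ≤ ∑' i, ∫⁻ x in E i, ENNReal.ofReal |hQ f p s x| := by
          apply ENNReal.tsum_le_tsum
          intro i
          rcases hE i with h | ⟨p', s', hs', h, _, h', _⟩
          · rw [h]; simp
          · rw [h, dc_vol p' hs', ← ENNReal.ofReal_mul hα.le]; exact h'.le
      _ = ∫⁻ x in ⋃ i, E i, ENNReal.ofReal |hQ f p s x| := (lintegral_iUnion hEm hd _).symm
      _ ≤ _ := (setLIntegral_le_lintegral _ _).trans hl1
  have hvr : volume.real (⋃ i, E i) ≤ s ^ n / 2 := by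
    have hfin : volume (⋃ i, E i) ≠ ⊤ := ne_top_of_le_ne_top (dc_fin p hs) (measure_mono hU)
    rw [← ofReal_measureReal hfin, ← ENNReal.ofReal_mul hα.le, ENNReal.ofReal_le_ofReal_iff (by positivity)] at hvol
    have : α * volume.real (⋃ i, E i) ≤ α * (s ^ n / 2) := by linarith
    exact le_of_mul_le_mul_left this hα
  have hdiff : ENNReal.ofReal (s ^ n / 2) ≤ volume (dc p s \ ⋃ i, E i) := by
    have hfin : volume (⋃ i, E i) ≠ ⊤ := ne_top_of_le_ne_top (dc_fin p hs) (measure_mono hU)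
    rw [measure_diff hU hUm.nullMeasurableSet hfin, dc_vol p hs, ← ofReal_measureReal hfin, ← ENNReal.ofReal_sub _ measureReal_nonneg]
    exact ENNReal.ofReal_le_ofReal (by linarith)
  have hμU : μ (⋃ i, E i) ≤ ENNReal.ofReal (1 - 1 / (2 * K₃)) * μ (dc p s) := by
    have h2 := A.h2 p s hs (dc p s \ ⋃ i, E i) diff_subset ((dc_meas p s).diff hUm)
    have hsum : μ (dc p s \ ⋃ i, E i) + μ (⋃ i, E i) = μ (dc p s) := by
      rw [add_comm, measure_add_diff hUm.nullMeasurableSet, union_eq_self_of_subset_left hU]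
    have hf1 : μ (dc p s \ ⋃ i, E i) ≠ ⊤ := ne_top_of_le_ne_top (A.h4 p s hs).ne (measure_mono diff_subset)
    have hf2 : μ (⋃ i, E i) ≠ ⊤ := ne_top_of_le_ne_top (A.h4 p s hs).ne (measure_mono hU)
    have h2' := (mul_le_mul_right hdiff (μ (dc p s))).trans h2
    rw [dc_vol p hs] at h2'
    rw [hmμ] at h2' hsum ⊢
    generalize μ (dc p s \ ⋃ i, E i) = u at *
    generalize μ (⋃ i, E i) = v at *
    lift u to NNReal using hf1
    lift v to NNReal using hf2
    have hu0 := u.coe_nonneg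
    have hv0 := v.coe_nonneg
    rw [← ENNReal.ofReal_coe_nnreal (p := u)] at h2' hsum
    rw [← ENNReal.ofReal_coe_nnreal (p := v)] at hsum ⊢
    have hk30 : 0 < K₃ := by linarith
    rw [← ENNReal.ofReal_add u.coe_nonneg v.coe_nonneg, ENNReal.ofReal_eq_ofReal_iff (by positivity) hm.le] at hsum
    rw [← ENNReal.ofReal_mul hm.le, ← ENNReal.ofReal_mul hk30.le, ← ENNReal.ofReal_mul (by positivity), ENNReal.ofReal_le_ofReal_iff (by positivity)] at h2'
    have hth : 0 ≤ 1 - 1 / (2 * K₃) := by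
      rw [sub_nonneg, div_le_one (by positivity)]; linarith
    rw [← ENNReal.ofReal_mul hth]
    apply ENNReal.ofReal_le_ofReal
    have h3 : m / 2 ≤ K₃ * u := by
      have : s ^ n * (m / 2) ≤ s ^ n * (K₃ * u) := by linarith
      exact le_of_mul_le_mul_left this (by positivity)
    have h4 : m / (2 * K₃) ≤ u := by
      rw [div_le_iff₀ (by positivity)]; linarith
    have : (1 - 1 / (2 * K₃)) * m = m - m / (2 * K₃) := by ring
    rw [this]; linarith
  -- the pieces
  let b : ℕ → Rn n → ℝ := fun i => (E i).indicator (fun x => f x - avg f (E i))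
  have hb : ∀ i, (E i = ∅ ∧ b i = 0) ∨ ∃ p' s', 0 < s' ∧ E i = dc p' s' ∧ b i = hQ f p' s' := by
    intro i
    rcases hE i with h | ⟨p', s', hs', h, _⟩
    · left; refine ⟨h, ?_⟩; simp only [b, h]; simp; rfl
    · right; refine ⟨p', s', hs', h, ?_⟩; simp only [b, h, hQ]
  have hbi : ∀ i, Integrable (b i) := by
    intro i
    rcases hb i with ⟨_, h⟩ | ⟨p', s', hs', _, h⟩
    · rw [h]; exact integrable_zero _ _ _
    · rw [h]; exact hQ_int hf p' hs'
  have hbz : ∀ i, ∫ x, b i x = 0 := by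
    intro i
    rcases hb i with ⟨_, h⟩ | ⟨p', s', hs', _, h⟩
    · rw [h]; simp
    · rw [h]; exact hQ_zero hf p' hs'
  have hbl : ∀ i, ∫⁻ x, ‖b i x‖ₑ ≤ ENNReal.ofReal K₂ * μ (E i) := by
    intro i
    rcases hb i with ⟨_, h⟩ | ⟨p', s', hs', h', h⟩
    · rw [h]; simp
    · rw [h, h']; simp_rw [← ofReal_norm, Real.norm_eq_abs]; rw [hQ_lint]; exact A.h1 p' s' hs'
  have hbfin : ∑' i, ∫⁻ x, ‖b i x‖ₑ ≠ ⊤ := by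
    refine ne_top_of_le_ne_top ?_ (ENNReal.tsum_le_tsum hbl)
    rw [ENNReal.tsum_mul_left, ← measure_iUnion hd hEm]
    exact ENNReal.mul_ne_top ENNReal.ofReal_ne_top (ne_top_of_le_ne_top (A.h4 p s hs).ne (measure_mono hU))
  have hbsupp : ∀ i x, x ∉ E i → b i x = 0 := fun i x hx => by simp [b, hx]
  have hbs := sum_disj' hd hbsupp
  have hBint := B_int hbi hbs hbfin
  let g₀ : Rn n → ℝ := fun x => hQ f p s x - ∑' i, b i x
  have hg₀ : Integrable g₀ := hIntg.sub hBint
  have hg₀z : ∫ x, g₀ x = 0 := by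
    simp only [g₀]
    rw [integral_sub hIntg hBint, hQ_zero hf p hs, integral_tsum (fun i => (hbi i).1) hbfin]
    simp [hbz]
  have hg₀supp : ∀ x, x ∉ dc p s → g₀ x = 0 := by
    intro x hx
    have : ∀ i, b i x = 0 := fun i => hbsupp i x fun h => hx (hEs i h)
    simp [g₀, this, hQ, hx]
  have hg₀b : ∀ᵐ x, |g₀ x| ≤ 2 ^ n * α := by
    filter_upwards [hae] with x hx
    by_cases h : ∃ i, x ∈ E i
    · obtain ⟨i, hi⟩ := h
      simp only [g₀]
      rw [(sum_disj hd hbsupp hi).tsum_eq]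
      rcases hE i with h | ⟨p', s', hs', h, hsub, _, h'⟩
      · rw [h] at hi; exact absurd hi (notMem_empty _)
      · have : hQ f p s x - b i x = avg f (dc p' s') - avg f (dc p s) := by
          rw [h] at hi
          simp [b, h, hQ, hi, hsub hi]
        rw [this]
        exact avg_diff hf hs hs' hsub (by positivity) h'
    · push Not at h
      have : ∀ i, b i x = 0 := fun i => hbsupp i x (h i)
      simp only [g₀, this, tsum_zero, sub_zero]
      refine (hx h).trans ?_
      have : (1:ℝ) ≤ 2 ^ n := one_le_pow₀ (by norm_num)
      nlinarith
  let g : Rn n → ℝ := fun x => if |g₀ x| ≤ 2 ^ n * α then g₀ x else 0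
  have hgg : g =ᵐ[volume] g₀ := by
    filter_upwards [hg₀b] with x hx
    simp [g, hx]
  have hgi : Integrable g := hg₀.congr hgg.symm
  refine ⟨b, E, g, hd, hEm, hb, hμU, hgi, ?_, ?_⟩
  · refine (hat g hgi (2 ^ n * α) ((n + 1) * s) (by positivity) (by positivity) p ?_ ?_ ?_).trans ?_
    · intro x
      simp only [g]
      split_ifs with h
      · exact h
      · rw [abs_zero]; positivity
    · intro x hx
      have := hg₀supp x fun h => hx (dc_sub_ball p hs h)
      simp [g, this]
    · rw [integral_congr_ae hgg, hg₀z]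
    · rw [hmμ, ← ENNReal.ofReal_mul (by positivity)]
      apply ENNReal.ofReal_le_ofReal
      rw [mul_pow]
      apply le_of_eq
      linear_combination C * 2 ^ n * (n + 1) ^ n * hαs
  · intro t ht y
    have := Phi_decomp hC₁ hδ hψ hIntg hbi hbs hbfin ht y
    have e : Phi ψ g (t, y) = Phi ψ g₀ (t, y) := by
      unfold Phi cvl
      congr 2
      apply integral_congr_ae
      filter_upwards [hgg] with z hz
      simp only [hz]
    rw [e]
    exact this

end PE3

section PE4
/-- strip in the half space. -/
def strip (n : ℕ) (T : ℕ) : Set (ℝ × Rn n) := {p | 1 / ((T:ℝ) + 1) < p.1 ∧ p.1 < T + 1}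

theorem strip_meas (T : ℕ) : MeasurableSet (strip n T) :=
  (measurableSet_lt measurable_const measurable_fst).inter (measurableSet_lt measurable_fst measurable_const)

theorem strip_mono : Monotone (strip n) := by
  intro T T' h p hp
  have : (T:ℝ) ≤ T' := by exact_mod_cast h
  refine ⟨lt_of_le_of_lt ?_ hp.1, hp.2.trans_le (by linarith)⟩
  gcongr

/-- truncated functional. -/
def NT (a : ℝ) (ψ : Rn n → ℝ) (T : ℕ) (h : Rn n → ℝ) : ℝ≥0∞ :=
  ∫⁻ x in ball (0 : Rn n) (T + 1), Gs a ((strip n T).indicator (Phi ψ h)) x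

theorem strip_wt (T : ℕ) {a : ℝ} (ha : 3 * (n:ℝ) < a) (hn : 1 ≤ n) : ∃ V : ℝ≥0∞, V ≠ ⊤ ∧ ∀ x : Rn n,
    ∫⁻ p, (strip n T).indicator (wt a x) p ∂(PM n) ≤ V := by
  obtain ⟨C, hC, hC'⟩ := lint_pow n a (by have : (0:ℝ) ≤ n := by positivity
                                          linarith)
  have hn1 : (1:ℝ) ≤ n := by exact_mod_cast hn
  have hT : (0:ℝ) < (T:ℝ) + 1 := by positivity
  refine ⟨ENNReal.ofReal (((T:ℝ) + 1) ^ (a - n - 1)) * ENNReal.ofReal (C * (1 / ((T:ℝ) + 1)) ^ ((n:ℝ) - a)) * volume (Iio ((T:ℝ) + 1) ∩ Ioi 0), ?_, ?_⟩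
  · refine ENNReal.mul_ne_top (ENNReal.mul_ne_top ENNReal.ofReal_ne_top ENNReal.ofReal_ne_top) ?_
    rw [Iio_inter_Ioi]
    simp
  intro x
  rw [PM_lint ((wt_meas' a x).indicator (strip_meas T)).aemeasurable]
  calc _ ≤ ∫⁻ t in Ioi (0:ℝ), (Iio ((T:ℝ) + 1)).indicator (fun _ => ENNReal.ofReal (((T:ℝ) + 1) ^ (a - n - 1)) * ENNReal.ofReal (C * (1 / ((T:ℝ) + 1)) ^ ((n:ℝ) - a))) t := by
        apply setLIntegral_mono' measurableSet_Ioi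
        intro t ht
        by_cases h : 1 / ((T:ℝ) + 1) < t ∧ t < (T:ℝ) + 1
        · rw [indicator_of_mem (show t ∈ Iio ((T:ℝ)+1) from h.2)]
          have hmem : ∀ y : Rn n, (t, y) ∈ strip n T := fun y => h
          simp_rw [indicator_of_mem (hmem _)]
          refine le_trans ?_ (mul_le_mul_right (hC' (1 / ((T:ℝ) + 1)) (by positivity) x) _)
          rw [← lintegral_const_mul' _ _ ENNReal.ofReal_ne_top]
          apply lintegral_mono
          intro y
          dsimp only
          rw [wt_eq a x ht y, ← ENNReal.ofReal_mul (by positivity)]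
          apply ENNReal.ofReal_le_ofReal
          have ht0 : 0 < t := ht
          gcongr ?_ * ?_
          · exact Real.rpow_le_rpow ht0.le h.2.le (by linarith)
          · apply Real.rpow_le_rpow_of_nonpos (by positivity) _ (by linarith)
            rw [dist_comm]; linarith [h.1]
        · have hmem : ∀ y : Rn n, (t, y) ∉ strip n T := fun y => h
          simp_rw [indicator_of_notMem (hmem _)]
          simp
    _ = _ := by
        rw [lintegral_indicator measurableSet_Iio, setLIntegral_const, Measure.restrict_apply measurableSet_Iio]

theorem NT_fin {C₁ C₂ δ γ : ℝ} (hC₁ : 0 < C₁) (hδ : 0 < δ) {ψ : Rn n → ℝ} (hψ : PsiKernel n C₁ C₂ δ γ ψ) 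
    (T : ℕ) {a : ℝ} (ha : 3 * (n:ℝ) < a) (hn : 1 ≤ n) : ∃ L : ℝ≥0∞, L ≠ ⊤ ∧ ∀ h : Rn n → ℝ,
    NT a ψ T h ≤ L * ∫⁻ x, ENNReal.ofReal |h x| := by
  obtain ⟨V, hV, hV'⟩ := strip_wt (n := n) T ha hn
  refine ⟨(V + 1) * ENNReal.ofReal (C₁ * ((T:ℝ) + 1) ^ n) * volume (ball (0 : Rn n) (T + 1)), ?_, ?_⟩
  · refine ENNReal.mul_ne_top (ENNReal.mul_ne_top (by simp [hV]) ENNReal.ofReal_ne_top) measure_ball_lt_top.ne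
  intro h
  have key : ∀ x, Gs a ((strip n T).indicator (Phi ψ h)) x ≤ (V + 1) * ENNReal.ofReal (C₁ * ((T:ℝ) + 1) ^ n) * ∫⁻ x, ENNReal.ofReal |h x| := by
    intro x
    apply Gs_le_of_sq
    calc _ ≤ ∫⁻ p, (strip n T).indicator (wt a x) p * (ENNReal.ofReal (C₁ * ((T:ℝ) + 1) ^ n) * ∫⁻ x, ENNReal.ofReal |h x|) ^ 2 ∂(PM n) := by
          apply lintegral_mono
          intro p
          by_cases hp : p ∈ strip n T
          · simp only [indicator_of_mem hp]
            gcongr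
            have hp0 : 0 < p.1 := lt_trans (by positivity) hp.1
            refine (cvl_crude hC₁ hδ hψ hp0 h p.2).trans ?_
            gcongr
            rw [← inv_pow]
            gcongr
            rw [inv_le_comm₀ hp0 (by positivity), ← one_div]
            exact hp.1.le
          · simp [indicator_of_notMem hp]
      _ = (∫⁻ p, (strip n T).indicator (wt a x) p ∂(PM n)) * (ENNReal.ofReal (C₁ * ((T:ℝ) + 1) ^ n) * ∫⁻ x, ENNReal.ofReal |h x|) ^ 2 := 
          lintegral_mul_const _ ((wt_meas' a x).indicator (strip_meas T))
      _ ≤ (V + 1) ^ 2 * (ENNReal.ofReal (C₁ * ((T:ℝ) + 1) ^ n) * ∫⁻ x, ENNReal.ofReal |h x|) ^ 2 := by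
          gcongr
          refine (hV' x).trans ?_
          calc V ≤ (V + 1) * 1 := by simp
            _ ≤ (V + 1) * (V + 1) := by gcongr; simp
            _ = _ := by ring
      _ = _ := by rw [← mul_pow, mul_assoc]
  calc _ ≤ ∫⁻ x in ball (0 : Rn n) (T + 1), (V + 1) * ENNReal.ofReal (C₁ * ((T:ℝ) + 1) ^ n) * ∫⁻ x, ENNReal.ofReal |h x| := lintegral_mono key
    _ = _ := by rw [setLIntegral_const]; ring

theorem NT_le {a : ℝ} {ψ : Rn n → ℝ} (T : ℕ) (h : Rn n → ℝ) : NT a ψ T h ≤ ∫⁻ x, Gs a (Phi ψ h) x := by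
  refine (setLIntegral_le_lintegral _ _).trans (lintegral_mono fun x => Gs_mono (fun p _ => ?_) x)
  exact indicator_le_self _ _ _

theorem NT_sub {a : ℝ} {ψ : Rn n → ℝ} (hψ : AEStronglyMeasurable ψ volume) (T : ℕ) {h g : Rn n → ℝ} {b : ℕ → Rn n → ℝ}
    (hg : AEStronglyMeasurable g volume) (hb : ∀ i, AEStronglyMeasurable (b i) volume)
    (hle : ∀ t > 0, ∀ y, Phi ψ h (t, y) ≤ Phi ψ g (t, y) + ∑' i, Phi ψ (b i) (t, y)) :
    NT a ψ T h ≤ NT a ψ T g + ∑' i, NT a ψ T (b i) := by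
  have mg := (Phi_aemeas hψ hg).indicator (strip_meas T)
  have mb := fun i => (Phi_aemeas hψ (hb i)).indicator (strip_meas T)
  unfold NT
  rw [← lintegral_tsum (fun i => (Gs_meas a (mb i)).aemeasurable), ← lintegral_add_left (Gs_meas a mg)]
  apply lintegral_mono
  intro x
  calc _ ≤ Gs a ((strip n T).indicator (Phi ψ g) + fun p => ∑' i, (strip n T).indicator (Phi ψ (b i)) p) x := by
        apply Gs_mono
        intro p hp
        by_cases hpT : p ∈ strip n T
        · simp only [Pi.add_apply, indicator_of_mem hpT]
          exact hle p.1 hp p.2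
        · simp [indicator_of_notMem hpT]
    _ ≤ _ := (Gs_add a mg (AEMeasurable.ennreal_tsum mb) x).trans (add_le_add le_rfl (Gs_tsum a mb x))

theorem NT_sup {a : ℝ} {ψ : Rn n → ℝ} (hψ : AEStronglyMeasurable ψ volume) {h : Rn n → ℝ} (hh : AEStronglyMeasurable h volume) {M : ℝ≥0∞}
    (hM : ∀ T, NT a ψ T h ≤ M) : ∫⁻ x, Gs a (Phi ψ h) x ≤ M := by
  have mh := fun T => (Phi_aemeas hψ hh).indicator (strip_meas (n := n) T)
  have hmono : Monotone (fun T => (strip n T).indicator (Phi ψ h)) := fun T T' hT =>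
    indicator_le_indicator_of_subset (strip_mono hT) (fun _ => zero_le)
  have e1 : ∀ x, Gs a (Phi ψ h) x = ⨆ T : ℕ, (ball (0 : Rn n) (T + 1)).indicator (Gs a ((strip n T).indicator (Phi ψ h))) x := by
    intro x
    have e2 : Gs a (Phi ψ h) x = Gs a (fun p => ⨆ T, (strip n T).indicator (Phi ψ h) p) x := by
      apply Gs_congr
      filter_upwards [PM_pos] with p hp
      apply le_antisymm
      · obtain ⟨N, hN⟩ := exists_nat_gt (max p.1 (1 / p.1))
        have hN1 := (le_max_left _ _).trans_lt hN
        have hN2 := (le_max_right _ _).trans_lt hN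
        have hN0 : (0:ℝ) < N := hp.trans hN1
        refine le_iSup_of_le N ?_
        rw [indicator_of_mem]
        refine ⟨?_, by linarith⟩
        rw [one_div_lt (by positivity) hp]; linarith
      · exact iSup_le fun T => indicator_le_self _ _ _
    rw [e2, Gs_iSup a mh hmono]
    apply le_antisymm
    · refine iSup_le fun T => ?_
      obtain ⟨N, hN⟩ := exists_nat_gt (dist x 0)
      refine le_iSup_of_le (max T N) ?_
      rw [indicator_of_mem]
      · exact Gs_mono (fun p _ => hmono (le_max_left _ _) p) x
      · rw [mem_ball]
        refine hN.trans ?_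
        have : (N:ℝ) ≤ ((max T N : ℕ) : ℝ) := by exact_mod_cast le_max_right T N
        linarith
    · exact iSup_mono fun T => indicator_le_self _ _ _
  simp_rw [e1]
  rw [lintegral_iSup]
  · refine iSup_le fun T => ?_
    rw [lintegral_indicator measurableSet_ball]
    exact hM T
  · exact fun T => (Gs_meas a (mh T)).indicator measurableSet_ball
  · intro T T' hT x
    have hc : (T:ℝ) ≤ T' := by exact_mod_cast hT
    refine (indicator_le_indicator_of_subset (ball_subset_ball (show (T:ℝ) + 1 ≤ T' + 1 by linarith)) (fun _ => zero_le) x).trans ?_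
    apply indicator_le_indicator
    exact Gs_mono (fun p _ => hmono hT p) x

theorem iter (hn : 1 ≤ n) {C₁ C₂ δ γ : ℝ} (hC₁ : 0 < C₁) (hC₂ : 0 < C₂) (hδ : 0 < δ) (hγ : 0 < γ) {ψ : Rn n → ℝ} (hψ : PsiKernel n C₁ C₂ δ γ ψ) 
    {a : ℝ} (ha : 3 * (n:ℝ) + 2 * δ + 2 * γ < a) :
    ∃ D : ℝ, 0 < D ∧ ∀ (f : Rn n → ℝ) (μ : Measure (Rn n)) (K₂ K₃ : ℝ) (_ : Adm f μ K₂ K₃) (p : Rn n) (s : ℝ) (_ : 0 < s),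
      ∫⁻ x, Gs a (Phi ψ (hQ f p s)) x ≤ ENNReal.ofReal (D * K₂ * K₃) * μ (dc p s) := by
  obtain ⟨D, hD, hst⟩ := step hn hC₁ hC₂ hδ hγ hψ ha
  refine ⟨2 * D, by positivity, ?_⟩
  intro f μ K₂ K₃ A p s hs
  apply NT_sup hψ.1.1 (hQ_int A.loc p hs).1
  intro T
  have hk2 := A.k2
  have hk3 := A.k3
  obtain ⟨L, hL, hL'⟩ := NT_fin hC₁ hδ hψ T (a := a) (by linarith) hn
  -- the supremum
  obtain ⟨Z, hZdef⟩ : ∃ Z : ℝ≥0∞, Z = ⨆ q : {q : Rn n × ℝ // 0 < q.2}, NT a ψ T (hQ f q.1.1 q.1.2) / μ (dc q.1.1 q.1.2) := ⟨_, rfl⟩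
  have hZ1 : ∀ p s, 0 < s → NT a ψ T (hQ f p s) ≤ Z * μ (dc p s) := by
    intro p s hs
    rw [← ENNReal.div_le_iff (A.h3 p s hs).ne' (A.h4 p s hs).ne, hZdef]
    exact le_iSup (fun q : {q : Rn n × ℝ // 0 < q.2} => NT a ψ T (hQ f q.1.1 q.1.2) / μ (dc q.1.1 q.1.2)) ⟨(p, s), hs⟩
  have hZfin : Z ≠ ⊤ := by
    refine ne_top_of_le_ne_top (ENNReal.mul_ne_top hL (ENNReal.ofReal_ne_top (r := K₂))) ?_
    rw [hZdef]
    refine iSup_le fun ⟨⟨p, s⟩, hs⟩ => ?_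
    rw [ENNReal.div_le_iff (A.h3 p s hs).ne' (A.h4 p s hs).ne]
    refine (hL' _).trans ?_
    rw [hQ_lint, mul_assoc]
    gcongr
    exact A.h1 p s hs
  have hth : 0 ≤ 1 - 1 / (2 * K₃) := by
    rw [sub_nonneg, div_le_one (by positivity)]; linarith
  have hZ2 : Z ≤ ENNReal.ofReal (D * K₂) + Z * ENNReal.ofReal (1 - 1 / (2 * K₃)) := by
    conv_lhs => rw [hZdef]
    refine iSup_le fun ⟨⟨p, s⟩, hs⟩ => ?_
    rw [ENNReal.div_le_iff (A.h3 p s hs).ne' (A.h4 p s hs).ne]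
    obtain ⟨b, E, g, hd, hEm, hb, hμU, hgi, hgb, hle⟩ := hst f μ K₂ K₃ A p s hs
    have hbm : ∀ i, AEStronglyMeasurable (b i) volume := by
      intro i
      rcases hb i with ⟨_, h⟩ | ⟨p', s', hs', _, h⟩
      · rw [h]; exact aestronglyMeasurable_zero
      · rw [h]; exact (hQ_int A.loc p' hs').1
    refine (NT_sub hψ.1.1 T hgi.1 hbm hle).trans ?_
    rw [add_mul]
    refine add_le_add ((NT_le T g).trans hgb) ?_
    calc _ ≤ ∑' i, Z * μ (E i) := by
          apply ENNReal.tsum_le_tsum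
          intro i
          rcases hb i with ⟨_, h⟩ | ⟨p', s', hs', h', h⟩
          · rw [h]
            refine (hL' _).trans ?_
            simp
          · rw [h, h']; exact hZ1 p' s' hs'
      _ = Z * μ (⋃ i, E i) := by rw [ENNReal.tsum_mul_left, measure_iUnion hd hEm]
      _ ≤ _ := by rw [mul_assoc]; gcongr
  refine (hZ1 p s hs).trans ?_
  gcongr
  lift Z to NNReal using hZfin
  have hz0 := Z.coe_nonneg
  rw [← ENNReal.ofReal_coe_nnreal (p := Z)] at hZ2 ⊢
  rw [← ENNReal.ofReal_mul hz0, ← ENNReal.ofReal_add (by positivity) (by positivity), ENNReal.ofReal_le_ofReal_iff (by positivity)] at hZ2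
  apply ENNReal.ofReal_le_ofReal
  have h1 : (Z:ℝ) / (2 * K₃) ≤ D * K₂ := by
    have : (Z:ℝ) * (1 - 1 / (2 * K₃)) = Z - Z / (2 * K₃) := by ring
    linarith
  rw [div_le_iff₀ (by positivity)] at h1
  linarith

end PE4

section PF1
/-- Structural hypotheses on (f, μ), balls. -/
structure BAdm (f : Rn n → ℝ) (μ : Measure (Rn n)) (K : ℝ) : Prop where
  loc : LocallyIntegrable f volume
  k1 : 1 ≤ K
  b1 : ∀ c r, 0 < r → ∫⁻ x in ball c r, ENNReal.ofReal |f x - avg f (ball c r)| ≤ μ (ball c r)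
  b2 : ∀ c r, 0 < r → ∀ E, E ⊆ ball c r → MeasurableSet E → μ (ball c r) * volume E ≤ ENNReal.ofReal K * volume (ball c r) * μ E
  b3 : ∀ c r, 0 < r → 0 < μ (ball c r)
  b4 : ∀ c r, 0 < r → μ (ball c r) < ⊤

variable {f : Rn n → ℝ} {μ : Measure (Rn n)} {K : ℝ}

theorem ball_int (hf : LocallyIntegrable f volume) (c : Rn n) (r : ℝ) : IntegrableOn f (ball c r) :=
  (hf.integrableOn_isCompact (isCompact_closedBall c r)).mono_set ball_subset_closedBall

theorem ball_int' (hf : LocallyIntegrable f volume) (c : Rn n) (r k : ℝ) : IntegrableOn (fun x => |f x - k|) (ball c r) :=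
  ((ball_int hf c r).sub (integrableOn_const measure_ball_lt_top.ne)).abs

theorem BAdm.b1r (A : BAdm f μ K) (c : Rn n) {r : ℝ} (hr : 0 < r) :
    ∫ x in ball c r, |f x - avg f (ball c r)| ≤ μ.real (ball c r) := by
  rw [integral_eq_lintegral_of_nonneg_ae (by filter_upwards with y using abs_nonneg _) (ball_int' A.loc c r _).1]
  exact ENNReal.toReal_mono (A.b4 c r hr).ne (A.b1 c r hr)

theorem vol_ball_real (c : Rn n) {r : ℝ} (hr : 0 < r) : volume.real (ball c r) = VB n * r ^ n := by
  have := VB_pos (n := n)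
  rw [Measure.real, vol_ball c hr, ENNReal.toReal_ofReal (by positivity)]

theorem avg_mul (hf : LocallyIntegrable f volume) {E : Set (Rn n)} {c : Rn n} {R : ℝ} (hE : E ⊆ ball c R)
    (hv : 0 < volume.real E) (k : ℝ) : volume.real E * (avg f E - k) = ∫ x in E, (f x - k) := by
  have hfin : volume E ≠ ⊤ := ne_top_of_le_ne_top measure_ball_lt_top.ne (measure_mono hE)
  rw [integral_sub ((ball_int hf c R).mono_set hE) (integrableOn_const hfin), setIntegral_const, smul_eq_mul, mul_sub]
  congr 1
  rw [avg, ← Measure.real, mul_inv_cancel_left₀ hv.ne']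

theorem avg_sub_le (hf : LocallyIntegrable f volume) {E : Set (Rn n)} {c : Rn n} {R : ℝ} (hE : E ⊆ ball c R)
    (hv : 0 < volume.real E) (k : ℝ) : volume.real E * |avg f E - k| ≤ ∫ x in ball c R, |f x - k| := by
  rw [← abs_of_pos hv, ← abs_mul, avg_mul hf hE hv k]
  refine abs_integral_le_integral_abs.trans ?_
  exact setIntegral_mono_set (ball_int' hf c R k) (by filter_upwards with y using abs_nonneg _) hE.eventuallyLE

theorem BAdm.avg_ball_diff (A : BAdm f μ K) {E : Set (Rn n)} {c : Rn n} {R : ℝ} (hR : 0 < R) (hE : E ⊆ ball c R)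
    (hv : 0 < volume.real E) : volume.real E * |avg f E - avg f (ball c R)| ≤ μ.real (ball c R) :=
  (avg_sub_le A.loc hE hv _).trans (A.b1r c hR)

theorem BAdm.dbl (A : BAdm f μ K) {c c' : Rn n} {r R : ℝ} (hr : 0 < r) (hR : 0 < R) (h : ball c r ⊆ ball c' R) :
    μ.real (ball c' R) * r ^ n ≤ K * R ^ n * μ.real (ball c r) := by
  have hk : 0 < K := zero_lt_one.trans_le A.k1
  have h2 := A.b2 c' R hR _ h measurableSet_ball
  have h3 := ENNReal.toReal_mono (ENNReal.mul_ne_top (ENNReal.mul_ne_top ENNReal.ofReal_ne_top measure_ball_lt_top.ne) (A.b4 c r hr).ne) h2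
  rw [ENNReal.toReal_mul, ENNReal.toReal_mul, ENNReal.toReal_mul, ENNReal.toReal_ofReal hk.le, ← Measure.real, ← Measure.real,
    ← Measure.real, ← Measure.real, vol_ball_real c hr, vol_ball_real c' hR] at h3
  have := VB_pos (n := n)
  have h4 : VB n * (μ.real (ball c' R) * r ^ n) ≤ VB n * (K * R ^ n * μ.real (ball c r)) := by linarith
  exact le_of_mul_le_mul_left h4 this

theorem BAdm.Wpos (A : BAdm f μ K) (c : Rn n) {r : ℝ} (hr : 0 < r) : 0 < μ.real (ball c r) :=
  ENNReal.toReal_pos (A.b3 c r hr).ne' (A.b4 c r hr).ne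

theorem BAdm.adm (A : BAdm f μ K) : Adm f μ (2 * (K * (VB n * (n + 1) ^ n))) (1 + K * (VB n * (n + 1) ^ n)) := by
  have hk : 0 < K := zero_lt_one.trans_le A.k1
  have hV := VB_pos (n := n)
  have hvol : ∀ (p : Rn n) s, 0 < s → volume (ball p ((n+1) * s)) = ENNReal.ofReal (VB n * (n + 1) ^ n) * volume (dc p s) := by
    intro p s hs
    rw [vol_ball p (by positivity), dc_vol p hs, ← ENNReal.ofReal_mul (by positivity)]
    congr 1; rw [mul_pow]; ring
  have hcmp : ∀ p s, 0 < s → μ (ball p ((n+1) * s)) ≤ ENNReal.ofReal (K * (VB n * (n + 1) ^ n)) * μ (dc p s) := by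
    intro p s hs
    have h2 := A.b2 p ((n+1)*s) (by positivity) _ (dc_sub_ball p hs) (dc_meas p s)
    rw [hvol p s hs] at h2
    have hv0 : volume (dc p s) ≠ 0 := by rw [dc_vol p hs]; simp; positivity
    rw [← ENNReal.mul_le_mul_iff_left hv0 (dc_fin p hs)]
    refine h2.trans (le_of_eq ?_)
    rw [ENNReal.ofReal_mul hk.le]; ring
  refine ⟨A.loc, by positivity, by have : 0 < K * (VB n * (n + 1) ^ n) := by positivity
                                   linarith, ?_, ?_, ?_, ?_⟩
  · intro p s hs
    have hR : 0 < (n + 1) * s := by positivity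
    have hlt : ENNReal.ofReal (s ^ n) * ENNReal.ofReal |avg f (dc p s) - avg f (ball p ((n+1)*s))| ≤ μ (ball p ((n+1)*s)) := by
      have := A.avg_ball_diff hR (dc_sub_ball p hs) (by rw [dc_real p hs]; positivity)
      rw [dc_real p hs] at this
      rw [← ENNReal.ofReal_mul (by positivity), ← ofReal_measureReal (A.b4 p _ hR).ne]
      exact ENNReal.ofReal_le_ofReal this
    calc _ ≤ ∫⁻ x in dc p s, (ENNReal.ofReal |f x - avg f (ball p ((n+1)*s))| + ENNReal.ofReal |avg f (dc p s) - avg f (ball p ((n+1)*s))|) := by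
          apply lintegral_mono
          intro x
          dsimp only
          rw [← ENNReal.ofReal_add (by positivity) (by positivity)]
          apply ENNReal.ofReal_le_ofReal
          have := abs_sub (f x - avg f (ball p ((n+1)*s))) (avg f (dc p s) - avg f (ball p ((n+1)*s)))
          simpa using this
      _ = (∫⁻ x in dc p s, ENNReal.ofReal |f x - avg f (ball p ((n+1)*s))|) + ENNReal.ofReal (s ^ n) * ENNReal.ofReal |avg f (dc p s) - avg f (ball p ((n+1)*s))| := by
          rw [lintegral_add_right _ measurable_const, setLIntegral_const, dc_vol p hs, mul_comm (ENNReal.ofReal |avg f (dc p s) - _|)]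
      _ ≤ μ (ball p ((n+1)*s)) + μ (ball p ((n+1)*s)) := 
          add_le_add ((lintegral_mono_set (dc_sub_ball p hs)).trans (A.b1 p _ hR)) hlt
      _ ≤ ENNReal.ofReal (K * (VB n * (n + 1) ^ n)) * μ (dc p s) + ENNReal.ofReal (K * (VB n * (n + 1) ^ n)) * μ (dc p s) := add_le_add (hcmp p s hs) (hcmp p s hs)
      _ = _ := by rw [ENNReal.ofReal_mul (by norm_num : (0:ℝ) ≤ 2)]; simp; ring
  · intro p s hs E hE hEm
    calc _ ≤ μ (ball p ((n+1)*s)) * volume E := by gcongr; exact dc_sub_ball p hs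
      _ ≤ _ := A.b2 p ((n+1)*s) (by positivity) E (hE.trans (dc_sub_ball p hs)) hEm
      _ = ENNReal.ofReal (K * (VB n * (n + 1) ^ n)) * volume (dc p s) * μ E := by
          rw [hvol p s hs, ENNReal.ofReal_mul hk.le]; ring
      _ ≤ _ := by gcongr; linarith
  · intro p s hs
    by_contra h
    have h0 : μ (dc p s) = 0 := by simpa using h
    have h1 := hcmp p s hs
    rw [h0, mul_zero] at h1
    exact absurd h1 (not_le.2 (A.b3 p _ (by positivity)))
  · intro p s hs
    exact (measure_mono (dc_sub_ball p hs)).trans_lt (A.b4 p _ (by positivity))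

theorem grow1 (A : BAdm f μ K) {ε : ℝ} (hε : 0 < ε) (c : Rn n) {r W : ℝ} (hr : 0 < r) (hW : μ.real (ball c r) = W * r ^ n) (k : ℕ) :
    ∀ R, r ≤ R → R ≤ 2 ^ k * r → |avg f (ball c R) - avg f (ball c r)| ≤ (2 ^ n * K / VB n / (1 - 2 ^ (-ε))) * W * (R / r) ^ ε := by
  have hV := VB_pos (n := n)
  have hk : 0 < K := zero_lt_one.trans_le A.k1
  have hW0 : 0 < W := by
    have := A.Wpos c hr
    rw [hW] at this
    exact pos_of_mul_pos_left this (by positivity)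
  have he1 : (2:ℝ) ^ (-ε) < 1 := Real.rpow_lt_one_of_one_lt_of_neg (by norm_num) (by linarith)
  have he0 : (0:ℝ) < 2 ^ (-ε) := by positivity
  have h1e : 0 < 1 - (2:ℝ) ^ (-ε) := by linarith
  obtain ⟨c0, hc0⟩ : ∃ c0, c0 = 2 ^ n * K / VB n := ⟨_, rfl⟩
  have hc0p : 0 < c0 := by rw [hc0]; positivity
  rw [← hc0]
  have hA : c0 ≤ c0 / (1 - 2 ^ (-ε)) := by
    rw [le_div_iff₀ h1e]; nlinarith
  have hmu : ∀ R, r ≤ R → μ.real (ball c R) ≤ K * W * R ^ n := by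
    intro R hR
    have := A.dbl (c := c) (c' := c) hr (hr.trans_le hR) (ball_subset_ball hR)
    rw [hW] at this
    have h2 : r ^ n * μ.real (ball c R) ≤ r ^ n * (K * W * R ^ n) := by linarith
    exact le_of_mul_le_mul_left h2 (by positivity)
  have hstep : ∀ R R', r ≤ R → R ≤ R' → R' ≤ 2 * R → |avg f (ball c R') - avg f (ball c R)| ≤ c0 * W := by
    intro R R' h1 h2 h3
    have hR : 0 < R := hr.trans_le h1
    have := A.avg_ball_diff (hR.trans_le h2) (ball_subset_ball (x := c) h2) (by rw [vol_ball_real c hR]; positivity)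
    rw [vol_ball_real c hR, abs_sub_comm] at this
    have h4 := this.trans (hmu R' (h1.trans h2))
    have h5 : K * W * R' ^ n ≤ K * W * (2 * R) ^ n := by
      have : 0 ≤ R' := hR.le.trans h2
      gcongr
    have h6 : VB n * R ^ n * |avg f (ball c R') - avg f (ball c R)| ≤ VB n * R ^ n * (c0 * W) := by
      refine h4.trans (h5.trans (le_of_eq ?_))
      rw [hc0, mul_pow]; field_simp
    exact le_of_mul_le_mul_left h6 (by positivity)
  induction k with
  | zero =>
    intro R h1 h2
    have : R = r := le_antisymm (by simpa using h2) h1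
    rw [this]; simp; positivity
  | succ k ih =>
    intro R h1 h2
    have hR : 0 < R := hr.trans_le h1
    by_cases h3 : R ≤ 2 * r
    · refine (hstep r R le_rfl h1 h3).trans ?_
      have : 1 ≤ (R / r) ^ ε := Real.one_le_rpow (by rw [le_div_iff₀ hr]; linarith) hε.le
      calc c0 * W ≤ c0 / (1 - 2 ^ (-ε)) * W * 1 := by rw [mul_one]; gcongr
        _ ≤ _ := by gcongr
    · push Not at h3
      have i1 := ih (R / 2) (by linarith) (by rw [pow_succ] at h2; linarith)
      have i2 := hstep (R / 2) R (by linarith) (by linarith) (by linarith)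
      have i3 := abs_sub_le (avg f (ball c R)) (avg f (ball c (R / 2))) (avg f (ball c r))
      have e1 : (R / 2 / r) ^ ε = 2 ^ (-ε) * (R / r) ^ ε := by
        rw [show R / 2 / r = 2⁻¹ * (R / r) by ring, Real.mul_rpow (by norm_num) (by positivity), Real.inv_rpow (by norm_num), Real.rpow_neg (by norm_num)]
      rw [e1] at i1
      have : 1 ≤ (R / r) ^ ε := Real.one_le_rpow (by rw [le_div_iff₀ hr]; linarith) hε.le
      have i4 : c0 * W ≤ c0 * W * (R / r) ^ ε := le_mul_of_one_le_right (by positivity) this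
      refine i3.trans ((add_le_add i2 i1).trans ?_)
      calc _ ≤ c0 * W * (R / r) ^ ε + c0 / (1 - 2 ^ (-ε)) * W * (2 ^ (-ε) * (R / r) ^ ε) := by linarith
        _ = _ := by field_simp; ring

end PF1

section PF2
variable {f : Rn n → ℝ} {μ : Measure (Rn n)} {K : ℝ}

theorem BAdm.Wp (A : BAdm f μ K) {c : Rn n} {r W : ℝ} (hr : 0 < r) (hW : μ.real (ball c r) = W * r ^ n) : 0 < W := by
  have := A.Wpos c hr
  rw [hW] at this
  exact pos_of_mul_pos_left this (by positivity)

theorem grow2 (n : ℕ) {K ε cb : ℝ} (hK : 1 ≤ K) (hε : 0 < ε) (hcb : 0 ≤ cb) : ∃ C, 0 < C ∧ 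
    ∀ (f : Rn n → ℝ) (μ : Measure (Rn n)) (_ : BAdm f μ K) (c : Rn n) (r W b : ℝ) (_ : 0 < r) (_ : μ.real (ball c r) = W * r ^ n)
     (_ : |avg f (ball c r) - b| ≤ cb * W) (R : ℝ) (_ : r ≤ R), 
     ∫⁻ x in ball c R, ENNReal.ofReal |f x - b| ≤ ENNReal.ofReal (C * (W * R ^ n * (R / r) ^ ε)) := by
  have hV := VB_pos (n := n)
  have he1 : (2:ℝ) ^ (-ε) < 1 := Real.rpow_lt_one_of_one_lt_of_neg (by norm_num) (by linarith)
  have h1e : 0 < 1 - (2:ℝ) ^ (-ε) := by linarith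
  obtain ⟨A0, hA0⟩ : ∃ A0, A0 = (2 ^ n * K / VB n / (1 - 2 ^ (-ε))) := ⟨_, rfl⟩
  have hA0p : 0 < A0 := by rw [hA0]; positivity
  refine ⟨K + VB n * (A0 + cb), by positivity, ?_⟩
  intro f μ A c r W b hr hW hb R hR
  have hR0 : 0 < R := hr.trans_le hR
  have hWp := A.Wp hr hW
  obtain ⟨k, hk⟩ := pow_unbounded_of_one_lt (R / r) (one_lt_two : (1:ℝ) < 2)
  have g1 := grow1 A hε c hr hW k R hR (by rw [div_lt_iff₀ hr] at hk; exact hk.le)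
  rw [← hA0] at g1
  have one : 1 ≤ (R / r) ^ ε := Real.one_le_rpow (by rw [le_div_iff₀ hr]; linarith) hε.le
  have hmu : μ.real (ball c R) ≤ K * W * R ^ n := by
    have := A.dbl (c := c) (c' := c) hr hR0 (ball_subset_ball hR)
    rw [hW] at this
    have h2 : r ^ n * μ.real (ball c R) ≤ r ^ n * (K * W * R ^ n) := by linarith
    exact le_of_mul_le_mul_left h2 (by positivity)
  have hd : |avg f (ball c R) - b| ≤ (A0 + cb) * W * (R / r) ^ ε := by
    have := abs_sub_le (avg f (ball c R)) (avg f (ball c r)) b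
    have h3 : cb * W ≤ cb * W * (R / r) ^ ε := le_mul_of_one_le_right (by positivity) one
    linarith
  calc _ ≤ ∫⁻ x in ball c R, (ENNReal.ofReal |f x - avg f (ball c R)| + ENNReal.ofReal ((A0 + cb) * W * (R / r) ^ ε)) := by
        apply lintegral_mono
        intro x
        dsimp only
        rw [← ENNReal.ofReal_add (by positivity) (by positivity)]
        apply ENNReal.ofReal_le_ofReal
        have := abs_sub_le (f x) (avg f (ball c R)) b
        linarith
    _ = (∫⁻ x in ball c R, ENNReal.ofReal |f x - avg f (ball c R)|) + ENNReal.ofReal ((A0 + cb) * W * (R / r) ^ ε) * ENNReal.ofReal (VB n * R ^ n) := by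
        rw [lintegral_add_right _ measurable_const, setLIntegral_const, vol_ball c hR0]
    _ ≤ ENNReal.ofReal (K * W * R ^ n) + ENNReal.ofReal ((A0 + cb) * W * (R / r) ^ ε) * ENNReal.ofReal (VB n * R ^ n) := by
        gcongr
        refine (A.b1 c R hR0).trans ?_
        rw [← ofReal_measureReal (A.b4 c R hR0).ne]
        exact ENNReal.ofReal_le_ofReal hmu
    _ ≤ _ := by
        rw [← ENNReal.ofReal_mul (by positivity), ← ENNReal.ofReal_add (by positivity) (by positivity)]
        apply ENNReal.ofReal_le_ofReal
        have h3 : K * W * R ^ n ≤ K * W * R ^ n * (R / r) ^ ε := le_mul_of_one_le_right (by positivity) one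
        calc _ ≤ K * W * R ^ n * (R / r) ^ ε + (A0 + cb) * W * (R / r) ^ ε * (VB n * R ^ n) := by linarith
          _ = _ := by ring

theorem layer {ρ τ q : ℝ} (hρ : 0 < ρ) (hτ : 0 ≤ τ) (hq : 0 < q) : ∃ k : ℕ, τ < 2 ^ k * ρ ∧ (ρ + τ) ^ (-q) ≤ 2 ^ q * (2 ^ k * ρ) ^ (-q) := by
  have hex : ∃ k : ℕ, τ < 2 ^ k * ρ := by
    obtain ⟨k, hk⟩ := pow_unbounded_of_one_lt (τ / ρ) (one_lt_two : (1:ℝ) < 2)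
    exact ⟨k, by rwa [div_lt_iff₀ hρ] at hk⟩
  classical
  refine ⟨Nat.find hex, Nat.find_spec hex, ?_⟩
  have h2 : ∀ x : ℝ, 0 < x → (x / 2) ^ (-q) = 2 ^ q * x ^ (-q) := by
    intro x hx
    rw [div_eq_mul_inv, Real.mul_rpow hx.le (by norm_num), Real.inv_rpow (by norm_num), Real.rpow_neg (by norm_num : (0:ℝ) ≤ 2), inv_inv, mul_comm]
  rw [← h2 _ (by positivity)]
  apply Real.rpow_le_rpow_of_nonpos (by positivity) _ (by linarith)
  rcases Nat.eq_zero_or_pos (Nat.find hex) with h | h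
  · rw [h]; linarith
  · obtain ⟨m, hm⟩ := Nat.exists_eq_add_of_le' h
    have := Nat.find_min hex (m := m) (by omega)
    push Not at this
    rw [hm, pow_succ]; linarith

theorem grow3 (n : ℕ) {K ε cb δ : ℝ} (hK : 1 ≤ K) (hε : 0 < ε) (hcb : 0 ≤ cb) (hεδ : ε < δ) : ∃ C, 0 < C ∧ 
    ∀ (f : Rn n → ℝ) (μ : Measure (Rn n)) (_ : BAdm f μ K) (c : Rn n) (r W b : ℝ) (_ : 0 < r) (_ : μ.real (ball c r) = W * r ^ n)
     (_ : |avg f (ball c r) - b| ≤ cb * W) (ρ : ℝ) (_ : r ≤ ρ), 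
     ∫⁻ x, ENNReal.ofReal (|f x - b| * (ρ + dist x c) ^ (-((n:ℝ) + δ))) ≤ ENNReal.ofReal (C * (W * ρ ^ (-δ) * (ρ / r) ^ ε)) := by
  obtain ⟨C, hC, hC'⟩ := grow2 n hK hε hcb
  have hx1 : (2:ℝ) ^ (-(δ - ε)) < 1 := Real.rpow_lt_one_of_one_lt_of_neg (by norm_num) (by linarith)
  have hx0 : (0:ℝ) < 2 ^ (-(δ - ε)) := by positivity
  have hx2 : 0 < 1 - (2:ℝ) ^ (-(δ - ε)) := by linarith
  have hn0 : (0:ℝ) ≤ n := by positivity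
  have hq : 0 < (n:ℝ) + δ := by linarith
  refine ⟨2 ^ ((n:ℝ) + δ) * C * (1 - 2 ^ (-(δ - ε)))⁻¹, by positivity, ?_⟩
  intro f μ A c r W b hr hW hb ρ hρr
  have hWp := A.Wp hr hW
  have hρ : 0 < ρ := hr.trans_le hρr
  calc _ ≤ ∫⁻ x, ∑' k : ℕ, ENNReal.ofReal (2 ^ ((n:ℝ) + δ) * (2 ^ k * ρ) ^ (-((n:ℝ) + δ))) * (ball c (2 ^ k * ρ)).indicator (fun x => ENNReal.ofReal |f x - b|) x := by
        apply lintegral_mono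
        intro x
        obtain ⟨k, hk1, hk2⟩ := layer hρ (dist_nonneg (x := x) (y := c)) hq
        refine le_trans ?_ (ENNReal.le_tsum k)
        rw [indicator_of_mem (show x ∈ ball c (2 ^ k * ρ) from hk1), ← ENNReal.ofReal_mul (by positivity)]
        apply ENNReal.ofReal_le_ofReal
        rw [mul_comm]
        gcongr
    _ = ∑' k : ℕ, ENNReal.ofReal (2 ^ ((n:ℝ) + δ) * (2 ^ k * ρ) ^ (-((n:ℝ) + δ))) * ∫⁻ x in ball c (2 ^ k * ρ), ENNReal.ofReal |f x - b| := by
        have hm : AEMeasurable (fun x => ENNReal.ofReal |f x - b|) volume := by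
          have := A.loc.aestronglyMeasurable.aemeasurable
          fun_prop
        rw [lintegral_tsum]
        · congr 1; ext k
          rw [lintegral_const_mul' _ _ ENNReal.ofReal_ne_top, lintegral_indicator measurableSet_ball]
        · intro k
          exact (hm.indicator measurableSet_ball).const_mul _
    _ ≤ ∑' k : ℕ, ENNReal.ofReal (2 ^ ((n:ℝ) + δ) * C * (W * ρ ^ (-δ) * (ρ / r) ^ ε) * (2 ^ (-(δ - ε))) ^ k) := by
        apply ENNReal.tsum_le_tsum
        intro k
        have hk1 : (1:ℝ) ≤ 2 ^ k := one_le_pow₀ (by norm_num)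
        have hk0 : (0:ℝ) < 2 ^ k := by positivity
        have := hC' f μ A c r W b hr hW hb (2 ^ k * ρ) (by nlinarith)
        refine (mul_le_mul_right this _).trans ?_
        rw [← ENNReal.ofReal_mul (by positivity)]
        apply ENNReal.ofReal_le_ofReal
        apply le_of_eq
        have hP : 0 < 2 ^ k * ρ := by positivity
        have e1 : (2 ^ k * ρ) ^ (-((n:ℝ) + δ)) * (2 ^ k * ρ) ^ n = (2 ^ k * ρ) ^ (-δ) := by
          rw [← Real.rpow_natCast (2 ^ k * ρ) n, ← Real.rpow_add hP]; congr 1; ring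
        have e2 : (2 ^ k * ρ) ^ (-δ) = ((2:ℝ) ^ k) ^ (-δ) * ρ ^ (-δ) := Real.mul_rpow hk0.le hρ.le
        have e3 : (2 ^ k * ρ / r) ^ ε = ((2:ℝ) ^ k) ^ ε * (ρ / r) ^ ε := by
          rw [mul_div_assoc, Real.mul_rpow hk0.le (by positivity)]
        have e4 : ((2:ℝ) ^ (-(δ - ε))) ^ k = ((2:ℝ) ^ k) ^ (-δ) * ((2:ℝ) ^ k) ^ ε := by
          rw [← Real.rpow_add hk0, ← Real.rpow_natCast, ← Real.rpow_natCast, ← Real.rpow_mul (by norm_num), ← Real.rpow_mul (by norm_num)]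
          congr 1; ring
        rw [e4, e3]
        calc _ = 2 ^ ((n:ℝ) + δ) * C * W * ((2 ^ k * ρ) ^ (-((n:ℝ) + δ)) * (2 ^ k * ρ) ^ n) * (((2:ℝ) ^ k) ^ ε * (ρ / r) ^ ε) := by ring
          _ = _ := by rw [e1, e2]; ring
    _ = _ := by
        rw [← ENNReal.ofReal_tsum_of_nonneg (fun k => by positivity) ((summable_geometric_of_lt_one hx0.le hx1).mul_left _), tsum_mul_left, tsum_geometric_of_lt_one hx0.le hx1]
        congr 1; ring

/-- corner of the big cube -/
def pQ (c : Rn n) (r : ℝ) : Rn n := WithLp.toLp 2 (fun i => c i - 4 * r)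

theorem ball_sub_Q (c : Rn n) (r : ℝ) : ball c (4 * r) ⊆ dc (pQ c r) (8 * r) := by
  intro x hx i
  have h1 : |x i - c i| ≤ dist x c := by
    rw [dist_eq_norm]
    exact PiLp.norm_apply_le (x - c) i
  have h2 : dist x c < 4 * r := hx
  have h3 := abs_lt.1 (h1.trans_lt h2)
  simp only [pQ]
  constructor <;> linarith [h3.1, h3.2]

theorem Q_mu (A : BAdm f μ K) (c : Rn n) {r W : ℝ} (hr : 0 < r) (hW : μ.real (ball c r) = W * r ^ n) :
    μ.real (ball (pQ c r) ((n + 1) * (8 * r))) ≤ K * (8 * (n + 1)) ^ n * (W * r ^ n) := by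
  have hsub : ball c r ⊆ ball (pQ c r) ((n + 1) * (8 * r)) :=
    (ball_subset_ball (by linarith)).trans ((ball_sub_Q c r).trans (dc_sub_ball _ (by positivity)))
  have := A.dbl hr (by positivity) hsub
  rw [hW] at this
  have h2 : r ^ n * μ.real (ball (pQ c r) ((n + 1) * (8 * r))) ≤ r ^ n * (K * (8 * (n + 1)) ^ n * (W * r ^ n)) := by
    rw [show ((n:ℝ) + 1) * (8 * r) = (8 * (n + 1)) * r by ring, mul_pow] at this
    rw [show ((n:ℝ) + 1) * (8 * r) = (8 * (n + 1)) * r by ring]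
    linarith
  exact le_of_mul_le_mul_left h2 (by positivity)

theorem Q_avg (A : BAdm f μ K) (c : Rn n) {r W : ℝ} (hr : 0 < r) (hW : μ.real (ball c r) = W * r ^ n) :
    |avg f (ball c r) - avg f (dc (pQ c r) (8 * r))| ≤ (K * (8 * (n + 1)) ^ n / VB n + K * (8 * (n + 1)) ^ n) * W := by
  have hV := VB_pos (n := n)
  have hk : 0 < K := zero_lt_one.trans_le A.k1
  have hWp := A.Wp hr hW
  have hsub : ball c r ⊆ ball (pQ c r) ((n + 1) * (8 * r)) :=
    (ball_subset_ball (by linarith)).trans ((ball_sub_Q c r).trans (dc_sub_ball _ (by positivity)))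
  have hm := Q_mu A c hr hW
  have h1 := (A.avg_ball_diff (by positivity) hsub (by rw [vol_ball_real c hr]; positivity)).trans hm
  have h2 := (A.avg_ball_diff (by positivity) (dc_sub_ball (pQ c r) (show 0 < 8 * r by positivity)) (by rw [dc_real _ (by positivity)]; positivity)).trans hm
  rw [vol_ball_real c hr] at h1
  rw [dc_real _ (by positivity)] at h2
  set k := avg f (ball (pQ c r) ((n + 1) * (8 * r)))
  have h1' : |avg f (ball c r) - k| ≤ K * (8 * (n + 1)) ^ n / VB n * W := by
    have : (VB n * r ^ n) * |avg f (ball c r) - k| ≤ (VB n * r ^ n) * (K * (8 * (n + 1)) ^ n / VB n * W) := by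
      refine h1.trans (le_of_eq ?_)
      field_simp
    exact le_of_mul_le_mul_left this (by positivity)
  have h2' : |avg f (dc (pQ c r) (8 * r)) - k| ≤ K * (8 * (n + 1)) ^ n * W := by
    have h8 : (1:ℝ) ≤ 8 ^ n := one_le_pow₀ (by norm_num)
    have : r ^ n * |avg f (dc (pQ c r) (8 * r)) - k| ≤ r ^ n * (K * (8 * (n + 1)) ^ n * W) := by
      rw [mul_pow] at h2
      have h9 : r ^ n * |avg f (dc (pQ c r) (8 * r)) - k| ≤ 8 ^ n * (r ^ n * |avg f (dc (pQ c r) (8 * r)) - k|) := le_mul_of_one_le_left (by positivity) h8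
      linarith
    exact le_of_mul_le_mul_left this (by positivity)
  have := abs_sub_le (avg f (ball c r)) k (avg f (dc (pQ c r) (8 * r)))
  rw [abs_sub_comm k] at this
  linarith

end PF2

section PF3
theorem psit_zero {C₁ C₂ δ γ : ℝ} {ψ : Rn n → ℝ} (hψ : PsiKernel n C₁ C₂ δ γ ψ) (t : ℝ) (y : Rn n) :
    ∫ z, (t ^ n)⁻¹ * ψ (t⁻¹ • (y - z)) = 0 := by
  rw [integral_const_mul, integral_sub_left_eq_self (fun w => ψ (t⁻¹ • w)) volume y, Measure.integral_comp_smul, hψ.2.1]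
  simp

theorem psit_dom {C₁ C₂ δ γ : ℝ} {ψ : Rn n → ℝ} (hψ : PsiKernel n C₁ C₂ δ γ ψ) {t : ℝ} (ht : 0 < t) (y : Rn n)
    {h : Rn n → ℝ} (hh : AEStronglyMeasurable h volume) {g : Rn n → ℝ} {M : ℝ} (hM : 0 ≤ M)
    (hg : ∀ z, |(t ^ n)⁻¹ * ψ (t⁻¹ • (y - z))| * |h z| ≤ g z)
    (hgM : ∫⁻ z, ENNReal.ofReal (g z) ≤ ENNReal.ofReal M) :
    Integrable (fun z => (t ^ n)⁻¹ * ψ (t⁻¹ • (y - z)) * h z) volume ∧ |cvl ψ t h y| ≤ M := by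
  have h1 : ∫⁻ z, ‖(t ^ n)⁻¹ * ψ (t⁻¹ • (y - z)) * h z‖ₑ ≤ ENNReal.ofReal M := by
    refine le_trans (lintegral_mono fun z => ?_) hgM
    rw [← ofReal_norm, Real.norm_eq_abs, abs_mul]
    exact ENNReal.ofReal_le_ofReal (hg z)
  refine ⟨⟨(psit_int hψ ht y).1.mul hh, h1.trans_lt ENNReal.ofReal_lt_top⟩, ?_⟩
  have h2 := (enorm_integral_le_lintegral_enorm (fun z => (t ^ n)⁻¹ * ψ (t⁻¹ • (y - z)) * h z)).trans h1
  rw [← ofReal_norm] at h2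
  exact (ENNReal.ofReal_le_ofReal_iff hM).1 h2

theorem cvl_sub_const {C₁ C₂ δ γ : ℝ} {ψ : Rn n → ℝ} (hψ : PsiKernel n C₁ C₂ δ γ ψ) {t : ℝ} (ht : 0 < t) (y : Rn n)
    {f : Rn n → ℝ} {b : ℝ} (hi : Integrable (fun z => (t ^ n)⁻¹ * ψ (t⁻¹ • (y - z)) * (f z - b)) volume) :
    cvl ψ t f y = cvl ψ t (fun z => f z - b) y := by
  unfold cvl
  have e : ∀ z, (t ^ n)⁻¹ * ψ (t⁻¹ • (y - z)) * f z = (t ^ n)⁻¹ * ψ (t⁻¹ • (y - z)) * (f z - b) + (t ^ n)⁻¹ * ψ (t⁻¹ • (y - z)) * b := by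
    intro z; ring
  simp_rw [e]
  rw [integral_add hi ((psit_int hψ ht y).mul_const b), integral_mul_const, psit_zero hψ]
  simp

theorem sc_i {R t T d q : ℝ} (ht : 0 < t) (hR : t ≤ R) (hT : t ≤ T) (hd : 0 ≤ d) (h : R + d ≤ 2 * R + (T - t)) (hq : 0 < q) :
    T ^ (-q) ≤ (2 * R / t) ^ q * (R + d) ^ (-q) := by
  have hR0 : 0 < R := ht.trans_le hR
  have hT0 : 0 < T := ht.trans_le hT
  have h1 : (R + d) / (2 * R / t) ≤ T := by
    rw [div_le_iff₀ (by positivity), ← mul_div_assoc, le_div_iff₀ ht]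
    nlinarith [mul_nonneg (sub_nonneg.2 hR) (sub_nonneg.2 hT)]
  calc T ^ (-q) ≤ ((R + d) / (2 * R / t)) ^ (-q) := Real.rpow_le_rpow_of_nonpos (by positivity) h1 (by linarith)
    _ = _ := by
      rw [Real.div_rpow (by positivity) (by positivity), Real.rpow_neg (by positivity : 0 ≤ 2 * R / t), div_inv_eq_mul, mul_comm]

theorem sc_i2 (n : ℕ) {R t δ : ℝ} (ht : 0 < t) (hR : 0 < R) :
    t ^ δ * (2 * R / t) ^ ((n:ℝ) + δ) * R ^ (-δ) = 2 ^ ((n:ℝ) + δ) * (R / t) ^ n := by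
  rw [Real.div_rpow (by positivity) ht.le, Real.mul_rpow (by norm_num) hR.le, Real.rpow_add hR, Real.rpow_add ht,
    Real.rpow_natCast R n, Real.rpow_natCast t n, Real.rpow_neg hR.le, div_pow]
  have := Real.rpow_pos_of_pos ht δ
  have := Real.rpow_pos_of_pos hR δ
  field_simp

theorem Phi_i (n : ℕ) {C₁ C₂ δ γ K ε cb : ℝ} (hC₁ : 0 < C₁) (hK : 1 ≤ K) (hε : 0 < ε) (hcb : 0 ≤ cb) (hεδ : ε < δ)
    {ψ : Rn n → ℝ} (hψ : PsiKernel n C₁ C₂ δ γ ψ) : ∃ C, 0 < C ∧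
    ∀ (f : Rn n → ℝ) (μ : Measure (Rn n)) (_ : BAdm f μ K) (c : Rn n) (r W b : ℝ) (_ : 0 < r) (_ : μ.real (ball c r) = W * r ^ n)
     (_ : |avg f (ball c r) - b| ≤ cb * W) (t : ℝ) (_ : 0 < t) (y : Rn n),
     Integrable (fun z => (t ^ n)⁻¹ * ψ (t⁻¹ • (y - z)) * (f z - b)) volume ∧
     |cvl ψ t f y| ≤ C * (W * ((r + t + dist y c) / t) ^ n * ((r + t + dist y c) / r) ^ ε) := by
  obtain ⟨C, hC, hC'⟩ := grow3 n hK hε hcb hεδ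
  refine ⟨C₁ * 2 ^ ((n:ℝ) + δ) * C, by positivity, ?_⟩
  intro f μ A c r W b hr hW hb t ht y
  have hWp := A.Wp hr hW
  have hyc := dist_nonneg (x := y) (y := c)
  obtain ⟨R, hR⟩ : ∃ R, R = r + t + dist y c := ⟨_, rfl⟩
  rw [← hR]
  have hR0 : 0 < R := by linarith
  have hn0 : (0:ℝ) ≤ n := by positivity
  have hq : 0 < (n:ℝ) + δ := by linarith
  have key := psit_dom hψ ht y (h := fun z => f z - b) (A.loc.aestronglyMeasurable.sub aestronglyMeasurable_const)
    (g := fun z => C₁ * (t ^ δ * (2 * R / t) ^ ((n:ℝ) + δ)) * (|f z - b| * (R + dist z c) ^ (-((n:ℝ) + δ))))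
    (M := C₁ * (t ^ δ * (2 * R / t) ^ ((n:ℝ) + δ)) * (C * (W * R ^ (-δ) * (R / r) ^ ε))) (by positivity) ?_ ?_
  · refine ⟨key.1, ?_⟩
    rw [cvl_sub_const hψ ht y key.1]
    refine key.2.trans (le_of_eq ?_)
    have := sc_i2 n (δ := δ) ht hR0
    calc _ = C₁ * C * W * (R / r) ^ ε * (t ^ δ * (2 * R / t) ^ ((n:ℝ) + δ) * R ^ (-δ)) := by ring
      _ = _ := by rw [this]; ring
  · intro z
    have h1 := psit_bd hψ ht (y - z)
    have h2 : (t + ‖y - z‖) ^ (-((n:ℝ) + δ)) ≤ (2 * R / t) ^ ((n:ℝ) + δ) * (R + dist z c) ^ (-((n:ℝ) + δ)) := by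
      apply sc_i ht (by linarith) (by linarith [norm_nonneg (y - z)]) dist_nonneg _ hq
      have := dist_triangle z y c
      rw [dist_comm z y, dist_eq_norm y z] at this
      linarith
    have hz := abs_nonneg (f z - b)
    have htd : 0 < t ^ δ := by positivity
    calc _ ≤ (C₁ * (t ^ δ * ((2 * R / t) ^ ((n:ℝ) + δ) * (R + dist z c) ^ (-((n:ℝ) + δ))))) * |f z - b| := by
          apply mul_le_mul_of_nonneg_right _ hz
          refine h1.trans ?_
          apply mul_le_mul_of_nonneg_left _ hC₁.le
          exact mul_le_mul_of_nonneg_left h2 htd.le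
      _ = _ := by ring
  · have hp : 0 ≤ C₁ * (t ^ δ * (2 * R / t) ^ ((n:ℝ) + δ)) := by positivity
    simp_rw [ENNReal.ofReal_mul hp]
    rw [lintegral_const_mul' _ _ ENNReal.ofReal_ne_top]
    exact mul_le_mul_right (hC' f μ A c r W b hr hW hb R (by linarith)) _

theorem Phi_ii (n : ℕ) {C₁ C₂ δ γ K ε cb : ℝ} (hC₁ : 0 < C₁) (hK : 1 ≤ K) (hε : 0 < ε) (hcb : 0 ≤ cb) (hεδ : ε < δ)
    {ψ : Rn n → ℝ} (hψ : PsiKernel n C₁ C₂ δ γ ψ) : ∃ C, 0 < C ∧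
    ∀ (f : Rn n → ℝ) (μ : Measure (Rn n)) (_ : BAdm f μ K) (c : Rn n) (r W b : ℝ) (_ : 0 < r) (_ : μ.real (ball c r) = W * r ^ n)
     (_ : |avg f (ball c r) - b| ≤ cb * W) (t : ℝ) (_ : 0 < t) (y : Rn n) (_ : dist y c < 2 * r) (E : Set (Rn n)) (_ : MeasurableSet E)
     (_ : ball c (4 * r) ⊆ E),
     Integrable (fun z => (t ^ n)⁻¹ * ψ (t⁻¹ • (y - z)) * Eᶜ.indicator (fun z => f z - b) z) volume ∧
     |cvl ψ t (Eᶜ.indicator (fun z => f z - b)) y| ≤ C * (W * (t / r) ^ δ) := by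
  obtain ⟨C, hC, hC'⟩ := grow3 n hK hε hcb hεδ
  refine ⟨C₁ * 4 ^ ((n:ℝ) + δ) * C, by positivity, ?_⟩
  intro f μ A c r W b hr hW hb t ht y hy E hE hEs
  have hWp := A.Wp hr hW
  have hn0 : (0:ℝ) ≤ n := by positivity
  have hq : 0 < (n:ℝ) + δ := by linarith
  have key := psit_dom hψ ht y (h := Eᶜ.indicator (fun z => f z - b)) ((A.loc.aestronglyMeasurable.sub aestronglyMeasurable_const).indicator hE.compl)
    (g := fun z => C₁ * (t ^ δ * 4 ^ ((n:ℝ) + δ)) * (|f z - b| * (r + dist z c) ^ (-((n:ℝ) + δ))))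
    (M := C₁ * (t ^ δ * 4 ^ ((n:ℝ) + δ)) * (C * (W * r ^ (-δ) * (r / r) ^ ε))) (by positivity) ?_ ?_
  · refine ⟨key.1, key.2.trans (le_of_eq ?_)⟩
    rw [div_self hr.ne', Real.one_rpow, Real.div_rpow ht.le hr.le, Real.rpow_neg hr.le]
    ring
  · intro z
    have htd : 0 < t ^ δ := by positivity
    have hz := abs_nonneg (f z - b)
    have hd0 := dist_nonneg (x := z) (y := c)
    by_cases hz' : z ∈ E
    · rw [indicator_of_notMem (by simpa using hz'), abs_zero, mul_zero]
      have : 0 < (r + dist z c) ^ (-((n:ℝ) + δ)) := Real.rpow_pos_of_pos (by linarith) _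
      positivity
    rw [indicator_of_mem (by simpa using hz')]
    have hd : 4 * r ≤ dist z c := by
      by_contra hh
      exact hz' (hEs (not_le.1 hh))
    have h1 := psit_bd hψ ht (y - z)
    have h2 : (t + ‖y - z‖) ^ (-((n:ℝ) + δ)) ≤ 4 ^ ((n:ℝ) + δ) * (r + dist z c) ^ (-((n:ℝ) + δ)) := by
      have h3 : (r + dist z c) / 4 ≤ t + ‖y - z‖ := by
        have := dist_triangle z y c
        rw [dist_comm z y, dist_eq_norm y z] at this
        linarith
      refine (Real.rpow_le_rpow_of_nonpos (by linarith) h3 (by linarith)).trans (le_of_eq ?_)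
      rw [Real.div_rpow (by linarith) (by norm_num), Real.rpow_neg (by norm_num : (0:ℝ) ≤ 4), div_inv_eq_mul, mul_comm]
    calc _ ≤ (C₁ * (t ^ δ * (4 ^ ((n:ℝ) + δ) * (r + dist z c) ^ (-((n:ℝ) + δ))))) * |f z - b| := by
          apply mul_le_mul_of_nonneg_right _ hz
          refine h1.trans ?_
          apply mul_le_mul_of_nonneg_left _ hC₁.le
          exact mul_le_mul_of_nonneg_left h2 htd.le
      _ = _ := by ring
  · have hp : 0 ≤ C₁ * (t ^ δ * 4 ^ ((n:ℝ) + δ)) := by positivity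
    simp_rw [ENNReal.ofReal_mul hp]
    rw [lintegral_const_mul' _ _ ENNReal.ofReal_ne_top]
    exact mul_le_mul_right (hC' f μ A c r W b hr hW hb r le_rfl) _

theorem Phi_main (n : ℕ) {C₁ C₂ δ γ K ε : ℝ} (hC₁ : 0 < C₁) (hK : 1 ≤ K) (hε : 0 < ε) (hεδ : ε < δ)
    {ψ : Rn n → ℝ} (hψ : PsiKernel n C₁ C₂ δ γ ψ) : ∃ C, 0 < C ∧
    ∀ (f : Rn n → ℝ) (μ : Measure (Rn n)) (_ : BAdm f μ K) (c : Rn n) (r W : ℝ) (_ : 0 < r) (_ : μ.real (ball c r) = W * r ^ n)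
     (t : ℝ) (_ : 0 < t) (y : Rn n),
     Phi ψ f (t, y) ≤ ENNReal.ofReal (C * (W * ((r + t + dist y c) / t) ^ n * ((r + t + dist y c) / r) ^ ε)) ∧
     (dist y c < 2 * r → Phi ψ f (t, y) ≤ Phi ψ (hQ f (pQ c r) (8 * r)) (t, y) + ENNReal.ofReal (C * (W * (t / r) ^ δ))) := by
  have hV := VB_pos (n := n)
  have hcb : 0 ≤ K * (8 * ((n:ℝ) + 1)) ^ n / VB n + K * (8 * (n + 1)) ^ n := by positivity
  obtain ⟨C, hC, h1⟩ := Phi_i n hC₁ hK hε hcb hεδ hψ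
  obtain ⟨C', hC', h2⟩ := Phi_ii n hC₁ hK hε hcb hεδ hψ
  refine ⟨C + C', by positivity, ?_⟩
  intro f μ A c r W hr hW t ht y
  have hWp := A.Wp hr hW
  have hyc := dist_nonneg (x := y) (y := c)
  have hb := Q_avg A c hr hW
  have k1 := h1 f μ A c r W _ hr hW hb t ht y
  refine ⟨ENNReal.ofReal_le_ofReal (k1.2.trans ?_), fun hy => ?_⟩
  · apply mul_le_mul_of_nonneg_right (by linarith) (by positivity)
  · have k2 := h2 f μ A c r W _ hr hW hb t ht y hy (dc (pQ c r) (8 * r)) (dc_meas _ _) (ball_sub_Q c r)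
    have hi := psit_mul_int hC₁ (hε.trans hεδ) hψ ht y (hQ_int A.loc (pQ c r) (show 0 < 8 * r by positivity))
    have e : cvl ψ t f y = cvl ψ t (hQ f (pQ c r) (8 * r)) y + cvl ψ t ((dc (pQ c r) (8 * r))ᶜ.indicator (fun z => f z - avg f (dc (pQ c r) (8 * r)))) y := by
      rw [cvl_sub_const hψ ht y k1.1]
      unfold cvl
      rw [← integral_add hi k2.1]
      congr 1; ext z
      rw [← mul_add]
      congr 1
      unfold hQ
      by_cases hz : z ∈ dc (pQ c r) (8 * r) <;> simp [hz]
    unfold Phi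
    dsimp only
    rw [e, ← ENNReal.ofReal_add (abs_nonneg _) (by positivity)]
    apply ENNReal.ofReal_le_ofReal
    refine (abs_add_le _ _).trans ?_
    have h3 : C' * (W * (t / r) ^ δ) ≤ (C + C') * (W * (t / r) ^ δ) := mul_le_mul_of_nonneg_right (by linarith) (by positivity)
    linarith [k2.2]

end PF3

section PG1
theorem sc_bern {U V a r R : ℝ} (hU : 0 < U) (hV : 0 < V) (ha : 1 ≤ a) (hr : 0 < r) (hR : 0 < R) (hUV : V - U ≤ 2 * r) (hRU : R ≤ 3 * U) :
    U ^ (-a) ≤ V ^ (-a) + 2 * a * 3 ^ (a + 1) * r * R ^ (-(a + 1)) := by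
  have hp : 0 < 2 * a * 3 ^ (a + 1) * r * R ^ (-(a + 1)) := by positivity
  rcases le_total V U with h | h
  · have := Real.rpow_le_rpow_of_nonpos hV h (show -a ≤ 0 by linarith)
    linarith
  · have b := one_add_mul_self_le_rpow_one_add (s := U / V - 1) (by have : 0 < U / V := by positivity
                                                                    linarith) ha
    rw [add_sub_cancel] at b
    have e1 : V ^ (-a) = U ^ (-a) * (U / V) ^ a := by
      rw [Real.div_rpow hU.le hV.le, Real.rpow_neg hU.le, Real.rpow_neg hV.le]
      have := Real.rpow_pos_of_pos hU a
      field_simp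
    have e2 : 1 - U / V ≤ 2 * r * U⁻¹ := by
      calc 1 - U / V = (V - U) / V := by field_simp
        _ ≤ (2 * r) / U := by gcongr
        _ = _ := by ring
    have e3 : U ^ (-a) * U⁻¹ ≤ 3 ^ (a + 1) * R ^ (-(a + 1)) := by
      rw [← Real.rpow_neg_one, ← Real.rpow_add hU]
      have h3 : R / 3 ≤ U := by linarith
      calc U ^ (-a + -1) ≤ (R / 3) ^ (-a + -1) := Real.rpow_le_rpow_of_nonpos (by positivity) h3 (by linarith)
        _ = _ := by
          rw [show -a + -1 = -(a + 1) by ring, Real.div_rpow hR.le (by norm_num), Real.rpow_neg (by norm_num : (0:ℝ) ≤ 3), div_inv_eq_mul, mul_comm]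
    have hUa := Real.rpow_pos_of_pos hU (-a)
    calc U ^ (-a) = V ^ (-a) + U ^ (-a) * (1 - (U / V) ^ a) := by rw [e1]; ring
      _ ≤ V ^ (-a) + U ^ (-a) * (a * (2 * r * U⁻¹)) := by
          gcongr
          nlinarith
      _ = V ^ (-a) + 2 * a * r * (U ^ (-a) * U⁻¹) := by ring
      _ ≤ V ^ (-a) + 2 * a * r * (3 ^ (a + 1) * R ^ (-(a + 1))) := by gcongr
      _ = _ := by ring

theorem wt_cmp {a : ℝ} (ha : 1 ≤ a) {c x x' : Rn n} {r : ℝ} (hr : 0 < r) (hx : x ∈ ball c r) (hx' : x' ∈ ball c r)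
    {t : ℝ} (ht : 0 < t) {y : Rn n} (hT : ¬ (t < r ∧ dist y c < 2 * r)) :
    wt a x (t, y) ≤ wt a x' (t, y) + ENNReal.ofReal (2 * a * 3 ^ (a + 1) * r * (t ^ (a - n - 1) * (r + t + dist y c) ^ (-(a + 1)))) := by
  rw [wt_eq a x ht, wt_eq a x' ht, ← ENNReal.ofReal_add (by positivity) (by positivity)]
  apply ENNReal.ofReal_le_ofReal
  have hx1 : dist x c < r := hx
  have hx2 : dist x' c < r := hx'
  have t1 := dist_triangle x' x y
  have t2 := dist_triangle_right x' x c
  have t3 := dist_triangle y x c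
  have t4 := dist_nonneg (x := x) (y := y)
  have t5 := dist_nonneg (x := y) (y := c)
  have t6 := dist_nonneg (x := x') (y := y)
  rw [dist_comm y x] at t3
  have := sc_bern (U := t + dist x y) (V := t + dist x' y) (a := a) (r := r) (R := r + t + dist y c) (by linarith) (by linarith) ha hr
    (by linarith) (by linarith) (by
      by_cases h : t < r
      · have : 2 * r ≤ dist y c := by
          by_contra hh; exact hT ⟨h, not_le.1 hh⟩
        linarith
      · linarith)
  have hta : 0 < t ^ (a - n - 1) := by positivity
  calc _ ≤ t ^ (a - n - 1) * ((t + dist x' y) ^ (-a) + 2 * a * 3 ^ (a + 1) * r * (r + t + dist y c) ^ (-(a + 1))) :=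
        mul_le_mul_of_nonneg_left this hta.le
    _ = _ := by ring

theorem sc_prod (n : ℕ) {t r R a ε W C A : ℝ} (ht : 0 < t) (hr : 0 < r) (hR : 0 < R) :
    A * r * (t ^ (a - n - 1) * R ^ (-(a + 1))) * (C * (W * (R / t) ^ n * (R / r) ^ ε)) ^ 2
     = A * C ^ 2 * W ^ 2 * r ^ (1 - 2 * ε) * (t ^ (a - 3 * n - 1) * R ^ (-(a + 1 - 2 * n - 2 * ε))) := by
  have e1 : t ^ (a - 3 * n - 1) = t ^ (a - n - 1) * (t ^ n)⁻¹ * (t ^ n)⁻¹ := by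
    rw [← Real.rpow_natCast t n, ← Real.rpow_neg ht.le, ← Real.rpow_add ht, ← Real.rpow_add ht]; congr 1; ring
  have e2 : R ^ (-(a + 1 - 2 * n - 2 * ε)) = R ^ (-(a + 1)) * R ^ n * R ^ n * R ^ ε * R ^ ε := by
    rw [← Real.rpow_natCast R n, ← Real.rpow_add hR, ← Real.rpow_add hR, ← Real.rpow_add hR, ← Real.rpow_add hR]; congr 1; ring
  have e3 : r ^ (1 - 2 * ε) = r * (r ^ ε)⁻¹ * (r ^ ε)⁻¹ := by
    nth_rw 2 [← Real.rpow_one r]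
    rw [← Real.rpow_neg hr.le, ← Real.rpow_add hr, ← Real.rpow_add hr]; congr 1; ring
  rw [e1, e2, e3, div_pow, Real.div_rpow hR.le hr.le]
  ring

theorem enn_sq_ofReal {x : ℝ} (hx : 0 ≤ x) : ENNReal.ofReal x ^ 2 = ENNReal.ofReal (x ^ 2) := (ENNReal.ofReal_pow hx 2).symm

/-- outer part -/
theorem outer (hn : 1 ≤ n) {a ε : ℝ} (ha : 3 * (n:ℝ) < a) (hε : 0 < ε) (hε2 : 2 * ε < 1) {C : ℝ} (hC : 0 < C) : ∃ D, 0 < D ∧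
    ∀ (Φ : ℝ × Rn n → ℝ≥0∞) (_ : AEMeasurable Φ (PM n)) (c : Rn n) (r W : ℝ) (_ : 0 < r) (_ : 0 < W)
     (_ : ∀ t, 0 < t → ∀ y, ¬ (t < r ∧ dist y c < 2 * r) → Φ (t, y) ≤ ENNReal.ofReal (C * (W * ((r + t + dist y c) / t) ^ n * ((r + t + dist y c) / r) ^ ε)))
     (_ : ∀ t, 0 < t → ∀ y, (t < r ∧ dist y c < 2 * r) → Φ (t, y) = 0)
     (x x' : Rn n) (_ : x ∈ ball c r) (_ : x' ∈ ball c r), Gs a Φ x ≤ Gs a Φ x' + ENNReal.ofReal (D * W) := by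
  have hn' : (1:ℝ) ≤ n := by exact_mod_cast hn
  obtain ⟨L, hL, hL'⟩ := lint_half2 n (a - 3 * n) (a + 1 - 2 * n - 2 * ε) (by linarith) (by linarith) (by linarith)
  have ha1 : 1 ≤ a := by linarith
  have ha0 : 0 < a := by linarith
  obtain ⟨A, hA⟩ : ∃ A, A = 2 * a * 3 ^ (a + 1) := ⟨_, rfl⟩
  have hAp : 0 < A := by rw [hA]; positivity
  refine ⟨Real.sqrt (A * C ^ 2 * L), by positivity, ?_⟩
  intro Φ hΦ c r W hr hW h1 h0 x x' hx hx'
  apply Gs_le_of_sq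
  have hi : ∫⁻ p : ℝ × Rn n, ENNReal.ofReal (A * C ^ 2 * W ^ 2 * r ^ (1 - 2 * ε) * (p.1 ^ (a - 3 * n - 1) * (p.1 + r + dist p.2 c) ^ (-(a + 1 - 2 * n - 2 * ε)))) ∂(PM n)
      ≤ ENNReal.ofReal (A * C ^ 2 * L * W ^ 2) := by
    have hp : 0 ≤ A * C ^ 2 * W ^ 2 * r ^ (1 - 2 * ε) := by positivity
    simp_rw [ENNReal.ofReal_mul hp]
    rw [lintegral_const_mul' _ _ ENNReal.ofReal_ne_top]
    refine (mul_le_mul_right (hL' r hr c) _).trans ?_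
    rw [← ENNReal.ofReal_mul hp]
    apply ENNReal.ofReal_le_ofReal
    apply le_of_eq
    have : r ^ (1 - 2 * ε) * r ^ (a - 3 * n + n - (a + 1 - 2 * n - 2 * ε)) = 1 := by
      rw [← Real.rpow_add hr, ← Real.rpow_zero r]; congr 1; ring
    calc _ = A * C ^ 2 * W ^ 2 * L * (r ^ (1 - 2 * ε) * r ^ (a - 3 * n + n - (a + 1 - 2 * n - 2 * ε))) := by ring
      _ = _ := by rw [this]; ring
  calc ∫⁻ p, wt a x p * Φ p ^ 2 ∂(PM n) ≤ ∫⁻ p, (wt a x' p * Φ p ^ 2 + ENNReal.ofReal (A * C ^ 2 * W ^ 2 * r ^ (1 - 2 * ε) * (p.1 ^ (a - 3 * n - 1) * (p.1 + r + dist p.2 c) ^ (-(a + 1 - 2 * n - 2 * ε))))) ∂(PM n) := by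
        apply lintegral_mono_ae
        filter_upwards [PM_pos] with p hp
        obtain ⟨t, y⟩ := p
        replace hp : 0 < t := hp
        dsimp only
        by_cases hT : t < r ∧ dist y c < 2 * r
        · rw [h0 t hp y hT]; simp
        · have hyc := dist_nonneg (x := y) (y := c)
          have hR : 0 < r + t + dist y c := by linarith
          have w := wt_cmp (n := n) ha1 hr hx hx' hp hT
          refine (mul_le_mul_left w _).trans ?_
          rw [add_mul]
          apply add_le_add le_rfl
          refine (mul_le_mul_right (pow_le_pow_left₀ (by simp) (h1 t hp y hT) 2) _).trans ?_
          rw [enn_sq_ofReal (by positivity), ← hA, ← ENNReal.ofReal_mul (by positivity), sc_prod n hp hr hR, add_comm t r]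
    _ = ∫⁻ p, wt a x' p * Φ p ^ 2 ∂(PM n) + _ := by
        apply lintegral_add_right
        fun_prop
    _ ≤ Gs a Φ x' ^ 2 + ENNReal.ofReal (Real.sqrt (A * C ^ 2 * L) * W) ^ 2 := by
        rw [Gs_sq, enn_sq_ofReal (by positivity), mul_pow, Real.sq_sqrt (by positivity)]
        exact add_le_add le_rfl hi
    _ ≤ _ := by
        rw [add_sq]
        gcongr
        exact le_self_add

theorem inner_part (hn : 1 ≤ n) {a δ : ℝ} (ha : (n:ℝ) < a) (hδ : 0 < δ) {C : ℝ} (hC : 0 < C) : ∃ D, 0 < D ∧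
    ∀ (Φ : ℝ × Rn n → ℝ≥0∞) (r W : ℝ) (_ : 0 < r) (_ : 0 < W)
     (_ : ∀ t, 0 < t → t < r → ∀ y, Φ (t, y) ≤ ENNReal.ofReal (C * (W * (t / r) ^ δ)))
     (_ : ∀ t, 0 < t → r ≤ t → ∀ y, Φ (t, y) = 0)
     (x : Rn n), Gs a Φ x ≤ ENNReal.ofReal (D * W) := by
  obtain ⟨L, hL, hL'⟩ := lint_half n (a - n + δ) (2 * δ) a ha (by linarith) (by linarith)
  refine ⟨Real.sqrt (C ^ 2 * 2 ^ (2 * δ) * L), by positivity, ?_⟩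
  intro Φ r W hr hW h1 h0 x
  apply Gs_le_of_sq
  have hp : 0 ≤ C ^ 2 * W ^ 2 * 2 ^ (2 * δ) * r ^ δ := by positivity
  calc ∫⁻ p, wt a x p * Φ p ^ 2 ∂(PM n) ≤ ∫⁻ p, ENNReal.ofReal (C ^ 2 * W ^ 2 * 2 ^ (2 * δ) * r ^ δ) * ENNReal.ofReal (p.1 ^ (a - n + δ - 1) * (p.1 + r) ^ (-(2 * δ)) * (p.1 + dist p.2 x) ^ (-a)) ∂(PM n) := by
        apply lintegral_mono_ae
        filter_upwards [PM_pos] with p hp'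
        obtain ⟨t, y⟩ := p
        replace hp' : 0 < t := hp'
        dsimp only
        by_cases hT : t < r
        · refine (mul_le_mul_right (pow_le_pow_left₀ (by simp) (h1 t hp' hT y) 2) _).trans ?_
          rw [wt_eq a x hp', enn_sq_ofReal (by positivity), ← ENNReal.ofReal_mul (by positivity), ← ENNReal.ofReal_mul hp, dist_comm x y]
          apply ENNReal.ofReal_le_ofReal
          have hd := dist_nonneg (x := y) (y := x)
          have hD : 0 < (t + dist y x) ^ (-a) := Real.rpow_pos_of_pos (by linarith) _
          have e1 : t ^ (a - n + δ - 1) = t ^ (a - n - 1) * t ^ δ := by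
            rw [← Real.rpow_add hp']; congr 1; ring
          have e2 : (t / r) ^ δ * (t / r) ^ δ ≤ 2 ^ (2 * δ) * r ^ δ * (t ^ δ * (t + r) ^ (-(2 * δ))) := by
            have f1 : (t / r) ^ δ ≤ 1 := Real.rpow_le_one (by positivity) ((div_le_one hr).2 hT.le) hδ.le
            have f2 : (r + r) ^ (-(2 * δ)) ≤ (t + r) ^ (-(2 * δ)) := Real.rpow_le_rpow_of_nonpos (by linarith) (by linarith) (by linarith)
            have f3 : (r + r) ^ (-(2 * δ)) = (2 ^ (2 * δ))⁻¹ * (r ^ δ)⁻¹ * (r ^ δ)⁻¹ := by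
              rw [← two_mul, Real.mul_rpow (by norm_num) hr.le, Real.rpow_neg (by norm_num), ← Real.rpow_neg hr.le, mul_assoc, ← Real.rpow_add hr]
              congr 2; ring
            calc _ ≤ (t / r) ^ δ * 1 := by gcongr
              _ = 2 ^ (2 * δ) * r ^ δ * (t ^ δ * (r + r) ^ (-(2 * δ))) := by
                rw [f3, Real.div_rpow hp'.le hr.le]
                have := Real.rpow_pos_of_pos hr δ
                field_simp
              _ ≤ _ := by gcongr
          have hta := Real.rpow_pos_of_pos hp' (a - n - 1)
          calc _ = C ^ 2 * W ^ 2 * (t ^ (a - n - 1) * (t + dist y x) ^ (-a)) * ((t / r) ^ δ * (t / r) ^ δ) := by ring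
            _ ≤ C ^ 2 * W ^ 2 * (t ^ (a - n - 1) * (t + dist y x) ^ (-a)) * (2 ^ (2 * δ) * r ^ δ * (t ^ δ * (t + r) ^ (-(2 * δ)))) :=
                mul_le_mul_of_nonneg_left e2 (by positivity)
            _ = _ := by rw [e1]; ring
        · rw [h0 t hp' (not_lt.1 hT) y]; simp
    _ ≤ _ := by
        rw [lintegral_const_mul' _ _ ENNReal.ofReal_ne_top]
        refine (mul_le_mul_right (hL' r hr x) _).trans ?_
        rw [← ENNReal.ofReal_mul hp, enn_sq_ofReal (by positivity), mul_pow, Real.sq_sqrt (by positivity)]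
        apply ENNReal.ofReal_le_ofReal
        apply le_of_eq
        have : r ^ δ * r ^ (a - n + δ + n - a - 2 * δ) = 1 := by
          rw [← Real.rpow_add hr, ← Real.rpow_zero r]; congr 1; ring
        calc _ = C ^ 2 * W ^ 2 * 2 ^ (2 * δ) * L * (r ^ δ * r ^ (a - n + δ + n - a - 2 * δ)) := by ring
          _ = _ := by rw [this]; ring

theorem pointwise (hn : 1 ≤ n) {C₁ C₂ δ γ K : ℝ} (hC₁ : 0 < C₁) (hδ : 0 < δ) (hK : 1 ≤ K)
    {ψ : Rn n → ℝ} (hψ : PsiKernel n C₁ C₂ δ γ ψ) {a : ℝ} (ha : 3 * (n:ℝ) < a) : ∃ D, 0 < D ∧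
    ∀ (f : Rn n → ℝ) (μ : Measure (Rn n)) (_ : BAdm f μ K) (c : Rn n) (r W : ℝ) (_ : 0 < r) (_ : μ.real (ball c r) = W * r ^ n)
     (x x' : Rn n) (_ : x ∈ ball c r) (_ : x' ∈ ball c r),
     Gs a (Phi ψ f) x ≤ Gs a (Phi ψ (hQ f (pQ c r) (8 * r))) x + ENNReal.ofReal (D * W) + Gs a (Phi ψ f) x' := by
  have hn' : (1:ℝ) ≤ n := by exact_mod_cast hn
  obtain ⟨ε, hε, hεm⟩ : ∃ ε, 0 < ε ∧ ε < min δ (1/2) := ⟨min δ (1/2) / 2, by positivity, half_lt_self (by positivity)⟩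
  have hεδ : ε < δ := hεm.trans_le (min_le_left _ _)
  have hε2 : 2 * ε < 1 := by have := hεm.trans_le (min_le_right _ _); linarith
  obtain ⟨C, hC, hP⟩ := Phi_main n hC₁ hK hε hεδ hψ
  obtain ⟨D1, hD1, hO⟩ := outer hn ha hε hε2 hC
  obtain ⟨D2, hD2, hI⟩ := inner_part hn (show (n:ℝ) < a by linarith) hδ hC
  refine ⟨D1 + D2, by positivity, ?_⟩
  intro f μ A c r W hr hW x x' hx hx'
  have hWp := A.Wp hr hW
  obtain ⟨T, hTd⟩ : ∃ T : Set (ℝ × Rn n), T = {p | p.1 < r ∧ dist p.2 c < 2 * r} := ⟨_, rfl⟩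
  have hT : MeasurableSet T := by
    rw [hTd]
    exact (measurableSet_lt measurable_fst measurable_const).inter (measurableSet_lt (measurable_snd.dist measurable_const) measurable_const)
  have hmT : ∀ t y, (t, y) ∈ T ↔ (t < r ∧ dist y c < 2 * r) := by intro t y; rw [hTd]; rfl
  have hΦ : AEMeasurable (Phi ψ f) (PM n) := Phi_aemeas hψ.1.1 A.loc.aestronglyMeasurable
  have hΦ1 : AEMeasurable (Phi ψ (hQ f (pQ c r) (8 * r))) (PM n) := Phi_aemeas hψ.1.1 (hQ_int A.loc _ (by positivity)).1
  have hsmall : Measurable (T.indicator fun p : ℝ × Rn n => ENNReal.ofReal (C * (W * (p.1 / r) ^ δ))) := by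
    refine Measurable.indicator ?_ hT
    fun_prop
  have s1 : Gs a (Phi ψ f) x ≤ Gs a (T.indicator (Phi ψ f)) x + Gs a (Tᶜ.indicator (Phi ψ f)) x := by
    have := Gs_add a (hΦ.indicator hT) (hΦ.indicator hT.compl) x
    rwa [indicator_self_add_compl] at this
  have s2 : Gs a (T.indicator (Phi ψ f)) x ≤ Gs a (Phi ψ (hQ f (pQ c r) (8 * r))) x + Gs a (T.indicator fun p : ℝ × Rn n => ENNReal.ofReal (C * (W * (p.1 / r) ^ δ))) x := by
    refine le_trans (Gs_mono ?_ x) (Gs_add a hΦ1 hsmall.aemeasurable x)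
    rintro ⟨t, y⟩ ht
    replace ht : 0 < t := ht
    rw [Pi.add_apply]
    by_cases h : (t, y) ∈ T
    · rw [indicator_of_mem h, indicator_of_mem h]
      exact (hP f μ A c r W hr hW t ht y).2 ((hmT t y).1 h).2
    · rw [indicator_of_notMem h]; exact zero_le
  have s3 : Gs a (T.indicator fun p : ℝ × Rn n => ENNReal.ofReal (C * (W * (p.1 / r) ^ δ))) x ≤ ENNReal.ofReal (D2 * W) := by
    refine hI _ r W hr hWp ?_ ?_ x
    · intro t ht htr y
      exact indicator_le_self T (fun p : ℝ × Rn n => ENNReal.ofReal (C * (W * (p.1 / r) ^ δ))) (t, y)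
    · intro t ht htr y
      apply indicator_of_notMem
      rw [hmT]; intro h; linarith [h.1]
  have s4 : Gs a (Tᶜ.indicator (Phi ψ f)) x ≤ Gs a (Tᶜ.indicator (Phi ψ f)) x' + ENNReal.ofReal (D1 * W) := by
    refine hO _ (hΦ.indicator hT.compl) c r W hr hWp ?_ ?_ x x' hx hx'
    · intro t ht y h
      rw [indicator_of_mem (by rw [mem_compl_iff, hmT]; exact h)]
      exact (hP f μ A c r W hr hW t ht y).1
    · intro t ht y h
      apply indicator_of_notMem
      rw [mem_compl_iff, hmT, not_not]; exact h
  have s5 : Gs a (Tᶜ.indicator (Phi ψ f)) x' ≤ Gs a (Phi ψ f) x' := Gs_mono (fun p _ => indicator_le_self _ _ p) x'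
  calc _ ≤ (Gs a (Phi ψ (hQ f (pQ c r) (8 * r))) x + ENNReal.ofReal (D2 * W)) + (Gs a (Phi ψ f) x' + ENNReal.ofReal (D1 * W)) := by
        refine s1.trans (add_le_add (s2.trans (add_le_add le_rfl s3)) (s4.trans (add_le_add s5 le_rfl)))
    _ = _ := by
        rw [add_mul, ENNReal.ofReal_add (by positivity) (by positivity)]; ring

end PG1

section PG2
theorem ball_est (hn : 1 ≤ n) {C₁ C₂ δ γ K : ℝ} (hC₁ : 0 < C₁) (hC₂ : 0 < C₂) (hδ : 0 < δ) (hγ : 0 < γ) (hK : 1 ≤ K)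
    {ψ : Rn n → ℝ} (hψ : PsiKernel n C₁ C₂ δ γ ψ) {a : ℝ} (ha : 3 * (n:ℝ) + 2 * δ + 2 * γ < a) : ∃ D, 0 < D ∧
    ∀ (f : Rn n → ℝ) (μ : Measure (Rn n)) (_ : BAdm f μ K) (c : Rn n) (r : ℝ) (_ : 0 < r),
     ∃ H : Rn n → ℝ≥0∞, Measurable H ∧ ∫⁻ x in ball c r, H x ≤ ENNReal.ofReal (D * μ.real (ball c r)) ∧
     ∀ x ∈ ball c r, ∀ x' ∈ ball c r, Gs a (Phi ψ f) x ≤ H x + Gs a (Phi ψ f) x' := by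
  obtain ⟨D1, hD1, hi⟩ := iter hn hC₁ hC₂ hδ hγ hψ ha
  obtain ⟨D2, hD2, hp⟩ := pointwise hn hC₁ hδ hK hψ (show 3 * (n:ℝ) < a by linarith)
  have hV := VB_pos (n := n)
  obtain ⟨K₂, hK₂⟩ : ∃ k, k = (2*(K*(VB n*((n:ℝ)+1)^n))) := ⟨_, rfl⟩
  obtain ⟨K₃, hK₃⟩ : ∃ k, k = (1+K*(VB n*((n:ℝ)+1)^n)) := ⟨_, rfl⟩
  have k2 : 0 < K₂ := by rw [hK₂]; positivity
  have k3 : 0 < K₃ := by rw [hK₃]; positivity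
  refine ⟨D1 * K₂ * K₃ * (K * (8 * (n + 1)) ^ n) + D2 * VB n, by positivity, ?_⟩
  intro f μ A c r hr
  obtain ⟨W, hW⟩ : ∃ W, μ.real (ball c r) = W * r ^ n := ⟨μ.real (ball c r) / r ^ n, by field_simp⟩
  have hWp := A.Wp hr hW
  have hr8 : 0 < 8 * r := by positivity
  have hm : Measurable (Gs a (Phi ψ (hQ f (pQ c r) (8 * r)))) :=
    Gs_meas a (Phi_aemeas hψ.1.1 (hQ_int A.loc _ hr8).1)
  refine ⟨fun x => Gs a (Phi ψ (hQ f (pQ c r) (8 * r))) x + ENNReal.ofReal (D2 * W), hm.add_const _, ?_, ?_⟩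
  · rw [lintegral_add_right _ measurable_const, setLIntegral_const, vol_ball c hr]
    have h1 : ∫⁻ x in ball c r, Gs a (Phi ψ (hQ f (pQ c r) (8 * r))) x ≤ ENNReal.ofReal (D1 * K₂ * K₃ * (K * (8 * (n + 1)) ^ n * (W * r ^ n))) := by
      have hAd := A.adm
      rw [← hK₂, ← hK₃] at hAd
      refine (setLIntegral_le_lintegral _ _).trans ((hi f μ K₂ K₃ hAd (pQ c r) (8 * r) hr8).trans ?_)
      rw [ENNReal.ofReal_mul (p := D1 * K₂ * K₃) (by positivity)]
      gcongr
      refine (measure_mono (dc_sub_ball (pQ c r) hr8)).trans ?_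
      rw [← ofReal_measureReal (A.b4 _ _ (by positivity)).ne]
      exact ENNReal.ofReal_le_ofReal (Q_mu A c hr hW)
    refine (add_le_add h1 le_rfl).trans ?_
    rw [← ENNReal.ofReal_mul (by positivity), ← ENNReal.ofReal_add (by positivity) (by positivity), hW]
    apply ENNReal.ofReal_le_ofReal
    apply le_of_eq; ring
  · intro x hx x' hx'
    exact hp f μ A c r W hr hW x x' hx hx'

theorem w_pos {ω : Rn n → ℝ} (hω : IsWeight ω) (c : Rn n) {r : ℝ} (hr : 0 < r) : 0 < wInt ω (ball c r) := by
  unfold wInt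
  rw [setIntegral_pos_iff_support_of_nonneg_ae (by filter_upwards with x using hω.1 x) (ball_int hω.2.1 c r)]
  have : volume (Function.support ω ∩ ball c r) = volume (ball c r) := by
    apply measure_congr
    filter_upwards [hω.2.2] with x hx
    apply propext
    constructor
    · intro h; exact h.2
    · intro h; exact ⟨hx.ne', h⟩
  rw [this]
  exact measure_ball_pos _ _ hr

theorem mu_ball {ω : Rn n → ℝ} (hω : IsWeight ω) {M : ℝ} (hM : 0 < M) (c : Rn n) (r : ℝ) :
    (volume.withDensity (fun x => ENNReal.ofReal (M * ω x))) (ball c r) = ENNReal.ofReal (M * wInt ω (ball c r)) := by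
  rw [withDensity_apply _ measurableSet_ball, wInt, ← integral_const_mul, ofReal_integral_eq_lintegral_ofReal ((ball_int hω.2.1 c r).const_mul M)]
  filter_upwards with x using mul_nonneg hM.le (hω.1 x)

theorem mk_BAdm {ω : Rn n → ℝ} (hω : IsWeight ω) {C : ℝ} (hA : A1ballBound ω C) {f : Rn n → ℝ} (hf : LocallyIntegrable f volume)
    {M : ℝ} (hM : 0 < M) (hb : bmoNorm ω f ≤ ENNReal.ofReal M) :
    BAdm f (volume.withDensity (fun x => ENNReal.ofReal (M * ω x))) (max 1 C) where
  loc := hf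
  k1 := le_max_left _ _
  b1 := by
    intro c r hr
    rw [mu_ball hω hM, ← ofReal_integral_eq_lintegral_ofReal (ball_int' hf c r _) (by filter_upwards with x using abs_nonneg _)]
    apply ENNReal.ofReal_le_ofReal
    have h1 : ENNReal.ofReal (bmoAvg ω f (ball c r)) ≤ ENNReal.ofReal M :=
      le_trans (le_iSup_of_le c (le_iSup_of_le r (le_iSup (fun _ : 0 < r => ENNReal.ofReal (bmoAvg ω f (ball c r))) hr))) hb
    have h2 := (ENNReal.ofReal_le_ofReal_iff hM.le).1 h1
    have hw := w_pos hω c hr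
    unfold bmoAvg at h2
    rw [inv_mul_le_iff₀ hw] at h2
    linarith
  b2 := by
    intro c r hr E hE hEm
    have hC := hA.1
    have hv : 0 < volume.real (ball c r) := by rw [vol_ball_real c hr]; have := VB_pos (n := n); positivity
    have hw := w_pos hω c hr
    have e : wInt ω (ball c r) = volume.real (ball c r) * avg ω (ball c r) := by
      unfold avg wInt; rw [← Measure.real, mul_inv_cancel_left₀ hv.ne']
    have hav : 0 < avg ω (ball c r) := by
      rw [e] at hw; exact pos_of_mul_pos_right hw hv.le
    have hae : ∀ᵐ x ∂(volume.restrict (ball c r)), avg ω (ball c r) ≤ C * ω x := by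
      have hbd : Filter.IsBoundedUnder (· ≥ ·) (ae (volume.restrict (ball c r))) ω :=
        ⟨0, by rw [Filter.eventually_map]; filter_upwards with x using hω.1 x⟩
      filter_upwards [ae_essInf_le (f := ω) (hf := hbd)] with x hx
      exact (hA.2 c r hr).trans (mul_le_mul_of_nonneg_left hx hC.le)
    have hlow : ENNReal.ofReal (M * avg ω (ball c r)) * volume E ≤ ENNReal.ofReal C * (volume.withDensity (fun x => ENNReal.ofReal (M * ω x))) E := by
      rw [withDensity_apply _ hEm, ← lintegral_const_mul' _ _ ENNReal.ofReal_ne_top, ← setLIntegral_const]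
      apply lintegral_mono_ae
      filter_upwards [ae_mono (Measure.restrict_mono hE le_rfl) hae] with x hx
      rw [← ENNReal.ofReal_mul hC.le]
      apply ENNReal.ofReal_le_ofReal
      nlinarith
    rw [mu_ball hω hM, e, show M * (volume.real (ball c r) * avg ω (ball c r)) = volume.real (ball c r) * (M * avg ω (ball c r)) by ring,
      ENNReal.ofReal_mul hv.le, ofReal_measureReal measure_ball_lt_top.ne, mul_assoc]
    calc _ ≤ volume (ball c r) * (ENNReal.ofReal C * (volume.withDensity (fun x => ENNReal.ofReal (M * ω x))) E) := by gcongr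
      _ = ENNReal.ofReal C * volume (ball c r) * (volume.withDensity (fun x => ENNReal.ofReal (M * ω x))) E := by ring
      _ ≤ _ := by gcongr; exact le_max_right _ _
  b3 := by
    intro c r hr
    rw [mu_ball hω hM, ENNReal.ofReal_pos]
    exact mul_pos hM (w_pos hω c hr)
  b4 := by
    intro c r hr
    rw [mu_ball hω hM]; exact ENNReal.ofReal_lt_top

theorem blo_ball {G H : Rn n → ℝ≥0∞} {c : Rn n} {r : ℝ} (hr : 0 < r) (hH : Measurable H) {L : ℝ} (hL : 0 ≤ L)
    (hHL : ∫⁻ x in ball c r, H x ≤ ENNReal.ofReal L) (hG : ∀ᵐ x, G x < ⊤)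
    (h : ∀ x ∈ ball c r, ∀ x' ∈ ball c r, G x ≤ H x + G x') :
    ∫ x in ball c r, ((G x).toReal - essInf (fun x => (G x).toReal) (volume.restrict (ball c r))) ≤ L := by
  obtain ⟨ν, hν⟩ : ∃ ν, ν = (volume : Measure (Rn n)).restrict (ball c r) := ⟨_, rfl⟩
  rw [← hν] at hHL ⊢
  have hne : ν ≠ 0 := by
    rw [hν, Ne, Measure.restrict_eq_zero]; exact (measure_ball_pos _ _ hr).ne'
  haveI : (ae ν).NeBot := ae_neBot.2 hne
  have hGν : ∀ᵐ x ∂ν, G x < ⊤ := by rw [hν]; exact ae_restrict_of_ae hG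
  have hmem : ∀ᵐ x ∂ν, x ∈ ball c r := by rw [hν]; exact ae_restrict_mem measurableSet_ball
  have hHfin : ∀ᵐ x ∂ν, H x < ⊤ := ae_lt_top hH (ne_top_of_le_ne_top ENNReal.ofReal_ne_top hHL)
  have hbd : Filter.IsBoundedUnder (· ≥ ·) (ae ν) (fun x => (G x).toReal) :=
    ⟨0, by rw [Filter.eventually_map]; filter_upwards with x using ENNReal.toReal_nonneg⟩
  have hcob : Filter.IsCoboundedUnder (· ≥ ·) (ae ν) (fun x => (G x).toReal) := by
    by_contra hcon
    have : ∀ k : ℕ, ∀ᵐ x ∂ν, (k:ℝ) < (G x).toReal := by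
      intro k
      by_contra hk
      apply hcon
      refine Filter.IsCoboundedUnder.of_frequently_le (a := (k:ℝ)) ?_
      refine (Filter.not_eventually.1 hk).mono ?_
      intro x hx; exact not_lt.1 hx
    obtain ⟨x, hx⟩ := (ae_all_iff.2 this).exists
    obtain ⟨k, hk⟩ := exists_nat_ge (G x).toReal
    linarith [hx k]
  have hle : ∀ᵐ x ∂ν, (G x).toReal - essInf (fun x => (G x).toReal) ν ≤ (H x).toReal := by
    filter_upwards [hGν, hmem, hHfin] with x h1 h2 h3
    have : (G x).toReal - (H x).toReal ≤ essInf (fun x => (G x).toReal) ν := by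
      apply Filter.le_liminf_of_le hcob
      filter_upwards [hGν, hmem] with x' h1' h2'
      have := ENNReal.toReal_mono (ENNReal.add_ne_top.2 ⟨h3.ne, h1'.ne⟩) (h x h2 x' h2')
      rw [ENNReal.toReal_add h3.ne h1'.ne] at this
      linarith
    linarith
  have hnn : ∀ᵐ x ∂ν, 0 ≤ (G x).toReal - essInf (fun x => (G x).toReal) ν := by
    filter_upwards [ae_essInf_le (f := fun x => (G x).toReal) (hf := hbd)] with x hx
    linarith
  have hHi : Integrable (fun x => (H x).toReal) ν :=
    integrable_toReal_of_lintegral_ne_top hH.aemeasurable (ne_top_of_le_ne_top ENNReal.ofReal_ne_top hHL)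
  refine (integral_mono_of_nonneg hnn hHi hle).trans ?_
  rw [integral_toReal hH.aemeasurable hHfin]
  exact ENNReal.toReal_le_of_le_ofReal hL hHL

theorem final_aux (hn : 1 ≤ n) {C₁ C₂ δ γ : ℝ} (hC₁ : 0 < C₁) (hC₂ : 0 < C₂) (hδ : 0 < δ) (hγ : 0 < γ)
    {ψ : Rn n → ℝ} (hψ : PsiKernel n C₁ C₂ δ γ ψ) {lam : ℝ} (ha : (lam - 3) * n > 2 * δ + 2 * γ)
    {ω : Rn n → ℝ} (hω : IsWeight ω) (hA : IsA1ball ω) :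
    ∃ C : ℝ, 0 < C ∧ ∀ f : Rn n → ℝ, LocallyIntegrable f volume → bmoNorm ω f < ⊤ →
      ∀ x₀ : Rn n, Gstar ψ lam f x₀ < ⊤ →
        (∀ᵐ x ∂(volume : Measure (Rn n)), Gstar ψ lam f x < ⊤) ∧
        bloNorm ω (fun x => (Gstar ψ lam f x).toReal) ≤ ENNReal.ofReal C * bmoNorm ω f := by
  obtain ⟨C, hC⟩ := hA
  obtain ⟨D, hD, hD'⟩ := ball_est hn hC₁ hC₂ hδ hγ (le_max_left 1 C) hψ (a := lam * n) (by linarith)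
  refine ⟨D, hD, ?_⟩
  intro f hf hb x₀ hx₀
  have hGe : ∀ x, Gstar ψ lam f x = Gs (lam * n) (Phi ψ f) x := Gstar_eq hψ.1.1 hf.aestronglyMeasurable lam
  simp_rw [hGe] at hx₀ ⊢
  have est : ∀ M, (bmoNorm ω f).toReal < M → ∀ c r, 0 < r → ∃ H : Rn n → ℝ≥0∞, Measurable H ∧ ∫⁻ x in ball c r, H x ≤ ENNReal.ofReal (D * (M * wInt ω (ball c r))) ∧
     ∀ x ∈ ball c r, ∀ x' ∈ ball c r, Gs (lam * n) (Phi ψ f) x ≤ H x + Gs (lam * n) (Phi ψ f) x' := by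
    intro M hM c r hr
    have hM0 : 0 < M := ENNReal.toReal_nonneg.trans_lt hM
    have hbM : bmoNorm ω f ≤ ENNReal.ofReal M := by
      rw [← ENNReal.ofReal_toReal hb.ne]; exact ENNReal.ofReal_le_ofReal hM.le
    have := hD' f _ (mk_BAdm hω hC hf hM0 hbM) c r hr
    have hw := w_pos hω c hr
    rwa [Measure.real, mu_ball hω hM0, ENNReal.toReal_ofReal (by positivity)] at this
  have hfin : ∀ᵐ x ∂(volume : Measure (Rn n)), Gs (lam * n) (Phi ψ f) x < ⊤ := by
    have hk : ∀ k : ℕ, ∀ᵐ x ∂(volume : Measure (Rn n)), x ∈ ball x₀ (k + 1) → Gs (lam * n) (Phi ψ f) x < ⊤ := by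
      intro k
      obtain ⟨H, hH, hHL, h⟩ := est ((bmoNorm ω f).toReal + 1) (by linarith) x₀ (k + 1) (by positivity)
      have hHfin := ae_lt_top hH (ne_top_of_le_ne_top ENNReal.ofReal_ne_top hHL)
      rw [ae_restrict_iff' measurableSet_ball] at hHfin
      filter_upwards [hHfin] with x hx hxb
      refine (h x hxb x₀ (mem_ball_self (by positivity))).trans_lt ?_
      exact ENNReal.add_lt_top.2 ⟨hx hxb, hx₀⟩
    filter_upwards [ae_all_iff.2 hk] with x hx
    obtain ⟨k, hk⟩ := exists_nat_ge (dist x x₀)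
    exact hx k (by rw [mem_ball]; linarith)
  refine ⟨hfin, ?_⟩
  unfold bloNorm
  refine iSup_le fun c => iSup_le fun r => iSup_le fun hr => ?_
  have hw := w_pos hω c hr
  rw [← ENNReal.ofReal_toReal hb.ne, ← ENNReal.ofReal_mul hD.le]
  apply ENNReal.ofReal_le_ofReal
  have key : ∀ M, (bmoNorm ω f).toReal < M → bloAvg ω (fun x => (Gs (lam * n) (Phi ψ f) x).toReal) (ball c r) / D ≤ M := by
    intro M hM
    have hM0 : 0 < M := ENNReal.toReal_nonneg.trans_lt hM
    obtain ⟨H, hH, hHL, h⟩ := est M hM c r hr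
    have := blo_ball hr hH (by positivity) hHL hfin h
    rw [div_le_iff₀ hD]
    unfold bloAvg
    rw [inv_mul_le_iff₀ hw]
    linarith
  have := le_of_forall_gt_imp_ge_of_dense key
  rw [div_le_iff₀ hD] at this
  linarith

end PG2

theorem bmo_blo_of_Gstar (n : ℕ) (hn : 1 ≤ n) (C₁ C₂ δ γ : ℝ)
    (hC₁ : 0 < C₁) (hC₂ : 0 < C₂) (hδ : 0 < δ) (hγ : 0 < γ)
    (ψ : Rn n → ℝ) (hψ : PsiKernel n C₁ C₂ δ γ ψ)
    (lam : ℝ) (hlam : 2 < lam) (hlamn : (lam - 3) * (n : ℝ) > 2 * δ + 2 * γ)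
    (ω : Rn n → ℝ) (hω : IsWeight ω) (hA1 : IsA1ball ω) :
    ∃ C : ℝ, 0 < C ∧ ∀ f : Rn n → ℝ, LocallyIntegrable f volume →
      bmoNorm ω f < ⊤ →
      ∀ x₀ : Rn n, Gstar ψ lam f x₀ < ⊤ →
        (∀ᵐ x ∂(volume : Measure (Rn n)), Gstar ψ lam f x < ⊤) ∧
        bloNorm ω (fun x => (Gstar ψ lam f x).toReal) ≤ ENNReal.ofReal C * bmoNorm ω f := by
  exact final_aux hn hC₁ hC₂ hδ hγ hψ hlamn hω hA1

end LPW
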